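/- arXiv:1408.2951 — 4 statements merged into one kernel-verified Lean document; each statement's English description precedes it below -/
import Mathlib

section
/- (Theorem 1) Let n, m be integers with m ≥ 1 and n − m ≥ 2. Then the singular value shrinkage prior π_SVS is superharmonic on ℝ^{nm}: it is lower semicontinuous, not identically +∞, and for every M ∈ ℝ^{n×m} and every δ > 0, the integral of π_SVS over the sphere {X ∈ ℝ^{n×m} : ‖X − M‖_F = δ} with respect to the normalized (nm−1)-dimensional surface (Hausdorff) measure is at most π_SVS(M). -/
open Matrix MeasureTheory Metric ENNReal
open scoped Classical

/-- The matrix in `ℝ^{n×m}` corresponding to a point of `ℝ^{nm}`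
(the identification via entries). -/
def toMat {n m : ℕ} (x : EuclideanSpace ℝ (Fin n × Fin m)) : Matrix (Fin n) (Fin m) ℝ :=
  fun i a => x (i, a)

/-- The singular value shrinkage prior `π_SVS(M) = det(MᵀM)^{-(n-m-1)/2}` if `MᵀM` is
invertible, and `+∞` otherwise, viewed as a function on `ℝ^{nm}`. -/
noncomputable def piSVS (n m : ℕ) (x : EuclideanSpace ℝ (Fin n × Fin m)) : ℝ≥0∞ :=
  if IsUnit ((toMat x)ᵀ * toMat x).det then
    ENNReal.ofReal ((((toMat x)ᵀ * toMat x).det) ^ (-(((n : ℝ) - m - 1)) / 2))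
  else ⊤

section analysis

variable {E : Type*} [NormedAddCommGroup E] [InnerProductSpace ℝ E] [FiniteDimensional ℝ E]
  [MeasurableSpace E] [BorelSpace E]

lemma integrable_of_cont {ν : Measure E} [IsFiniteMeasure ν] {K : Set E} (hK : IsCompact K)
    (hν : ∀ᵐ y ∂ν, y ∈ K) {f : E → ℝ} (hf : Continuous f) : Integrable f ν := by
  obtain ⟨C, hC⟩ := hK.exists_bound_of_continuousOn hf.continuousOn
  exact Integrable.of_bound hf.aestronglyMeasurable C (hν.mono fun y hy => hC y hy)

lemma hasDerivAt_param {ν : Measure E} [IsFiniteMeasure ν] {K : Set E} (hK : IsCompact K)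
    (hν : ∀ᵐ y ∂ν, y ∈ K) {F F' : ℝ → E → ℝ}
    (hF : Continuous (Function.uncurry F)) (hF' : Continuous (Function.uncurry F'))
    (hd : ∀ r y, HasDerivAt (fun r => F r y) (F' r y) r) (r₀ : ℝ) :
    HasDerivAt (fun r => ∫ y, F r y ∂ν) (∫ y, F' r₀ y ∂ν) r₀ := by
  obtain ⟨C, hC⟩ := ((isCompact_closedBall r₀ (1:ℝ)).prod hK).exists_bound_of_continuousOn
    hF'.continuousOn
  have hc : ∀ r, Continuous (F r) := fun r => hF.comp (by fun_prop : Continuous fun y => (r, y))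
  have hc' : ∀ r, Continuous (F' r) := fun r => hF'.comp (by fun_prop : Continuous fun y => (r, y))
  refine (hasDerivAt_integral_of_dominated_loc_of_deriv_le
    (closedBall_mem_nhds r₀ one_pos) (bound := fun _ => C)
    (Filter.Eventually.of_forall fun r => (hc r).aestronglyMeasurable)
    (integrable_of_cont hK hν (hc r₀)) (hc' r₀).aestronglyMeasurable ?_ (integrable_const _) ?_).2
  · filter_upwards [hν] with y hy r hr
    exact hC (r, y) ⟨hr, hy⟩
  · exact Filter.Eventually.of_forall fun y r _ => hd r y

lemma integral_skew {ν : Measure E} [IsFiniteMeasure ν] {K : Set E} (hK : IsCompact K)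
    (hν : ∀ᵐ y ∂ν, y ∈ K) (hinv : ∀ L : E ≃ₗᵢ[ℝ] E, Measure.map L ν = ν)
    (A : E →L[ℝ] E) (hA : A ∈ skewAdjoint (E →L[ℝ] E)) {G : E → ℝ} (hG : ContDiff ℝ 1 G) :
    ∫ y, fderiv ℝ G y (A y) ∂ν = 0 := by
  have hG' : Continuous (fderiv ℝ G) := hG.continuous_fderiv one_ne_zero
  have hGd : Differentiable ℝ G := hG.differentiable one_ne_zero
  let : NormedAlgebra ℚ (E →L[ℝ] E) := NormedAlgebra.restrictScalars ℚ ℝ _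
  obtain ⟨e, he⟩ : ∃ e : ℝ → (E →L[ℝ] E), ∀ t, e t = NormedSpace.exp (t • A) := ⟨_, fun _ => rfl⟩
  have hexpd : ∀ t : ℝ, HasDerivAt e (e t * A) t := by
    intro t
    have h := hasDerivAt_exp_smul_const A t
    rw [show e = fun t : ℝ => NormedSpace.exp (t • A) from funext he]
    exact h
  have hexpc : Continuous e :=
    continuous_iff_continuousAt.2 fun t => (hexpd t).continuousAt
  have he0 : e 0 = 1 := by rw [he, zero_smul, NormedSpace.exp_zero]
  have key := hasDerivAt_param hK hν
    (F := fun t y => G (e t y))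
    (F' := fun t y => fderiv ℝ G (e t y) (e t (A y)))
    (by
      simp only [Function.uncurry_def]
      have := hG.continuous
      fun_prop)
    (by
      simp only [Function.uncurry_def]
      fun_prop)
    (by
      intro t y
      have h1 : HasDerivAt (fun u : ℝ => e u y)
          (e t (A y)) t := by
        simpa using (hexpd t).clm_apply (hasDerivAt_const t y)
      exact (hGd _).hasFDerivAt.comp_hasDerivAt t h1) 0
  have hconst : ∀ t : ℝ, ∫ y, G (e t y) ∂ν = ∫ y, G y ∂ν := by
    intro t
    have hmem : t • A ∈ skewAdjoint (E →L[ℝ] E) := skewAdjoint.smul_mem t hA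
    have hu := NormedSpace.exp_mem_unitary_of_mem_skewAdjoint hmem
    rw [← he] at hu
    let L := Unitary.linearIsometryEquiv (𝕜 := ℝ) (H := E) ⟨_, hu⟩
    have hL : ∀ y, L y = e t y := fun y => rfl
    conv_rhs => rw [← hinv L]
    rw [integral_map L.continuous.aemeasurable hG.continuous.aestronglyMeasurable]
    rfl
  simp only [hconst] at key
  have := key.unique (hasDerivAt_const _ _)
  simpa [he0] using this

lemma skewPlane_mem {ι : Type*} [Fintype ι] (b : OrthonormalBasis ι ℝ E) (i j : ι) :
    ((innerSL ℝ (b i)).smulRight (b j) - (innerSL ℝ (b j)).smulRight (b i) : E →L[ℝ] E)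
      ∈ skewAdjoint (E →L[ℝ] E) := by
  rw [skewAdjoint.mem_iff, ContinuousLinearMap.star_eq_adjoint]
  symm
  rw [ContinuousLinearMap.eq_adjoint_iff]
  intro x y
  simp [inner_sub_left, inner_sub_right, inner_smul_left, inner_smul_right]
  rw [real_inner_comm (b i) x, real_inner_comm (b j) x]
  ring

lemma mean_le {ι : Type*} [Fintype ι] (b : OrthonormalBasis ι ℝ E) (hι : 2 ≤ Fintype.card ι)
    {ν : Measure E} [IsProbabilityMeasure ν] {δ : ℝ}
    (hν : ∀ᵐ y ∂ν, y ∈ sphere (0:E) δ) (hinv : ∀ L : E ≃ₗᵢ[ℝ] E, Measure.map L ν = ν)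
    {g : E → ℝ} (hg : ContDiff ℝ 2 g)
    (hΔ : ∀ x, ∑ i, fderiv ℝ (fderiv ℝ g) x (b i) (b i) ≤ 0) (M : E) :
    ∫ y, g (M + y) ∂ν ≤ g M := by
  have hK : IsCompact (sphere (0:E) δ) := isCompact_sphere _ _
  have hg1 : ContDiff ℝ 1 (fderiv ℝ g) := hg.fderiv_right (by norm_num)
  have hgc := hg.continuous
  have hgc1 := hg1.continuous
  have hgc2 : Continuous (fderiv ℝ (fderiv ℝ g)) := hg1.continuous_fderiv one_ne_zero
  have hgd : Differentiable ℝ g := hg.differentiable two_ne_zero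
  have hgd1 : Differentiable ℝ (fderiv ℝ g) := hg1.differentiable one_ne_zero
  have hline : ∀ (r : ℝ) (y : E), HasDerivAt (fun r : ℝ => M + r • y) y r := by
    intro r y
    simpa using ((hasDerivAt_id r).smul_const y).const_add M
  set φ : ℝ → ℝ := fun r => ∫ y, g (M + r • y) ∂ν with hφ
  set φ1 : ℝ → ℝ := fun r => ∫ y, fderiv ℝ g (M + r • y) y ∂ν with hφ1
  set φ2 : ℝ → ℝ := fun r => ∫ y, fderiv ℝ (fderiv ℝ g) (M + r • y) y y ∂ν with hφ2
  have d1 : ∀ r, HasDerivAt φ (φ1 r) r := by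
    intro r
    refine hasDerivAt_param hK hν (F := fun r y => g (M + r • y))
      (F' := fun r y => fderiv ℝ g (M + r • y) y) ?_ ?_ ?_ r
    · simp only [Function.uncurry_def]; fun_prop
    · simp only [Function.uncurry_def]; fun_prop
    · intro r y
      exact (hgd _).hasFDerivAt.comp_hasDerivAt r (hline r y)
  have d2 : ∀ r, HasDerivAt φ1 (φ2 r) r := by
    intro r
    refine hasDerivAt_param hK hν (F := fun r y => fderiv ℝ g (M + r • y) y)
      (F' := fun r y => fderiv ℝ (fderiv ℝ g) (M + r • y) y y) ?_ ?_ ?_ r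
    · simp only [Function.uncurry_def]; fun_prop
    · simp only [Function.uncurry_def]; fun_prop
    · intro r y
      have := ((hgd1 _).hasFDerivAt.comp_hasDerivAt r (hline r y)).clm_apply (hasDerivAt_const r y)
      simpa using this
  -- the rotation identity
  set N := Fintype.card ι with hN
  have main : ∀ r : ℝ, 0 ≤ r → r * φ2 r + ((N:ℝ) - 1) * φ1 r ≤ 0 := by
    intro r hr
    have hrot : ∀ A ∈ skewAdjoint (E →L[ℝ] E),
        ∫ y, (r * fderiv ℝ (fderiv ℝ g) (M + r • y) (A y) (A y)
          + fderiv ℝ g (M + r • y) (A (A y))) ∂ν = 0 := by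
      intro A hA
      have h := integral_skew hK hν hinv A hA (G := fun y => fderiv ℝ g (M + r • y) (A y))
        (by
          have : ContDiff ℝ 1 (fun y : E => M + r • y) := by fun_prop
          exact (hg1.comp this).clm_apply A.contDiff)
      rw [← h]
      congr 1
      ext y
      have ha : HasFDerivAt (fun y : E => M + r • y) (r • ContinuousLinearMap.id ℝ E) y :=
        ((hasFDerivAt_id y).const_smul r).const_add M
      have hb := ((hgd1 (M + r • y)).hasFDerivAt.comp y ha).clm_apply (A.hasFDerivAt (x := y))
      rw [show (fun y => fderiv ℝ g (M + r • y) (A y)) =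
        (fun y => (fderiv ℝ g ∘ fun y => M + r • y) y (A y)) from rfl, hb.fderiv]
      simp
      ring
    let A : ι → ι → (E →L[ℝ] E) := fun i j =>
      (innerSL ℝ (b i)).smulRight (b j) - (innerSL ℝ (b j)).smulRight (b i)
    have hsum : ∫ y, ∑ i, ∑ j, (r * fderiv ℝ (fderiv ℝ g) (M + r • y) (A i j y) (A i j y)
          + fderiv ℝ g (M + r • y) (A i j (A i j y))) ∂ν = 0 := by
      rw [integral_finsetSum]
      · refine Finset.sum_eq_zero fun i _ => ?_
        rw [integral_finsetSum]
        · exact Finset.sum_eq_zero fun j _ => hrot _ (skewPlane_mem b i j)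
        · intro j _
          refine integrable_of_cont hK hν ?_
          fun_prop
      · intro i _
        refine integrable_of_cont hK hν ?_
        fun_prop
    have halg : ∀ y, ∑ i, ∑ j, (r * fderiv ℝ (fderiv ℝ g) (M + r • y) (A i j y) (A i j y)
          + fderiv ℝ g (M + r • y) (A i j (A i j y))) =
        2 * (r * (‖y‖^2 * ∑ i, fderiv ℝ (fderiv ℝ g) (M + r • y) (b i) (b i))
          - (r * fderiv ℝ (fderiv ℝ g) (M + r • y) y y
            + ((N:ℝ) - 1) * fderiv ℝ g (M + r • y) y)) := by
      intro y
      generalize fderiv ℝ (fderiv ℝ g) (M + r • y) = H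
      generalize fderiv ℝ g (M + r • y) = D
      have hy : y = ∑ i, inner ℝ (b i) y • b i := (b.sum_repr' y).symm
      have hn : ‖y‖^2 = ∑ i, inner ℝ (b i) y ^ 2 := (b.sum_sq_inner_right y).symm
      have hδ : ∀ i j, inner ℝ (b i) (b j) = if i = j then (1:ℝ) else 0 :=
        orthonormal_iff_ite.1 b.orthonormal
      have hHy : H y y = ∑ i, ∑ j, inner ℝ (b i) y * inner ℝ (b j) y * H (b i) (b j) := by
        conv_lhs => rw [hy]
        simp [Finset.mul_sum, mul_assoc]
        rw [Finset.sum_comm]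
        refine Finset.sum_congr rfl fun i _ => Finset.sum_congr rfl fun j _ => ?_
        ring
      have hDy : D y = ∑ i, inner ℝ (b i) y * D (b i) := by
        conv_lhs => rw [hy]
        simp
      rw [hn, hHy, hDy]
      have hA1 : ∀ i j, A i j y = inner ℝ (b i) y • b j - inner ℝ (b j) y • b i := fun i j => by
        simp [A]
      have hA2 : ∀ i j, D (A i j (A i j y)) =
          (if i = j then inner ℝ (b i) y * D (b j) else 0)
          + (if i = j then inner ℝ (b j) y * D (b i) else 0)
          - inner ℝ (b j) y * D (b j) - inner ℝ (b i) y * D (b i) := by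
        intro i j
        rw [hA1]
        simp only [A, _root_.sub_apply, ContinuousLinearMap.smulRight_apply,
          innerSL_apply_apply, inner_sub_right, inner_smul_right, hδ, map_sub, map_smul, smul_eq_mul,
          if_true, eq_comm (a := j) (b := i)]
        by_cases h : i = j
        · simp [h]
        · simp [h]
          ring
      have hA3 : ∀ i j, H (A i j y) (A i j y) =
          inner ℝ (b i) y ^ 2 * H (b j) (b j) + H (b i) (b i) * inner ℝ (b j) y ^ 2
          - inner ℝ (b i) y * inner ℝ (b j) y * H (b i) (b j)
          - inner ℝ (b j) y * inner ℝ (b i) y * H (b j) (b i) := by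
        intro i j
        rw [hA1]
        simp only [map_sub, map_smul, _root_.sub_apply, _root_.smul_apply,
          smul_eq_mul]
        ring
      simp only [hA2, hA3]
      generalize hc : (fun i => inner ℝ (b i) y) = c
      have hc' : ∀ i, inner ℝ (b i) y = c i := fun i => congrFun hc i
      simp only [hc']
      have e1 : ∑ i, ∑ j, c j * c i * H (b j) (b i) = ∑ i, ∑ j, c i * c j * H (b i) (b j) :=
        Finset.sum_comm
      simp only [mul_add, mul_sub, Finset.sum_add_distrib, Finset.sum_sub_distrib,
        ← Finset.mul_sum, ← Finset.sum_mul, Finset.sum_ite_eq, Finset.mem_univ, if_true,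
        Finset.sum_const, Finset.card_univ, nsmul_eq_mul, e1]
      rw [← hN]
      have e2 : ∑ x, c x * ((N:ℝ) * D (b x)) = N * ∑ x, c x * D (b x) := by
        rw [Finset.mul_sum]
        exact Finset.sum_congr rfl fun x _ => by ring
      rw [e2]
      ring
    simp only [halg] at hsum
    have hle : ∫ y, 2 * (r * (‖y‖^2 * ∑ i, fderiv ℝ (fderiv ℝ g) (M + r • y) (b i) (b i))
          - (r * fderiv ℝ (fderiv ℝ g) (M + r • y) y y
            + ((N:ℝ) - 1) * fderiv ℝ g (M + r • y) y)) ∂ν ≤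
        ∫ y, -2 * (r * fderiv ℝ (fderiv ℝ g) (M + r • y) y y
            + ((N:ℝ) - 1) * fderiv ℝ g (M + r • y) y) ∂ν := by
      refine integral_mono (integrable_of_cont hK hν (by fun_prop))
        (integrable_of_cont hK hν (by fun_prop)) fun y => ?_
      have := mul_nonpos_of_nonneg_of_nonpos hr
        (mul_nonpos_of_nonneg_of_nonpos (sq_nonneg ‖y‖) (hΔ (M + r • y)))
      simp only
      linarith
    rw [hsum, integral_const_mul, integral_add (integrable_of_cont hK hν (by fun_prop))
      (integrable_of_cont hK hν (by fun_prop)), integral_const_mul, integral_const_mul] at hle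
    change 0 ≤ -2 * (r * φ2 r + ((N:ℝ) - 1) * φ1 r) at hle
    linarith
  -- integrate the ODE inequality
  obtain ⟨k, hk⟩ : ∃ k, N = k + 2 := ⟨N - 2, by omega⟩
  have d3 : ∀ r, HasDerivAt (fun r => r ^ (k+1) * φ1 r)
      (r ^ k * (r * φ2 r + ((N:ℝ) - 1) * φ1 r)) r := by
    intro r
    refine ((hasDerivAt_pow (k+1) r).mul (d2 r)).congr_deriv ?_
    rw [hk]; push_cast
    ring
  have hneg : ∀ r : ℝ, 0 < r → φ1 r ≤ 0 := by
    intro r hr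
    have hanti : AntitoneOn (fun r => r ^ (k+1) * φ1 r) (Set.Ici 0) := by
      refine antitoneOn_of_deriv_nonpos (convex_Ici 0)
        (fun r _ => (d3 r).continuousAt.continuousWithinAt)
        (fun r _ => (d3 r).differentiableAt.differentiableWithinAt) fun r hr => ?_
      rw [interior_Ici] at hr
      rw [(d3 r).deriv]
      exact mul_nonpos_of_nonneg_of_nonpos (pow_nonneg hr.le _) (main r hr.le)
    have := hanti (Set.mem_Ici.2 le_rfl) (Set.mem_Ici.2 hr.le) hr.le
    simp at this
    by_contra hcon
    push Not at hcon
    have := mul_pos (pow_pos hr (k+1)) hcon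
    linarith
  have hanti : AntitoneOn φ (Set.Ici 0) := by
    refine antitoneOn_of_deriv_nonpos (convex_Ici 0)
      (fun r _ => (d1 r).continuousAt.continuousWithinAt)
      (fun r _ => (d1 r).differentiableAt.differentiableWithinAt) fun r hr => ?_
    rw [interior_Ici] at hr
    rw [(d1 r).deriv]
    exact hneg r hr
  have := hanti (Set.mem_Ici.2 le_rfl) (Set.mem_Ici.2 zero_le_one) zero_le_one
  simpa [hφ] using this

end analysis
section matrixpart

lemma det_line {m : ℕ} (W : Matrix (Fin m) (Fin m) ℝ) (hW : IsUnit W.det) (hs : Wᵀ = W)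
    (e w : Fin m → ℝ) (t : ℝ) :
    (W + t • (vecMulVec e w + vecMulVec w e) + t ^ 2 • vecMulVec e e).det =
      W.det * (1 + 2 * (e ⬝ᵥ W⁻¹ *ᵥ w) * t +
        ((e ⬝ᵥ W⁻¹ *ᵥ w) ^ 2 + (e ⬝ᵥ W⁻¹ *ᵥ e)
          - (e ⬝ᵥ W⁻¹ *ᵥ e) * (w ⬝ᵥ W⁻¹ *ᵥ w)) * t ^ 2) := by
  let U1 : Matrix (Fin m) (Fin 2) ℝ := Matrix.of fun i k => ![e, t • w] k i
  let U2 : Matrix (Fin 2) (Fin m) ℝ := Matrix.of fun k i => ![t • w + t ^ 2 • e, e] k i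
  have h1 : W + t • (vecMulVec e w + vecMulVec w e) + t ^ 2 • vecMulVec e e
      = W * (1 + (W⁻¹ * U1) * U2) := by
    rw [mul_add, mul_one, Matrix.mul_assoc, Matrix.mul_nonsing_inv_cancel_left _ _ hW]
    ext i j
    simp [U1, U2, Matrix.mul_apply, Fin.sum_univ_two, vecMulVec_apply]
    ring
  have hV : (W⁻¹)ᵀ = W⁻¹ := by rw [Matrix.transpose_nonsing_inv, hs]
  have hsym : w ⬝ᵥ W⁻¹ *ᵥ e = e ⬝ᵥ W⁻¹ *ᵥ w := by
    rw [Matrix.dotProduct_mulVec, ← Matrix.mulVec_transpose, hV, dotProduct_comm]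
  have hent : ∀ k l, (U2 * (W⁻¹ * U1)) k l =
      ![t • w + t ^ 2 • e, e] k ⬝ᵥ W⁻¹ *ᵥ (![e, t • w] l) := by
    intro k l
    simp only [Matrix.mul_apply, dotProduct, mulVec, U1, U2, Matrix.of_apply]
  rw [h1, det_mul, det_one_add_mul_comm, det_fin_two]
  simp only [Matrix.add_apply, hent]
  simp [add_dotProduct, mulVec_smul, hsym]
  left
  ring

lemma second_deriv_line {E : Type*} [NormedAddCommGroup E] [NormedSpace ℝ E] {g : E → ℝ}
    (hg : ContDiff ℝ 2 g) (x e : E) (c β η s : ℝ)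
    (hpos : ∀ t : ℝ, 0 < 1 + 2 * β * t + η * t ^ 2)
    (hl : ∀ t : ℝ, g (x + t • e) = c * (1 + 2 * β * t + η * t ^ 2) ^ (-s)) :
    fderiv ℝ (fderiv ℝ g) x e e = c * (-s * (2 * η) + s * (s + 1) * (4 * β ^ 2)) := by
  have hg1 : ContDiff ℝ 1 (fderiv ℝ g) := hg.fderiv_right (by norm_num)
  have hgd : Differentiable ℝ g := hg.differentiable two_ne_zero
  have hgd1 : Differentiable ℝ (fderiv ℝ g) := hg1.differentiable one_ne_zero
  have hline : ∀ t : ℝ, HasDerivAt (fun r : ℝ => x + r • e) e t := by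
    intro r
    simpa using ((hasDerivAt_id r).smul_const e).const_add x
  have hp : ∀ t : ℝ, HasDerivAt (fun t : ℝ => 1 + 2 * β * t + η * t ^ 2) (2 * β + 2 * η * t) t := by
    intro t
    have h1 := (((hasDerivAt_id t).const_mul (2 * β)).const_add 1).add
      ((hasDerivAt_pow 2 t).const_mul η)
    refine h1.congr_deriv ?_
    simp
    ring
  have hg0 : ∀ t : ℝ, HasDerivAt (fun t : ℝ => g (x + t • e)) (fderiv ℝ g (x + t • e) e) t :=
    fun t => (hgd (x + t • e)).hasFDerivAt.comp_hasDerivAt t (hline t)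
  have hg2 : HasDerivAt (fun t : ℝ => fderiv ℝ g (x + t • e) e)
      (fderiv ℝ (fderiv ℝ g) (x + (0:ℝ) • e) e e) 0 := by
    have h1 : HasDerivAt (fun t : ℝ => fderiv ℝ g (x + t • e))
        (fderiv ℝ (fderiv ℝ g) (x + (0:ℝ) • e) e) 0 :=
      (hgd1 (x + (0:ℝ) • e)).hasFDerivAt.comp_hasDerivAt (0:ℝ) (hline 0)
    have h2 := h1.clm_apply (hasDerivAt_const (0:ℝ) e)
    rwa [map_zero, add_zero] at h2
  have d1 : ∀ t : ℝ, fderiv ℝ g (x + t • e) e =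
      c * ((2 * β + 2 * η * t) * (-s) * (1 + 2 * β * t + η * t ^ 2) ^ (-s - 1)) := by
    intro t
    have h2 := ((hp t).rpow_const (p := -s) (Or.inl (hpos t).ne')).const_mul c
    have h1 := hg0 t
    rw [funext hl] at h1
    exact h1.unique h2
  rw [funext d1] at hg2
  have h3 : HasDerivAt (fun t : ℝ => 2 * β + 2 * η * t) (2 * η) 0 := by
    simpa using ((hasDerivAt_id (0:ℝ)).const_mul (2 * η)).const_add (2 * β)
  have h2 := ((h3.mul_const (-s)).mul
    ((hp 0).rpow_const (p := -s - 1) (Or.inl (hpos 0).ne'))).const_mul c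
  have := hg2.unique h2
  simp at this
  rw [this]
  ring

variable {n m : ℕ}

/-- The regularized Gram matrix. -/
noncomputable def gramE (ε : ℝ) (x : EuclideanSpace ℝ (Fin n × Fin m)) :
    Matrix (Fin m) (Fin m) ℝ := (toMat x)ᵀ * toMat x + ε • 1

lemma gramE_posDef {ε : ℝ} (hε : 0 < ε) (x : EuclideanSpace ℝ (Fin n × Fin m)) :
    (gramE ε x).PosDef := by
  refine Matrix.PosDef.posSemidef_add ?_ (Matrix.PosDef.one.smul hε)
  have := Matrix.posSemidef_conjTranspose_mul_self (toMat x)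
  rwa [conjTranspose_eq_transpose_of_trivial] at this

lemma gramE_contDiff (ε : ℝ) :
    ContDiff ℝ 2 (fun x : EuclideanSpace ℝ (Fin n × Fin m) => (gramE ε x).det) := by
  simp only [gramE, det_apply, Matrix.add_apply, Matrix.mul_apply, toMat, transpose_apply,
    Matrix.smul_apply]
  refine ContDiff.sum fun σ _ => ContDiff.const_smul _ (contDiff_prod fun i _ => ?_)
  fun_prop

lemma gramE_line (ε : ℝ) (x : EuclideanSpace ℝ (Fin n × Fin m)) (i : Fin n) (a : Fin m) (t : ℝ) :
    gramE ε (x + t • EuclideanSpace.single (i, a) (1:ℝ)) =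
      gramE ε x + t • (vecMulVec (Pi.single a 1) (toMat x i) + vecMulVec (toMat x i) (Pi.single a 1))
        + t ^ 2 • vecMulVec (Pi.single a 1) (Pi.single a 1) := by
  have h : toMat (x + t • EuclideanSpace.single (i, a) (1:ℝ)) =
      toMat x + t • vecMulVec (Pi.single i 1) (Pi.single a 1) := by
    ext k c
    simp only [toMat, vecMulVec_apply, Pi.single_apply, Prod.ext_iff, PiLp.add_apply,
      PiLp.smul_apply, EuclideanSpace.single_apply, Matrix.add_apply, Matrix.smul_apply]
    by_cases h1 : k = i <;> by_cases h2 : c = a <;> simp [h1, h2]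
  have h1 : (toMat x)ᵀ * vecMulVec (Pi.single i (1:ℝ)) (Pi.single a (1:ℝ))
      = vecMulVec (toMat x i) (Pi.single a (1:ℝ)) := by
    rw [mul_vecMulVec]
    congr 1
    ext c
    simp
  have h2 : vecMulVec (Pi.single a (1:ℝ)) (Pi.single i (1:ℝ)) * toMat x
      = vecMulVec (Pi.single a (1:ℝ)) (toMat x i) := by
    rw [vecMulVec_mul]
    congr 1
    ext c
    simp
  have h3 : vecMulVec (Pi.single a (1:ℝ)) (Pi.single i (1:ℝ)) * vecMulVec (Pi.single i (1:ℝ)) (Pi.single a (1:ℝ))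
      = (vecMulVec (Pi.single a (1:ℝ)) (Pi.single a (1:ℝ)) : Matrix (Fin m) (Fin m) ℝ) := by
    rw [vecMulVec_mul_vecMulVec]
    simp
  simp only [gramE, h, transpose_add, transpose_smul, transpose_vecMulVec, Matrix.add_mul, Matrix.mul_add,
    Matrix.smul_mul, Matrix.mul_smul, h1, h2, h3, smul_add, smul_smul, pow_two]
  abel

lemma laplace_nonpos (hnm : m + 2 ≤ n) {ε : ℝ} (hε : 0 < ε)
    (x : EuclideanSpace ℝ (Fin n × Fin m)) :
    ∑ p, fderiv ℝ (fderiv ℝ (fun x : EuclideanSpace ℝ (Fin n × Fin m) =>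
      (gramE ε x).det ^ (-(((n:ℝ) - m - 1) / 2)))) x
      (EuclideanSpace.basisFun (Fin n × Fin m) ℝ p)
      (EuclideanSpace.basisFun (Fin n × Fin m) ℝ p) ≤ 0 := by
  set s : ℝ := ((n:ℝ) - m - 1) / 2 with hs
  have hnm' : (m:ℝ) + 2 ≤ n := by exact_mod_cast hnm
  have hs0 : 0 ≤ s := by rw [hs]; linarith
  set W := gramE ε x with hWdef
  have hW : W.PosDef := gramE_posDef hε x
  have hdet : 0 < W.det := hW.det_pos
  have hWu : IsUnit W.det := hdet.ne'.isUnit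
  have hWs : Wᵀ = W := by
    have := hW.isHermitian.eq
    rwa [conjTranspose_eq_transpose_of_trivial] at this
  set V := W⁻¹ with hV
  have hVs : Vᵀ = V := by rw [hV, Matrix.transpose_nonsing_inv, hWs]
  have hgc : ContDiff ℝ 2 (fun x : EuclideanSpace ℝ (Fin n × Fin m) => (gramE ε x).det ^ (-s)) :=
    (gramE_contDiff ε).rpow_const_of_ne fun x => (gramE_posDef hε x).det_pos.ne'
  set X := toMat x with hX
  let β : Fin n → Fin m → ℝ := fun i a => (V *ᵥ X i) a
  let γ : Fin n → ℝ := fun i => X i ⬝ᵥ V *ᵥ X i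
  have hterm : ∀ i a, fderiv ℝ (fderiv ℝ (fun x : EuclideanSpace ℝ (Fin n × Fin m) =>
      (gramE ε x).det ^ (-s))) x
      (EuclideanSpace.basisFun (Fin n × Fin m) ℝ (i, a))
      (EuclideanSpace.basisFun (Fin n × Fin m) ℝ (i, a)) =
      W.det ^ (-s) * (-s * (2 * (β i a ^ 2 + V a a - V a a * γ i))
        + s * (s + 1) * (4 * β i a ^ 2)) := by
    intro i a
    rw [EuclideanSpace.basisFun_apply]
    have hq : ∀ t : ℝ, (gramE ε (x + t • EuclideanSpace.single (i, a) (1:ℝ))).det =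
        W.det * (1 + 2 * β i a * t + (β i a ^ 2 + V a a - V a a * γ i) * t ^ 2) := by
      intro t
      rw [gramE_line, det_line W hWu hWs]
      simp [β, γ, ← hV, ← hX]
    have hpos : ∀ t : ℝ, 0 < 1 + 2 * β i a * t + (β i a ^ 2 + V a a - V a a * γ i) * t ^ 2 := by
      intro t
      have h := (gramE_posDef hε (x + t • EuclideanSpace.single (i, a) (1:ℝ))).det_pos
      rw [hq] at h
      exact (mul_pos_iff_of_pos_left hdet).1 h
    refine second_deriv_line hgc x _ _ _ _ _ hpos fun t => ?_
    rw [hq, Real.mul_rpow hdet.le (hpos t).le]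
  rw [Fintype.sum_prod_type]
  simp only [hterm]
  have hXX : Xᵀ * X = W - ε • 1 := by rw [hWdef, gramE]; simp [← hX]
  have hVW : V * W = 1 := Matrix.nonsing_inv_mul _ hWu
  have hB : ∑ i, ∑ a, β i a ^ 2 = V.trace - ε * (V * V).trace := by
    have h1 : ∑ i, ∑ a, β i a ^ 2 = ((X * V)ᵀ * (X * V)).trace := by
      rw [Finset.sum_comm]
      simp only [Matrix.trace, Matrix.diag_apply, Matrix.mul_apply, transpose_apply, pow_two, β,
        mulVec, dotProduct]
      refine Finset.sum_congr rfl fun a _ => Finset.sum_congr rfl fun i _ => ?_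
      have : ∑ c, V a c * X i c = ∑ c, X i c * V c a := by
        refine Finset.sum_congr rfl fun c _ => ?_
        rw [mul_comm]
        congr 1
        exact (congrFun (congrFun hVs c) a)
      rw [this]
    rw [h1, transpose_mul, hVs, show V * Xᵀ * (X * V) = V * (Xᵀ * X) * V by
      simp only [Matrix.mul_assoc], hXX, mul_sub, hVW, sub_mul, one_mul, trace_sub]
    simp
  have hG : ∑ i, γ i = m - ε * V.trace := by
    have h1 : ∑ i, γ i = (X * (V * Xᵀ)).trace := by
      simp only [Matrix.trace, Matrix.diag_apply, Matrix.mul_apply, transpose_apply, γ, mulVec,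
        dotProduct]
    rw [h1, trace_mul_comm, Matrix.mul_assoc, hXX, mul_sub, hVW, trace_sub]
    simp
  have hVV : 0 ≤ (V * V).trace := by
    nth_rewrite 1 [← hVs]
    simp only [Matrix.trace, Matrix.diag_apply, Matrix.mul_apply, transpose_apply]
    exact Finset.sum_nonneg fun i _ => Finset.sum_nonneg fun j _ => mul_self_nonneg _
  have htot : ∑ i, ∑ a, W.det ^ (-s) * (-s * (2 * (β i a ^ 2 + V a a - V a a * γ i))
        + s * (s + 1) * (4 * β i a ^ 2)) =
      W.det ^ (-s) * (-s * (2 * (∑ i, ∑ a, β i a ^ 2 + n * V.trace - V.trace * ∑ i, γ i))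
        + s * (s + 1) * (4 * ∑ i, ∑ a, β i a ^ 2)) := by
    simp only [← Finset.mul_sum, Finset.sum_add_distrib, Finset.sum_sub_distrib, ← Finset.sum_mul]
    simp [Matrix.trace]
  rw [htot, hB, hG]
  refine mul_nonpos_of_nonneg_of_nonpos (Real.rpow_nonneg hdet.le _) ?_
  have : -s * (2 * (V.trace - ε * (V * V).trace + n * V.trace - V.trace * (m - ε * V.trace)))
        + s * (s + 1) * (4 * (V.trace - ε * (V * V).trace))
      = - (s * (2 * ((n - m) * (ε * (V * V).trace)) + 2 * (ε * V.trace ^ 2))) := by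
    rw [hs]; ring
  rw [this, neg_nonpos]
  have h1 : 0 ≤ (n:ℝ) - m := by linarith
  positivity

end matrixpart
section final

variable {n m : ℕ}

lemma piSVS_eq (hnm : m + 2 ≤ n) (x : EuclideanSpace ℝ (Fin n × Fin m)) :
    piSVS n m x = ENNReal.ofReal (((toMat x)ᵀ * toMat x).det) ^ (-(((n:ℝ) - m - 1) / 2)) := by
  have hnm' : (m:ℝ) + 2 ≤ n := by exact_mod_cast hnm
  have hps : ((toMat x)ᵀ * toMat x).PosSemidef := by
    have := Matrix.posSemidef_conjTranspose_mul_self (toMat x)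
    rwa [conjTranspose_eq_transpose_of_trivial] at this
  have h0 := hps.det_nonneg
  unfold piSVS
  split_ifs with h
  · have hpos : 0 < ((toMat x)ᵀ * toMat x).det := lt_of_le_of_ne h0 (Ne.symm h.ne_zero)
    rw [ENNReal.ofReal_rpow_of_pos hpos, neg_div]
  · have : ((toMat x)ᵀ * toMat x).det = 0 := by
      by_contra h'
      exact h (isUnit_iff_ne_zero.2 h')
    rw [this, ENNReal.ofReal_zero, ENNReal.zero_rpow_of_neg]
    linarith

lemma toMat_continuous :
    Continuous (toMat : EuclideanSpace ℝ (Fin n × Fin m) → Matrix (Fin n) (Fin m) ℝ) := by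
  refine continuous_matrix fun i a => ?_
  simp only [toMat]
  fun_prop

lemma piSVS_continuous (hnm : m + 2 ≤ n) : Continuous (piSVS n m) := by
  rw [funext (piSVS_eq hnm)]
  refine ENNReal.continuous_rpow_const.comp (ENNReal.continuous_ofReal.comp ?_)
  have := toMat_continuous (n := n) (m := m)
  exact (this.matrix_transpose.matrix_mul this).matrix_det

lemma approx_tendsto (hnm : m + 2 ≤ n) (x : EuclideanSpace ℝ (Fin n × Fin m)) :
    Filter.Tendsto (fun k : ℕ => ENNReal.ofReal
      ((gramE (1 / ((k:ℝ) + 1)) x).det ^ (-(((n:ℝ) - m - 1) / 2)))) Filter.atTop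
      (nhds (piSVS n m x)) := by
  have h1 : ∀ k : ℕ, ENNReal.ofReal
      ((gramE (1 / ((k:ℝ) + 1)) x).det ^ (-(((n:ℝ) - m - 1) / 2))) =
      ENNReal.ofReal (gramE (1 / ((k:ℝ) + 1)) x).det ^ (-(((n:ℝ) - m - 1) / 2)) := fun k =>
    (ENNReal.ofReal_rpow_of_pos (gramE_posDef (by positivity) x).det_pos).symm
  simp only [h1]
  rw [piSVS_eq hnm]
  have hc : Continuous (fun ε : ℝ => ENNReal.ofReal (gramE ε x).det ^ (-(((n:ℝ) - m - 1) / 2))) := by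
    refine ENNReal.continuous_rpow_const.comp (ENNReal.continuous_ofReal.comp ?_)
    refine Continuous.matrix_det ?_
    unfold gramE
    fun_prop
  have h2 := (hc.tendsto 0).comp (tendsto_one_div_add_atTop_nhds_zero_nat (𝕜 := ℝ))
  simpa [gramE, Function.comp_def] using h2

lemma piSVS_mean (hm : 1 ≤ m) (hnm : m + 2 ≤ n)
    {ν : Measure (EuclideanSpace ℝ (Fin n × Fin m))} [IsProbabilityMeasure ν] {δ : ℝ}
    (hν : ∀ᵐ y ∂ν, y ∈ sphere (0 : EuclideanSpace ℝ (Fin n × Fin m)) δ)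
    (hinv : ∀ L : EuclideanSpace ℝ (Fin n × Fin m) ≃ₗᵢ[ℝ] EuclideanSpace ℝ (Fin n × Fin m),
      Measure.map L ν = ν) (M : EuclideanSpace ℝ (Fin n × Fin m)) :
    ∫⁻ y, piSVS n m (M + y) ∂ν ≤ piSVS n m M := by
  let g : ℕ → EuclideanSpace ℝ (Fin n × Fin m) → ℝ := fun k x =>
    (gramE (1 / ((k:ℝ) + 1)) x).det ^ (-(((n:ℝ) - m - 1) / 2))
  have hε : ∀ k : ℕ, 0 < 1 / ((k:ℝ) + 1) := fun k => by positivity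
  have hgc : ∀ k, ContDiff ℝ 2 (g k) := fun k =>
    (gramE_contDiff _).rpow_const_of_ne fun x => (gramE_posDef (hε k) x).det_pos.ne'
  have hg0 : ∀ k x, 0 ≤ g k x := fun k x => Real.rpow_nonneg (gramE_posDef (hε k) x).det_pos.le _
  have hcard : 2 ≤ Fintype.card (Fin n × Fin m) := by
    rw [Fintype.card_prod, Fintype.card_fin, Fintype.card_fin]
    nlinarith
  have hle : ∀ k, ∫⁻ y, ENNReal.ofReal (g k (M + y)) ∂ν ≤ ENNReal.ofReal (g k M) := by
    intro k
    have hcont : Continuous fun y => g k (M + y) := (hgc k).continuous.comp (by fun_prop)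
    rw [← ofReal_integral_eq_lintegral_ofReal
      (integrable_of_cont (isCompact_sphere _ δ) hν hcont)
      (Filter.Eventually.of_forall fun y => hg0 k _)]
    exact ENNReal.ofReal_le_ofReal (mean_le (EuclideanSpace.basisFun _ ℝ) hcard hν hinv (hgc k)
      (fun x => laplace_nonpos hnm (hε k) x) M)
  calc ∫⁻ y, piSVS n m (M + y) ∂ν
      = ∫⁻ y, Filter.liminf (fun k => ENNReal.ofReal (g k (M + y))) Filter.atTop ∂ν :=
        lintegral_congr fun y => (approx_tendsto hnm (M + y)).liminf_eq.symm
    _ ≤ Filter.liminf (fun k => ∫⁻ y, ENNReal.ofReal (g k (M + y)) ∂ν) Filter.atTop := by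
        refine lintegral_liminf_le fun k => ?_
        have hcont : Continuous fun y => g k (M + y) := (hgc k).continuous.comp (by fun_prop)
        exact (ENNReal.continuous_ofReal.comp hcont).measurable
    _ ≤ Filter.liminf (fun k => ENNReal.ofReal (g k M)) Filter.atTop :=
        Filter.liminf_le_liminf (Filter.Eventually.of_forall hle)
    _ = piSVS n m M := (approx_tendsto hnm M).liminf_eq

end final

theorem stmt3 (n m : ℕ) (hm : 1 ≤ m) (hnm : m + 2 ≤ n) :
    LowerSemicontinuous (piSVS n m) ∧
    (∃ x, piSVS n m x ≠ ⊤) ∧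
    ∀ (M : EuclideanSpace ℝ (Fin n × Fin m)) (δ : ℝ), 0 < δ →
      ∫⁻ X in sphere M δ, piSVS n m X
          ∂((μH[(n * m : ℝ) - 1] (sphere M δ))⁻¹ • μH[(n * m : ℝ) - 1]) ≤
        piSVS n m M := by
  refine ⟨(piSVS_continuous hnm).lowerSemicontinuous, ?_, ?_⟩
  · refine ⟨WithLp.toLp 2 (fun p => if p.1 = Fin.castLE (by omega) p.2 then 1 else 0), ?_⟩
    have h : ∀ x : EuclideanSpace ℝ (Fin n × Fin m), (toMat x)ᵀ * toMat x = 1 →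
        piSVS n m x ≠ ⊤ := by
      intro x hx
      simp [piSVS, hx]
    apply h
    ext a c
    simp [Matrix.mul_apply, toMat, Matrix.one_apply, Fin.castLE_inj, eq_comm]
  · intro M δ hδ
    set d : ℝ := (n * m : ℝ) - 1
    set h := (μH[d] : Measure (EuclideanSpace ℝ (Fin n × Fin m))) (sphere M δ) with hh
    have hmp : MeasurePreserving (fun y => M + y)
        ((μH[d] : Measure (EuclideanSpace ℝ (Fin n × Fin m))).restrict (sphere 0 δ))
        ((μH[d]).restrict (sphere M δ)) := by
      have h1 := ((IsometryEquiv.addLeft M).measurePreserving_hausdorffMeasure d).restrict_preimage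
        (isClosed_sphere (x := M) (ε := δ)).measurableSet
      have h2 : (IsometryEquiv.addLeft M) ⁻¹' (sphere M δ) = sphere 0 δ := by
        ext y; simp
      rw [h2] at h1
      exact h1
    rcases eq_or_ne h 0 with h0 | h0
    · rw [Measure.restrict_smul, Measure.restrict_eq_zero.2 h0]
      simp
    rcases eq_or_ne h ⊤ with ht | ht
    · rw [ht]; simp
    have hσ : ((μH[d] : Measure (EuclideanSpace ℝ (Fin n × Fin m))).restrict (sphere 0 δ)) Set.univ
        = h := by
      have := hmp.measure_preimage MeasurableSet.univ.nullMeasurableSet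
      rw [Set.preimage_univ] at this
      rw [this, Measure.restrict_apply_univ]
    let ν := h⁻¹ • ((μH[d] : Measure (EuclideanSpace ℝ (Fin n × Fin m))).restrict (sphere 0 δ))
    have hprob : IsProbabilityMeasure ν := ⟨by
      simp only [ν, Measure.smul_apply, hσ, smul_eq_mul]
      exact ENNReal.inv_mul_cancel h0 ht⟩
    have hν : ∀ᵐ y ∂ν, y ∈ sphere (0 : EuclideanSpace ℝ (Fin n × Fin m)) δ :=
      Measure.ae_smul_measure (ae_restrict_mem isClosed_sphere.measurableSet) _
    have hinv : ∀ L : EuclideanSpace ℝ (Fin n × Fin m) ≃ₗᵢ[ℝ] EuclideanSpace ℝ (Fin n × Fin m),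
        Measure.map L ν = ν := by
      intro L
      have h1 := (L.toIsometryEquiv.measurePreserving_hausdorffMeasure d).restrict_preimage
        (isClosed_sphere (x := (0 : EuclideanSpace ℝ (Fin n × Fin m))) (ε := δ)).measurableSet
      have h2 : L.toIsometryEquiv ⁻¹' (sphere 0 δ) = sphere 0 δ := by
        ext y; simp
      rw [h2] at h1
      simp only [ν, Measure.map_smul]
      congr 1
      exact h1.map_eq
    have := piSVS_mean hm hnm hν hinv M
    rw [lintegral_smul_measure, hmp.lintegral_comp (piSVS_continuous hnm).measurable] at this
    rw [Measure.restrict_smul, lintegral_smul_measure]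
    exact this
end

section
/- Let π : ℝ^d → [0,∞] be superharmonic and let z ∈ ℝ^d. For v > 0 let φ_v(x) = (2πv)^{−d/2} exp(−‖x‖²/(2v)) be the density of N(0, vI_d). Then the Gaussian smoothing of π is nonincreasing in the variance: for all 0 < v₀ ≤ v₁, ∫_{ℝ^d} φ_{v₀}(a − z) π(a) da ≥ ∫_{ℝ^d} φ_{v₁}(a − z) π(a) da, the integrals being taken in [0,∞]. -/
open MeasureTheory Metric ENNReal

/-- A function `f : ℝ^d → [0,∞]` is superharmonic if it is lower semicontinuous, not
identically `+∞`, and its mean over every sphere (with respect to the normalized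
`(d-1)`-dimensional Hausdorff surface measure) is at most its value at the center. -/
def SuperharmonicFn (d : ℕ) (f : EuclideanSpace ℝ (Fin d) → ℝ≥0∞) : Prop :=
  LowerSemicontinuous f ∧ (∃ x, f x ≠ ⊤) ∧
    ∀ (x : EuclideanSpace ℝ (Fin d)) (δ : ℝ), 0 < δ →
      ∫⁻ z in sphere x δ, f z
          ∂((μH[(d : ℝ) - 1] (sphere x δ))⁻¹ • μH[(d : ℝ) - 1]) ≤ f x

/-- The density of `N(0, v I_d)`: `φ_v(x) = (2πv)^{-d/2} exp(-‖x‖²/(2v))`. -/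
noncomputable def gaussDensityVar (d : ℕ) (v : ℝ) (x : EuclideanSpace ℝ (Fin d)) : ℝ :=
  (2 * Real.pi * v) ^ (-(d : ℝ) / 2) * Real.exp (-‖x‖ ^ 2 / (2 * v))


theorem finrank_orth (d : ℕ) (hd : 1 ≤ d) (v : EuclideanSpace ℝ (Fin d)) (hv : ‖v‖ = 1) :
    ((Module.finrank ℝ (Submodule.span ℝ {v})ᗮ : ℕ) : ℝ) = (d : ℝ) - 1 := by
  obtain ⟨n, rfl⟩ : ∃ n, d = n + 1 := ⟨d - 1, by omega⟩
  have : Fact (Module.finrank ℝ (EuclideanSpace ℝ (Fin (n+1))) = n + 1) := ⟨by simp⟩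
  have hv0 : v ≠ 0 := by rintro rfl; simp at hv
  rw [Submodule.finrank_orthogonal_span_singleton (n := n) hv0]
  push_cast; ring

theorem hemi_finite (d : ℕ) (hd : 1 ≤ d) (v : EuclideanSpace ℝ (Fin d)) (hv : ‖v‖ = 1) :
    μH[(d : ℝ) - 1] {x | x ∈ sphere (0 : EuclideanSpace ℝ (Fin d)) 1 ∧ inner ℝ v x ≤ 0} < ⊤ := by
  set W := (Submodule.span ℝ {v})ᗮ with hW
  have hsub : {x | x ∈ sphere (0 : EuclideanSpace ℝ (Fin d)) 1 ∧ inner ℝ v x ≤ 0} ⊆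
      (fun w : W => stereoInvFunAux v (w : EuclideanSpace ℝ (Fin d))) '' closedBall 0 2 := by
    rintro x ⟨hx, hi⟩
    refine ⟨stereoToFun v x, ?_, ?_⟩
    · rw [mem_closedBall_zero_iff, stereoToFun_apply, norm_smul]
      have h1 : ‖W.orthogonalProjectionOnto x‖ ≤ 1 := by
        have := W.norm_orthogonalProjectionOnto_apply_le x
        rw [mem_sphere_zero_iff_norm] at hx
        linarith
      have h2 : ‖(2 / ((1 : ℝ) - innerSL ℝ v x))‖ ≤ 2 := by
        simp only [innerSL_apply_apply]
        rw [Real.norm_of_nonneg (div_nonneg (by norm_num) (by linarith))]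
        rw [div_le_iff₀ (by linarith)]
        linarith
      calc _ ≤ (2:ℝ) * 1 := mul_le_mul h2 h1 (norm_nonneg _) (by norm_num)
        _ = 2 := by norm_num
    · have hne : x ≠ v := by
        rintro rfl
        rw [real_inner_self_eq_norm_sq, hv] at hi
        norm_num at hi
      have := stereo_left_inv hv (x := ⟨x, hx⟩) hne
      exact congrArg Subtype.val this
  have hc : ContDiff ℝ 1 (fun w : W => stereoInvFunAux v (w : EuclideanSpace ℝ (Fin d))) :=
    contDiff_stereoInvFunAux.comp W.subtypeL.contDiff
  obtain ⟨K, hK⟩ := LocallyLipschitzOn.exists_lipschitzOnWith_of_compact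
    (isCompact_closedBall (0 : W) 2) hc.locallyLipschitz.locallyLipschitzOn
  have hd0 : (0 : ℝ) ≤ (d : ℝ) - 1 := by
    have : (1 : ℝ) ≤ d := by exact_mod_cast hd
    linarith
  have h3 := hK.hausdorffMeasure_image_le hd0
  refine (measure_mono hsub).trans_lt (h3.trans_lt ?_)
  refine ENNReal.mul_lt_top (ENNReal.rpow_lt_top_of_nonneg hd0 coe_ne_top) ?_
  rw [← finrank_orth d hd v hv]
  have := isAddHaarMeasure_hausdorffMeasure (E := W)
  exact (isCompact_closedBall (0 : W) 2).measure_lt_top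

theorem exists_unit (d : ℕ) (hd : 1 ≤ d) : ∃ v : EuclideanSpace ℝ (Fin d), ‖v‖ = 1 :=
  ⟨EuclideanSpace.single ⟨0, hd⟩ 1, by simp⟩

theorem sphere_finite (d : ℕ) (hd : 1 ≤ d) :
    μH[(d : ℝ) - 1] (sphere (0 : EuclideanSpace ℝ (Fin d)) 1) < ⊤ := by
  obtain ⟨v, hv⟩ := exists_unit d hd
  have h1 := hemi_finite d hd v hv
  have h2 := hemi_finite d hd (-v) (by simpa using hv)
  refine (measure_mono ?_).trans_lt ((measure_union_le _ _).trans_lt (ENNReal.add_lt_top.2 ⟨h1, h2⟩))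
  intro x hx
  rcases le_total (inner ℝ v x) 0 with h | h
  · exact Or.inl ⟨hx, h⟩
  · exact Or.inr ⟨hx, by simpa using h⟩

theorem sphere_pos (d : ℕ) (hd : 1 ≤ d) :
    0 < μH[(d : ℝ) - 1] (sphere (0 : EuclideanSpace ℝ (Fin d)) 1) := by
  obtain ⟨v, hv⟩ := exists_unit d hd
  set W := (Submodule.span ℝ {v})ᗮ with hW
  have hd0 : (0 : ℝ) ≤ (d : ℝ) - 1 := by
    have : (1 : ℝ) ≤ d := by exact_mod_cast hd
    linarith
  have hL : LipschitzWith 1 (W.orthogonalProjectionOnto) := by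
    refine LipschitzWith.of_dist_le_mul fun x y => ?_
    rw [dist_eq_norm, dist_eq_norm, ← map_sub]
    simpa using W.norm_orthogonalProjectionOnto_apply_le (x - y)
  have h3 := hL.hausdorffMeasure_image_le hd0 (sphere (0 : EuclideanSpace ℝ (Fin d)) 1)
  simp only [ENNReal.coe_one, ENNReal.one_rpow, one_mul] at h3
  refine lt_of_lt_of_le ?_ h3
  have hsub : ball (0 : W) 1 ⊆
      W.orthogonalProjectionOnto '' (sphere (0 : EuclideanSpace ℝ (Fin d)) 1) := by
    intro w hw
    rw [mem_ball_zero_iff] at hw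
    refine ⟨(w : EuclideanSpace ℝ (Fin d)) + Real.sqrt (1 - ‖w‖ ^ 2) • v, ?_, ?_⟩
    · rw [mem_sphere_zero_iff_norm]
      have hwv : inner ℝ (w : EuclideanSpace ℝ (Fin d)) v = 0 :=
        Submodule.mem_orthogonal_singleton_iff_inner_left.mp w.2
      have hq : ‖(w : EuclideanSpace ℝ (Fin d)) + Real.sqrt (1 - ‖w‖ ^ 2) • v‖ ^ 2 = 1 := by
        rw [norm_add_sq_real, inner_smul_right, hwv, norm_smul, hv, mul_one, Real.norm_eq_abs,
          sq_abs, Real.sq_sqrt]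
        · simp
        · nlinarith [norm_nonneg w]
      nlinarith [norm_nonneg ((w : EuclideanSpace ℝ (Fin d)) + Real.sqrt (1 - ‖w‖ ^ 2) • v)]
    · have h₁ : W.orthogonalProjectionOnto v = 0 :=
        Submodule.orthogonalProjectionOnto_orthogonalComplement_singleton_eq_zero v
      rw [map_add, map_smul, h₁]
      simp
  refine lt_of_lt_of_le ?_ (measure_mono hsub)
  rw [← finrank_orth d hd v hv]
  have := isAddHaarMeasure_hausdorffMeasure (E := W)
  exact isOpen_ball.measure_pos _ ⟨0, by simp⟩

theorem sphere_scale (d : ℕ) (hd : 1 ≤ d) (x : EuclideanSpace ℝ (Fin d)) (δ : ℝ) (hδ : 0 < δ)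
    (hfin : μH[(d : ℝ) - 1] (sphere (0 : EuclideanSpace ℝ (Fin d)) 1) < ⊤)
    (hpos : 0 < μH[(d : ℝ) - 1] (sphere (0 : EuclideanSpace ℝ (Fin d)) 1))
    (f : EuclideanSpace ℝ (Fin d) → ℝ≥0∞) (hf : Measurable f)
    (h : ∫⁻ z in sphere x δ, f z
          ∂((μH[(d : ℝ) - 1] (sphere x δ))⁻¹ • μH[(d : ℝ) - 1]) ≤ f x) :
    ∫⁻ y in sphere (0 : EuclideanSpace ℝ (Fin d)) 1, f (x + δ • y) ∂μH[(d : ℝ) - 1] ≤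
      f x * μH[(d : ℝ) - 1] (sphere (0 : EuclideanSpace ℝ (Fin d)) 1) := by
  have hd0 : (0 : ℝ) ≤ (d : ℝ) - 1 := by
    have : (1 : ℝ) ≤ d := by exact_mod_cast hd
    linarith
  set T : EuclideanSpace ℝ (Fin d) → EuclideanSpace ℝ (Fin d) := fun y => x + δ • y with hT
  have hTm : Measurable T := by fun_prop
  set k : ℝ≥0∞ := ((‖δ‖₊⁻¹ ^ ((d : ℝ) - 1) : NNReal) : ℝ≥0∞) with hk
  have hk0 : k ≠ 0 := by
    rw [hk, ENNReal.coe_ne_zero]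
    exact (NNReal.rpow_pos (by simpa using hδ.ne')).ne'
  have hkt : k ≠ ⊤ := ENNReal.coe_ne_top
  have hmap : Measure.map T μH[(d : ℝ) - 1] = k • μH[(d : ℝ) - 1] := by
    have h1 := map_homothety_hausdorffMeasure hd0 (0 : EuclideanSpace ℝ (Fin d)) hδ.ne'
    have h2 := (IsometryEquiv.addLeft x).map_hausdorffMeasure ((d : ℝ) - 1)
    have h3 : T = (IsometryEquiv.addLeft x) ∘ (AffineMap.homothety (0 : EuclideanSpace ℝ (Fin d)) δ) := by
      ext1 y
      simp [hT, AffineMap.homothety_apply]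
    rw [h3, ← Measure.map_map (IsometryEquiv.addLeft x).continuous.measurable
      (AffineMap.homothety_continuous _ _).measurable, h1, Measure.map_smul, h2]
    rfl
  have hpre : T ⁻¹' (sphere x δ) = sphere 0 1 := by
    ext y
    simp [hT, norm_smul, abs_of_pos hδ, hδ.ne']
  have hms : MeasurableSet (sphere x δ) := isClosed_sphere.measurableSet
  have e1 : μH[(d : ℝ) - 1] (sphere (0 : EuclideanSpace ℝ (Fin d)) 1) =
      k * μH[(d : ℝ) - 1] (sphere x δ) := by
    rw [← hpre, ← Measure.map_apply hTm hms, hmap]; rfl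
  have e2 : ∫⁻ y in sphere (0 : EuclideanSpace ℝ (Fin d)) 1, f (x + δ • y) ∂μH[(d : ℝ) - 1] =
      k * ∫⁻ z in sphere x δ, f z ∂μH[(d : ℝ) - 1] := by
    rw [← hpre, ← setLIntegral_map hms hf hTm, hmap, Measure.restrict_smul, lintegral_smul_measure]
    rfl
  set M := μH[(d : ℝ) - 1] (sphere x δ)
  have hM0 : M ≠ 0 := by
    rintro h0; rw [e1, h0] at hpos; simp at hpos
  have hMt : M ≠ ⊤ := by
    rintro h0; rw [e1, h0, ENNReal.mul_top hk0] at hfin; simp at hfin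
  rw [Measure.restrict_smul, lintegral_smul_measure, smul_eq_mul] at h
  rw [e1, e2]
  have : ∫⁻ z in sphere x δ, f z ∂μH[(d : ℝ) - 1] ≤ f x * M := by
    rw [mul_comm, ← div_eq_mul_inv] at h
    exact (ENNReal.div_le_iff hM0 hMt).1 h
  calc _ ≤ k * (f x * M) := by gcongr
    _ = _ := by ring

theorem key (d : ℕ) (m ν : Measure (EuclideanSpace ℝ (Fin d))) [IsFiniteMeasure m]
    [IsFiniteMeasure ν] (hm0 : m {0} = 0)
    (hm : ∀ L : EuclideanSpace ℝ (Fin d) ≃ₗᵢ[ℝ] EuclideanSpace ℝ (Fin d), MeasurePreserving L m m)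
    (hν : ∀ L : EuclideanSpace ℝ (Fin d) ≃ₗᵢ[ℝ] EuclideanSpace ℝ (Fin d), MeasurePreserving L ν ν)
    (hνS : ∀ᵐ y ∂ν, ‖y‖ = 1) (hν0 : ν ≠ 0)
    (u : EuclideanSpace ℝ (Fin d)) (hu : ‖u‖ = 1)
    (g : EuclideanSpace ℝ (Fin d) → ℝ≥0∞) (hg : LowerSemicontinuous g) (C : ℝ≥0∞)
    (hC : ∀ δ : ℝ, 0 < δ → ∫⁻ y, g (δ • y) ∂ν ≤ C * ν Set.univ) :
    ∫⁻ x, g x ∂m ≤ C * m Set.univ := by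
  have hgm : Measurable g := hg.measurable
  have hrot : ∀ y : EuclideanSpace ℝ (Fin d), ‖y‖ = 1 →
      ∃ L : EuclideanSpace ℝ (Fin d) ≃ₗᵢ[ℝ] EuclideanSpace ℝ (Fin d), L u = y := fun y hy =>
    ⟨_, Submodule.reflection_sub (hu.trans hy.symm)⟩
  set c : ℝ → ℝ≥0∞ := fun r => ν (ball u r) with hc
  have hcball : ∀ y r, ‖y‖ = 1 → ν (ball y r) = c r := by
    intro y r hy
    obtain ⟨L, rfl⟩ := hrot y hy
    rw [← (hν L).measure_preimage isOpen_ball.measurableSet.nullMeasurableSet]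
    rw [LinearIsometryEquiv.preimage_ball]; simp [hc]
  have hcpos : ∀ r, 0 < r → c r ≠ 0 := by
    intro r hr h0
    obtain ⟨t, hts, ht, hcov⟩ := (isCompact_sphere (0 : EuclideanSpace ℝ (Fin d)) 1).finite_cover_balls hr
    apply hν0
    have h1 : ν (sphere 0 1) = 0 := by
      refine measure_mono_null hcov ((measure_biUnion_null_iff ht.countable).2 fun y hy => ?_)
      rw [hcball y r (by simpa using hts hy), h0]
    have h2 : ν (sphere 0 1)ᶜ = 0 := by
      rw [ae_iff] at hνS
      refine measure_mono_null (fun y hy => ?_) hνS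
      simpa using hy
    rw [← Measure.measure_univ_eq_zero, ← Set.union_compl_self (sphere 0 1)]
    exact measure_union_null h1 h2
  have hct : ∀ r, c r ≠ ⊤ := fun r => measure_ne_top _ _
  set N : EuclideanSpace ℝ (Fin d) → EuclideanSpace ℝ (Fin d) := fun x => ‖x‖⁻¹ • x with hN
  have hNm : Measurable N := by fun_prop
  have hx0 : ∀ᵐ x ∂m, x ≠ 0 := by
    rw [ae_iff]; simpa using hm0
  have hN1 : ∀ x, x ≠ 0 → ‖N x‖ = 1 := fun x hx => by
    simp [hN, norm_smul, hx]
  set K : ℝ → EuclideanSpace ℝ (Fin d) → EuclideanSpace ℝ (Fin d) → ℝ≥0∞ :=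
    fun r x y => (ball (0:ℝ) r).indicator 1 (dist y (N x)) with hK
  have hKm : ∀ r, Measurable (Function.uncurry (K r)) := by
    intro r
    have h1 : Measurable ((ball (0:ℝ) r).indicator (1 : ℝ → ℝ≥0∞)) :=
      measurable_one.indicator isOpen_ball.measurableSet
    exact h1.comp (measurable_snd.dist (hNm.comp measurable_fst))
  have hKball : ∀ r x y, K r x y = (ball (N x) r).indicator 1 y := by
    intro r x y
    simp [hK, Set.indicator]
  -- total mass in y
  have hKy : ∀ r x, x ≠ 0 → ∫⁻ y, K r x y ∂ν = c r := by
    intro r x hx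
    simp_rw [hKball]
    rw [lintegral_indicator_one isOpen_ball.measurableSet, hcball _ _ (hN1 x hx)]
  -- rotation in x
  have hKx : ∀ r y (h : ℝ → ℝ≥0∞), Measurable h → ‖y‖ = 1 →
      ∫⁻ x, K r x y * h ‖x‖ ∂m = ∫⁻ x, K r x u * h ‖x‖ ∂m := by
    intro r y h hh hy
    obtain ⟨L, rfl⟩ := hrot y hy
    have hmeas : Measurable fun x => K r x (L u) * h ‖x‖ :=
      ((hKm r).comp (measurable_id.prodMk measurable_const)).mul (hh.comp measurable_norm)
    rw [← (hm L).lintegral_comp hmeas]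
    refine lintegral_congr fun x => ?_
    have : N (L x) = L (N x) := by simp [hN]
    simp [hK, this]
  clear_value K c N
  have step2 : ∀ r, 0 < r → (c r)⁻¹ * ∫⁻ x, ∫⁻ y, K r x y * g (‖x‖ • y) ∂ν ∂m ≤ C * m Set.univ := by
    intro r hr
    have hG : Measurable (Function.uncurry fun (x y : EuclideanSpace ℝ (Fin d)) => g (‖x‖ • y)) :=
      hgm.comp ((measurable_norm.comp measurable_fst).smul measurable_snd)
    have hmass : (∫⁻ x, K r x u ∂m) * ν Set.univ = c r * m Set.univ := by
      calc (∫⁻ x, K r x u ∂m) * ν Set.univ = ∫⁻ y, ∫⁻ x, K r x u ∂m ∂ν := by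
            rw [lintegral_const]
        _ = ∫⁻ y, ∫⁻ x, K r x y ∂m ∂ν := by
            refine lintegral_congr_ae (hνS.mono fun y hy => ?_)
            simpa using (hKx r y (fun _ => 1) measurable_const hy).symm
        _ = ∫⁻ x, ∫⁻ y, K r x y ∂ν ∂m := by
            rw [lintegral_lintegral_swap (hKm r).aemeasurable]
        _ = ∫⁻ x, c r ∂m := lintegral_congr_ae (hx0.mono fun x hx => hKy r x hx)
        _ = _ := by rw [lintegral_const]
    have : ∫⁻ x, ∫⁻ y, K r x y * g (‖x‖ • y) ∂ν ∂m ≤ c r * (C * m Set.univ) := by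
      calc ∫⁻ x, ∫⁻ y, K r x y * g (‖x‖ • y) ∂ν ∂m 
          = ∫⁻ y, ∫⁻ x, K r x y * g (‖x‖ • y) ∂m ∂ν := 
            lintegral_lintegral_swap ((hKm r).mul hG).aemeasurable
        _ = ∫⁻ y, ∫⁻ x, K r x u * g (‖x‖ • y) ∂m ∂ν := by
            refine lintegral_congr_ae (hνS.mono fun y hy => ?_)
            exact hKx r y (fun s => g (s • y)) (hgm.comp (measurable_id.smul_const y)) hy
        _ = ∫⁻ x, ∫⁻ y, K r x u * g (‖x‖ • y) ∂ν ∂m := by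
            rw [lintegral_lintegral_swap]
            exact (Measurable.mul ((hKm r).comp (measurable_snd.prodMk measurable_const))
              (hG.comp measurable_swap)).aemeasurable
        _ = ∫⁻ x, K r x u * ∫⁻ y, g (‖x‖ • y) ∂ν ∂m := by
            refine lintegral_congr fun x => ?_
            rw [lintegral_const_mul]
            exact hgm.comp (measurable_const_smul ‖x‖)
        _ ≤ ∫⁻ x, K r x u * (C * ν Set.univ) ∂m := by
            refine lintegral_mono_ae (hx0.mono fun x hx => ?_)
            gcongr
            exact hC _ (norm_pos_iff.2 hx)
        _ = (∫⁻ x, K r x u ∂m) * (C * ν Set.univ) := by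
            exact lintegral_mul_const _ (hKm r).of_uncurry_right
        _ = C * ((∫⁻ x, K r x u ∂m) * ν Set.univ) := mul_left_comm _ _ _
        _ = c r * (C * m Set.univ) := by rw [hmass]; exact mul_left_comm _ _ _
    calc _ ≤ (c r)⁻¹ * (c r * (C * m Set.univ)) := by gcongr
      _ = _ := by rw [← mul_assoc, ENNReal.inv_mul_cancel (hcpos r hr) (hct r), one_mul]
  have step1 : ∀ x, x ≠ 0 → g x ≤ Filter.liminf (fun n : ℕ => (c (1 / ((n : ℝ) + 1)))⁻¹ *
      ∫⁻ y, K (1 / ((n : ℝ) + 1)) x y * g (‖x‖ • y) ∂ν) Filter.atTop := by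
    intro x hx
    refine le_of_forall_lt fun b hb => ?_
    obtain ⟨b', hbb', hb'⟩ := exists_between hb
    refine hbb'.trans_le (Filter.le_liminf_of_le (by isBoundedDefault) ?_)
    have hxx : ‖x‖ • N x = x := by simp [hN, smul_smul, hx]
    have h1 : ∀ᶠ y in nhds (N x), b' < g (‖x‖ • y) := by
      have hcont : Filter.Tendsto (fun y : EuclideanSpace ℝ (Fin d) => ‖x‖ • y) (nhds (N x)) (nhds x) := by
        have : Continuous (fun y : EuclideanSpace ℝ (Fin d) => ‖x‖ • y) := by fun_prop
        simpa [hxx] using this.tendsto (N x)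
      exact hcont.eventually (hg x b' hb')
    obtain ⟨ε, hε, hball⟩ := Metric.eventually_nhds_iff_ball.1 h1
    filter_upwards [(tendsto_one_div_add_atTop_nhds_zero_nat (𝕜 := ℝ)).eventually (gt_mem_nhds hε)] with n hn
    set r := 1 / ((n : ℝ) + 1)
    have hr : 0 < r := by positivity
    calc b' = (c r)⁻¹ * (c r * b') := by
          rw [← mul_assoc, ENNReal.inv_mul_cancel (hcpos r hr) (hct r), one_mul]
      _ = (c r)⁻¹ * ∫⁻ y, K r x y * b' ∂ν := by
          have hmx : Measurable fun y => K r x y :=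
            (hKm r).comp (measurable_const.prodMk measurable_id)
          rw [lintegral_mul_const _ hmx, hKy r x hx]
      _ ≤ _ := by
          refine mul_le_mul_right (lintegral_mono fun y => ?_) _
          simp only [hKball]
          by_cases hy : y ∈ ball (N x) r
          · simp only [Set.indicator_of_mem hy, Pi.one_apply, one_mul]
            exact (hball y (ball_subset_ball hn.le hy)).le
          · simp [Set.indicator_of_notMem hy]
  calc ∫⁻ x, g x ∂m ≤ ∫⁻ x, Filter.liminf (fun n : ℕ => (c (1 / ((n : ℝ) + 1)))⁻¹ *
      ∫⁻ y, K (1 / ((n : ℝ) + 1)) x y * g (‖x‖ • y) ∂ν) Filter.atTop ∂m :=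
        lintegral_mono_ae (hx0.mono step1)
    _ ≤ Filter.liminf (fun n : ℕ => ∫⁻ x, (c (1 / ((n : ℝ) + 1)))⁻¹ *
      ∫⁻ y, K (1 / ((n : ℝ) + 1)) x y * g (‖x‖ • y) ∂ν ∂m) Filter.atTop := by
        refine lintegral_liminf_le fun n => ?_
        refine Measurable.const_mul ?_ _
        refine Measurable.lintegral_prod_right' (f := fun p : _ × _ => K (1 / ((n : ℝ) + 1)) p.1 p.2 * g (‖p.1‖ • p.2)) ?_
        exact (hKm _).mul (hgm.comp ((measurable_norm.comp measurable_fst).smul measurable_snd))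
    _ ≤ C * m Set.univ := by
        refine Filter.liminf_le_of_le (by isBoundedDefault) fun b hb => ?_
        obtain ⟨n, hn⟩ := hb.exists
        refine hn.trans ?_
        rw [lintegral_const_mul']
        · exact step2 _ (by positivity)
        · exact ENNReal.inv_ne_top.2 (hcpos _ (by positivity))

theorem gauss_mass (d : ℕ) (s : ℝ) (hs : 0 < s) (p : EuclideanSpace ℝ (Fin d)) :
    ∫⁻ y, ENNReal.ofReal (gaussDensityVar d s (y - p)) = 1 := by
  rw [lintegral_sub_right_eq_self (fun y => ENNReal.ofReal (gaussDensityVar d s y)) p]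
  have hb : 0 < (2 * s)⁻¹ := by positivity
  have h1 := GaussianFourier.integral_rexp_neg_mul_sq_norm (V := EuclideanSpace ℝ (Fin d)) hb
  have hpos : 0 < 2 * Real.pi * s := by positivity
  have e : ∀ y : EuclideanSpace ℝ (Fin d), gaussDensityVar d s y =
      (2 * Real.pi * s) ^ (-(d : ℝ) / 2) * Real.exp (-(2 * s)⁻¹ * ‖y‖ ^ 2) := by
    intro y
    rw [gaussDensityVar]
    congr 2
    field_simp
  have hint : ∫ y : EuclideanSpace ℝ (Fin d), gaussDensityVar d s y = 1 := by
    simp_rw [e]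
    rw [integral_const_mul, h1]
    have : Real.pi / (2 * s)⁻¹ = 2 * Real.pi * s := by field_simp
    rw [this, ← Real.rpow_add hpos]
    simp [neg_div]
  rw [← ofReal_integral_eq_lintegral_ofReal, hint, ENNReal.ofReal_one]
  · by_contra hni
    rw [integral_undef hni] at hint
    exact zero_ne_one hint
  · exact Filter.Eventually.of_forall fun y => by rw [e]; positivity

theorem gauss_measurable (d : ℕ) (s : ℝ) : Measurable (gaussDensityVar d s) := by
  unfold gaussDensityVar
  fun_prop

theorem gauss_prod (d : ℕ) (v w : ℝ) (hv : 0 < v) (hw : 0 < w) (a y z : EuclideanSpace ℝ (Fin d)) :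
    gaussDensityVar d v (y - z) * gaussDensityVar d w (a - y) =
      gaussDensityVar d (v + w) (a - z) *
        gaussDensityVar d (v * w / (v + w)) (y - ((w / (v + w)) • z + (v / (v + w)) • a)) := by
  have hvw : 0 < v + w := by positivity
  unfold gaussDensityVar
  have hc : (2 * Real.pi * v) ^ (-(d : ℝ) / 2) * (2 * Real.pi * w) ^ (-(d : ℝ) / 2) =
      (2 * Real.pi * (v + w)) ^ (-(d : ℝ) / 2) *
        (2 * Real.pi * (v * w / (v + w))) ^ (-(d : ℝ) / 2) := by
    rw [← Real.mul_rpow (by positivity) (by positivity),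
      ← Real.mul_rpow (by positivity) (by positivity)]
    congr 1
    field_simp
  set P := y - z with hP
  set Q := a - y with hQ
  have e1 : a - z = P + Q := by rw [hP, hQ]; abel
  have e2 : y - ((w / (v + w)) • z + (v / (v + w)) • a) =
      (w / (v + w)) • P - (v / (v + w)) • Q := by
    have h1 : w / (v + w) + v / (v + w) = 1 := by field_simp; ring
    have h2 : y = (w / (v + w) + v / (v + w)) • y := by rw [h1, one_smul]
    rw [hP, hQ]
    nth_rewrite 1 [h2]
    module
  clear_value P Q
  have he : -‖P‖ ^ 2 / (2 * v) + -‖Q‖ ^ 2 / (2 * w) =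
      -‖P + Q‖ ^ 2 / (2 * (v + w)) +
        -‖(w / (v + w)) • P - (v / (v + w)) • Q‖ ^ 2 / (2 * (v * w / (v + w))) := by
    rw [norm_add_sq_real, norm_sub_sq_real, norm_smul, norm_smul, inner_smul_left,
      inner_smul_right, Real.norm_of_nonneg (by positivity), Real.norm_of_nonneg (by positivity)]
    simp only [conj_trivial]
    field_simp
    ring
  rw [e1, e2, mul_mul_mul_comm, hc, ← Real.exp_add, he, Real.exp_add]
  ring

theorem gauss_avg_le (d : ℕ) (hd : 1 ≤ d)
    (π : EuclideanSpace ℝ (Fin d) → ℝ≥0∞) (hπ : SuperharmonicFn d π)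
    (y : EuclideanSpace ℝ (Fin d)) (w : ℝ) (hw : 0 < w) :
    ∫⁻ a, ENNReal.ofReal (gaussDensityVar d w (a - y)) * π a ≤ π y := by
  obtain ⟨hlsc, -, hmean⟩ := hπ
  obtain ⟨u, hu⟩ := exists_unit d hd
  have hfin := sphere_finite d hd
  have hpos := sphere_pos d hd
  set ρ : EuclideanSpace ℝ (Fin d) → ℝ≥0∞ := fun a => ENNReal.ofReal (gaussDensityVar d w a) with hρ
  have hρm : Measurable ρ := (gauss_measurable d w).ennreal_ofReal
  have hmass : ∫⁻ a, ρ a = 1 := by simpa using gauss_mass d w hw 0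
  set m := (volume : Measure (EuclideanSpace ℝ (Fin d))).withDensity ρ with hm
  have hmuniv : m Set.univ = 1 := by
    rw [hm, withDensity_apply _ MeasurableSet.univ, Measure.restrict_univ, hmass]
  have : IsFiniteMeasure m := ⟨by rw [hmuniv]; exact one_lt_top⟩
  set S := sphere (0 : EuclideanSpace ℝ (Fin d)) 1 with hS
  have hSm : MeasurableSet S := isClosed_sphere.measurableSet
  set ν := (μH[(d : ℝ) - 1] : Measure (EuclideanSpace ℝ (Fin d))).restrict S with hν
  have hνuniv : ν Set.univ = μH[(d : ℝ) - 1] S := by rw [hν, Measure.restrict_apply_univ]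
  have : IsFiniteMeasure ν := ⟨by rw [hνuniv]; exact hfin⟩
  have : Nonempty (Fin d) := ⟨⟨0, hd⟩⟩
  have hgl : LowerSemicontinuous fun a => π (y + a) :=
    hlsc.comp (continuous_const.add continuous_id)
  have hkey := key d m ν ?_ ?_ ?_ ?_ ?_ u hu (fun a => π (y + a)) hgl (π y) ?_
  · rw [hmuniv, mul_one, hm, lintegral_withDensity_eq_lintegral_mul _ hρm hgl.measurable] at hkey
    refine le_trans (le_of_eq ?_) hkey
    rw [← lintegral_add_left_eq_self _ y]
    simp [hρ]
  · exact withDensity_absolutelyContinuous _ _ (measure_singleton 0)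
  · intro L
    refine ⟨L.continuous.measurable, ?_⟩
    ext s hs
    rw [Measure.map_apply L.continuous.measurable hs, hm, withDensity_apply _ hs,
      withDensity_apply _ (L.continuous.measurable hs),
      ← L.measurePreserving.setLIntegral_comp_preimage hs hρm]
    simp [hρ, gaussDensityVar]
  · intro L
    have h1 := (L.toIsometryEquiv.measurePreserving_hausdorffMeasure ((d : ℝ) - 1)).restrict_preimage hSm
    have h2 : L.toIsometryEquiv ⁻¹' S = S := by
      ext x; simp [hS]
    rw [h2] at h1
    exact h1
  · rw [hν]
    exact (ae_restrict_mem hSm).mono fun x hx => by simpa [hS] using hx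
  · intro h0
    rw [h0] at hνuniv
    exact hpos.ne hνuniv
  · intro δ hδ
    rw [hνuniv]
    exact sphere_scale d hd y δ hδ hfin hpos π hlsc.measurable (hmean y δ hδ)

theorem stmt6 (d : ℕ) (hd : 1 ≤ d)
    (π : EuclideanSpace ℝ (Fin d) → ℝ≥0∞) (hπ : SuperharmonicFn d π)
    (z : EuclideanSpace ℝ (Fin d)) (v₀ v₁ : ℝ) (h0 : 0 < v₀) (h01 : v₀ ≤ v₁) :
    ∫⁻ a, ENNReal.ofReal (gaussDensityVar d v₁ (a - z)) * π a ≤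
      ∫⁻ a, ENNReal.ofReal (gaussDensityVar d v₀ (a - z)) * π a := by
  rcases h01.eq_or_lt with rfl | hlt
  · exact le_rfl
  obtain ⟨w, hw, rfl⟩ : ∃ w, 0 < w ∧ v₁ = v₀ + w := ⟨v₁ - v₀, by linarith, by ring⟩
  have hnn : ∀ (v : ℝ), 0 < v → ∀ x, 0 ≤ gaussDensityVar d v x := by
    intro v hv x
    unfold gaussDensityVar
    positivity
  have hπm : Measurable π := hπ.1.measurable
  have hs : 0 < v₀ * w / (v₀ + w) := by positivity
  have hm0 := gauss_measurable d v₀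
  have hmw := gauss_measurable d w
  calc ∫⁻ a, ENNReal.ofReal (gaussDensityVar d (v₀ + w) (a - z)) * π a
      = ∫⁻ a, (∫⁻ y, ENNReal.ofReal (gaussDensityVar d v₀ (y - z)) *
          (ENNReal.ofReal (gaussDensityVar d w (a - y)) * π a)) := by
        refine lintegral_congr fun a => ?_
        simp_rw [← mul_assoc, ← ENNReal.ofReal_mul (hnn v₀ h0 _),
          gauss_prod d v₀ w h0 hw, ENNReal.ofReal_mul (hnn (v₀ + w) (by positivity) _)]
        rw [lintegral_mul_const, lintegral_const_mul, gauss_mass d _ hs, mul_one]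
        · exact ((gauss_measurable d _).comp (measurable_id.sub_const _)).ennreal_ofReal
        · exact (((gauss_measurable d _).comp
            (measurable_id.sub_const _)).ennreal_ofReal).const_mul _
    _ = ∫⁻ y, (∫⁻ a, ENNReal.ofReal (gaussDensityVar d v₀ (y - z)) *
          (ENNReal.ofReal (gaussDensityVar d w (a - y)) * π a)) := by
        apply lintegral_lintegral_swap
        refine Measurable.aemeasurable ?_
        refine Measurable.mul ?_ (Measurable.mul ?_ (hπm.comp measurable_fst))
        · exact (hm0.comp (measurable_snd.sub_const z)).ennreal_ofReal
        · exact (hmw.comp (measurable_fst.sub measurable_snd)).ennreal_ofReal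
    _ ≤ _ := by
        refine lintegral_mono fun y => ?_
        rw [lintegral_const_mul' _ _ ENNReal.ofReal_ne_top]
        exact mul_le_mul_right (gauss_avg_le d hd π hπ y w hw) _
end

section
/- Let π : ℝ^d → [0,∞] be superharmonic, let Σ be a d×d positive definite matrix with Gaussian density φ_Σ(x) = (2π)^{−d/2} (det Σ)^{−1/2} exp(−½ xᵀΣ⁻¹x), and assume the marginal m_π(x) = ∫_{ℝ^d} φ_Σ(x − a) π(a) da satisfies 0 < m_π(x) < ∞ for every x ∈ ℝ^d. Then log m_π is superharmonic: it is lower semicontinuous, not identically +∞, and for every x ∈ ℝ^d and every δ > 0 the integral of log m_π over the sphere {z : ‖z − x‖ = δ} with respect to the normalized (d−1)-dimensional surface measure is at most log m_π(x). -/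
open Matrix MeasureTheory Metric ENNReal

/-- The centered Gaussian density on `ℝ^d` with covariance matrix `S`:
`φ_S(x) = (2π)^{-d/2} (det S)^{-1/2} exp(-½ xᵀ S⁻¹ x)`. -/
noncomputable def gaussDensityMat (d : ℕ) (S : Matrix (Fin d) (Fin d) ℝ)
    (x : EuclideanSpace ℝ (Fin d)) : ℝ :=
  (2 * Real.pi) ^ (-(d : ℝ) / 2) * S.det ^ (-(1 : ℝ) / 2) *
    Real.exp (-(1 / 2) * ((fun i => x i) ⬝ᵥ (S⁻¹ *ᵥ fun i => x i)))

lemma radial_lip {E : Type*} [NormedAddCommGroup E] [NormedSpace ℝ E] (a b : E)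
    (ha : 1 ≤ ‖a‖) (hb : 1 ≤ ‖b‖) : ‖‖a‖⁻¹ • a - ‖b‖⁻¹ • b‖ ≤ 2 * ‖a - b‖ := by
  have h : ‖a‖⁻¹ • a - ‖b‖⁻¹ • b = ‖a‖⁻¹ • (a - b) + (‖a‖⁻¹ - ‖b‖⁻¹) • b := by
    rw [smul_sub, sub_smul]; abel
  have ha' : ‖a‖⁻¹ ≤ 1 := inv_le_one_of_one_le₀ ha
  have h1 : ‖‖a‖⁻¹ • (a - b)‖ ≤ ‖a - b‖ := by
    rw [norm_smul, norm_inv, norm_norm]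
    exact mul_le_of_le_one_left (norm_nonneg _) ha'
  have h2 : ‖(‖a‖⁻¹ - ‖b‖⁻¹) • b‖ ≤ ‖a - b‖ := by
    have e : (‖a‖⁻¹ - ‖b‖⁻¹) = ‖a‖⁻¹ * (‖b‖ - ‖a‖) * ‖b‖⁻¹ := by
      field_simp
    rw [norm_smul, e, norm_mul, norm_mul, norm_inv, norm_inv, norm_norm, norm_norm,
      mul_assoc, inv_mul_cancel₀ (by positivity), mul_one]
    refine (mul_le_of_le_one_left (norm_nonneg _) ha').trans ?_
    rw [norm_sub_rev a b]
    exact abs_norm_sub_norm_le _ _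
  rw [h]
  linarith [norm_add_le (‖a‖⁻¹ • (a - b)) ((‖a‖⁻¹ - ‖b‖⁻¹) • b)]

lemma sphere_lt_top (n : ℕ) (x : EuclideanSpace ℝ (Fin (n+1))) (δ : ℝ) (hδ : 0 < δ) :
    μH[(n : ℝ)] (sphere x δ) < ⊤ := by
  let p : Fin (n+1) × Bool → (Fin n → ℝ) → EuclideanSpace ℝ (Fin (n+1)) :=
    fun k u => WithLp.toLp 2 (k.1.insertNth (bif k.2 then (1:ℝ) else -1) u)
  have hp1 : ∀ k u, 1 ≤ ‖p k u‖ := by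
    intro k u
    have := PiLp.norm_apply_le (p k u) k.1
    refine le_trans ?_ this
    rcases k with ⟨i, _ | _⟩ <;> simp [p]
  obtain ⟨K, hK⟩ : ∃ K : NNReal, ∀ k u v, dist (p k u) (p k v) ≤ K * dist u v := by
    obtain ⟨K, hL⟩ : ∃ K, LipschitzWith K (WithLp.toLp 2 : (Fin (n+1) → ℝ) → _) :=
      ⟨_, PiLp.lipschitzWith_toLp 2 (fun _ : Fin (n+1) => ℝ)⟩
    refine ⟨K, fun k u v => (hL.dist_le_mul _ _).trans ?_⟩
    rw [Fin.dist_insertNth_insertNth]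
    simp only [dist_self, dist_nonneg, sup_of_le_right]
    exact le_rfl
  let f : Fin (n+1) × Bool → (Fin n → ℝ) → EuclideanSpace ℝ (Fin (n+1)) :=
    fun k u => x + δ • (‖p k u‖⁻¹ • p k u)
  have hf : ∀ k, LipschitzWith (δ.toNNReal * (2 * K)) (f k) := by
    intro k
    refine LipschitzWith.of_dist_le_mul fun u v => ?_
    simp only [f, dist_add_left]
    rw [dist_eq_norm, ← smul_sub, norm_smul, Real.norm_of_nonneg hδ.le]
    have h1 := radial_lip (p k u) (p k v) (hp1 k u) (hp1 k v)
    have h2 := hK k u v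
    rw [dist_eq_norm] at h2
    rw [NNReal.coe_mul, NNReal.coe_mul, Real.coe_toNNReal _ hδ.le, NNReal.coe_ofNat]
    rw [mul_assoc, mul_assoc]
    refine mul_le_mul_of_nonneg_left (h1.trans ?_) hδ.le
    exact mul_le_mul_of_nonneg_left h2 (by norm_num)
  have hcov : sphere x δ ⊆ ⋃ k, f k '' closedBall 0 1 := by
    intro z hz
    have hz' : ‖z - x‖ = δ := by simpa [dist_eq_norm] using hz
    set w := z - x with hw
    obtain ⟨i, -, hi⟩ := Finset.exists_max_image Finset.univ (fun i => |w i|) Finset.univ_nonempty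
    have hwi : 0 < |w i| := by
      by_contra hcon
      have : w = 0 := by
        ext j
        have h1 := hi j (Finset.mem_univ _)
        have : |w j| = 0 := le_antisymm (h1.trans (not_lt.mp hcon)) (abs_nonneg _)
        simpa using this
      rw [this, norm_zero] at hz'
      exact hδ.ne hz'
    let u : Fin n → ℝ := fun j => w (i.succAbove j) / |w i|
    have hpu : p (i, decide (0 < w i)) u = |w i|⁻¹ • w := by
      ext j
      refine Fin.succAboveCases i ?_ (fun j => ?_) j
      · simp only [p, Fin.insertNth_apply_same, PiLp.smul_apply, smul_eq_mul]
        by_cases h : 0 < w i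
        · simp [h, abs_of_pos h, h.ne']
        · have h' : w i < 0 := lt_of_le_of_ne (not_lt.mp h) (fun e => by simp [e] at hwi)
          simp [h, abs_of_neg h', h'.ne, inv_neg]
      · simp [p, u, div_eq_inv_mul]
    refine Set.mem_iUnion.2 ⟨(i, decide (0 < w i)), u, ?_, ?_⟩
    · rw [mem_closedBall_zero_iff, pi_norm_le_iff_of_nonneg zero_le_one]
      intro j
      simp only [u, norm_div, Real.norm_eq_abs, abs_abs]
      exact (div_le_one hwi).2 (hi _ (Finset.mem_univ _))
    · simp only [f]
      rw [hpu, norm_smul, norm_inv, Real.norm_eq_abs, abs_abs, hz', smul_smul, smul_smul]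
      have : δ * (|w i|⁻¹ * δ)⁻¹ * |w i|⁻¹ = 1 := by field_simp
      rw [this, one_smul, hw]; abel
  refine (measure_mono hcov).trans_lt ?_
  refine (measure_iUnion_le _).trans_lt ?_
  rw [tsum_fintype]
  refine ENNReal.sum_lt_top.2 fun k _ => ?_
  refine ((hf k).hausdorffMeasure_image_le (Nat.cast_nonneg n) _).trans_lt ?_
  have : (μH[(n:ℝ)] : Measure (Fin n → ℝ)) = volume := by
    simpa using hausdorffMeasure_pi_real (ι := Fin n)
  rw [this]
  exact ENNReal.mul_lt_top (ENNReal.rpow_lt_top_of_nonneg (Nat.cast_nonneg n) ENNReal.coe_ne_top)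
    (isCompact_closedBall _ _).measure_lt_top

lemma sphere_pos_s7 (n : ℕ) (x : EuclideanSpace ℝ (Fin (n+1))) (δ : ℝ) (hδ : 0 < δ) :
    0 < μH[(n : ℝ)] (sphere x δ) := by
  let q : EuclideanSpace ℝ (Fin (n+1)) → (Fin n → ℝ) := fun z j => z j.succ - x j.succ
  have hq : LipschitzWith 1 q := by
    refine LipschitzWith.of_dist_le_mul fun u v => ?_
    rw [NNReal.coe_one, one_mul, dist_pi_le_iff dist_nonneg]
    intro j
    simp only [q, dist_sub_right]
    rw [dist_eq_norm, dist_eq_norm]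
    exact PiLp.norm_apply_le (u - v) j.succ
  have hsub : ball 0 (δ / (n + 1)) ⊆ q '' sphere x δ := by
    intro u hu
    have hu' : ∀ j, |u j| ≤ δ / (n + 1) := by
      intro j
      rw [mem_ball_zero_iff] at hu
      exact (norm_le_pi_norm u j).trans hu.le
    have hs : ∑ j, (u j)^2 ≤ δ ^ 2 := by
      calc ∑ j, (u j)^2 ≤ ∑ j : Fin n, (δ / (n+1))^2 :=
            Finset.sum_le_sum fun j _ => sq_le_sq' (abs_le.1 (hu' j)).1 (abs_le.1 (hu' j)).2
        _ = n / (n+1)^2 * δ^2 := by simp; field_simp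
        _ ≤ 1 * δ^2 := by
            refine mul_le_mul_of_nonneg_right ?_ (sq_nonneg _)
            rw [div_le_one (by positivity)]
            nlinarith [(Nat.cast_nonneg n : (0:ℝ) ≤ n)]
        _ = _ := one_mul _
    refine ⟨x + WithLp.toLp 2 (Fin.cons (Real.sqrt (δ^2 - ∑ j, (u j)^2)) u), ?_, ?_⟩
    · rw [mem_sphere, dist_eq_norm, add_sub_cancel_left, EuclideanSpace.norm_eq, Fin.sum_univ_succ]
      simp only [Fin.cons_zero, Fin.cons_succ, Real.norm_eq_abs, sq_abs]
      rw [Real.sq_sqrt (by linarith), sub_add_cancel, Real.sqrt_sq hδ.le]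
    · ext j
      simp [q]
  have h1 := hq.hausdorffMeasure_image_le (Nat.cast_nonneg n) (sphere x δ)
  have : (μH[(n:ℝ)] : Measure (Fin n → ℝ)) = volume := by
    simpa using hausdorffMeasure_pi_real (ι := Fin n)
  rw [this] at h1
  simp only [ENNReal.coe_one, ENNReal.one_rpow, one_mul] at h1
  refine lt_of_lt_of_le ?_ ((measure_mono hsub).trans h1)
  exact measure_ball_pos _ _ (by positivity)

lemma gauss_cont (d : ℕ) (S : Matrix (Fin d) (Fin d) ℝ) : Continuous (gaussDensityMat d S) := by
  unfold gaussDensityMat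
  simp only [dotProduct, Matrix.mulVec]
  fun_prop

lemma gauss_pos (d : ℕ) (S : Matrix (Fin d) (Fin d) ℝ) (hS : S.PosDef)
    (x : EuclideanSpace ℝ (Fin d)) : 0 < gaussDensityMat d S x := by
  have := hS.det_pos
  unfold gaussDensityMat
  have := Real.pi_pos
  positivity

lemma marg_lsc (d : ℕ) (π : EuclideanSpace ℝ (Fin d) → ℝ≥0∞) (hπ : Measurable π)
    (S : Matrix (Fin d) (Fin d) ℝ) (hS : S.PosDef) :
    LowerSemicontinuous
      (fun x => ∫⁻ a, ENNReal.ofReal (gaussDensityMat d S (x - a)) * π a) := by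
  rw [lowerSemicontinuous_iff_le_liminf]
  intro x
  refine le_trans ?_ (lintegral_liminf_le fun y => ?_)
  · refine lintegral_mono fun a => ?_
    have ht : Filter.Tendsto (fun y => ENNReal.ofReal (gaussDensityMat d S (y - a)) * π a)
        (nhds x) (nhds (ENNReal.ofReal (gaussDensityMat d S (x - a)) * π a)) := by
      refine ENNReal.Tendsto.mul_const ?_ (Or.inl ?_)
      · refine (ENNReal.continuous_ofReal.comp ((gauss_cont d S).comp ?_)).tendsto x
        fun_prop
      · simpa using gauss_pos d S hS (x - a)
    exact ht.liminf_eq.ge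
  · have := (gauss_cont d S).measurable
    fun_prop

lemma sphere_mean_translate (d : ℕ) (s : ℝ) (π : EuclideanSpace ℝ (Fin d) → ℝ≥0∞)
    (x a : EuclideanSpace ℝ (Fin d)) (δ : ℝ) :
    ∫⁻ z in sphere x δ, π (z - a) ∂((μH[s] (sphere x δ))⁻¹ • μH[s]) =
    ∫⁻ z in sphere (x - a) δ, π z ∂((μH[s] (sphere (x - a) δ))⁻¹ • μH[s]) := by
  let e := IsometryEquiv.subRight a
  have hpre : e ⁻¹' sphere (x - a) δ = sphere x δ := by
    ext z; simp [e]
  have hmp := e.measurePreserving_hausdorffMeasure s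
  have hc : μH[s] (sphere x δ) = μH[s] (sphere (x - a) δ) := by
    rw [← hpre, e.hausdorffMeasure_preimage]
  rw [hc, Measure.restrict_smul, Measure.restrict_smul, lintegral_smul_measure,
    lintegral_smul_measure]
  congr 1
  have := hmp.setLIntegral_comp_preimage_emb e.toHomeomorph.measurableEmbedding π
    (sphere (x - a) δ)
  rw [hpre] at this
  exact this

lemma marg_super (d : ℕ) (π : EuclideanSpace ℝ (Fin d) → ℝ≥0∞) (hπ : SuperharmonicFn d π)
    (g : EuclideanSpace ℝ (Fin d) → ℝ) (hg : Measurable g)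
    (x : EuclideanSpace ℝ (Fin d)) (δ : ℝ) (hδ : 0 < δ)
    [SFinite (((μH[(d : ℝ) - 1] (sphere x δ))⁻¹ •
      (μH[(d : ℝ) - 1] : Measure (EuclideanSpace ℝ (Fin d)))).restrict (sphere x δ))] :
    ∫⁻ z in sphere x δ, (∫⁻ a, ENNReal.ofReal (g (z - a)) * π a)
      ∂((μH[(d : ℝ) - 1] (sphere x δ))⁻¹ • μH[(d : ℝ) - 1]) ≤
    ∫⁻ a, ENNReal.ofReal (g (x - a)) * π a := by
  have hm : Measurable π := hπ.1.measurable
  have key : ∀ z : EuclideanSpace ℝ (Fin d), ∫⁻ a, ENNReal.ofReal (g (z - a)) * π a =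
      ∫⁻ a, ENNReal.ofReal (g a) * π (z - a) := by
    intro z
    rw [← lintegral_sub_left_eq_self _ z]
    simp
  simp_rw [key]
  rw [lintegral_lintegral_swap (by fun_prop)]
  refine lintegral_mono fun a => ?_
  rw [lintegral_const_mul _ (by fun_prop), sphere_mean_translate]
  gcongr
  exact hπ.2.2 (x - a) δ hδ

theorem stmt7 (d : ℕ) (hd : 1 ≤ d)
    (π : EuclideanSpace ℝ (Fin d) → ℝ≥0∞) (hπ : SuperharmonicFn d π)
    (S : Matrix (Fin d) (Fin d) ℝ) (hS : S.PosDef)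
    (mπ : EuclideanSpace ℝ (Fin d) → ℝ≥0∞)
    (hmπ : mπ = fun x => ∫⁻ a, ENNReal.ofReal (gaussDensityMat d S (x - a)) * π a)
    (hpos : ∀ x, 0 < mπ x) (hfin : ∀ x, mπ x ≠ ⊤) :
    LowerSemicontinuous (fun x => Real.log (mπ x).toReal) ∧
    ∀ (x : EuclideanSpace ℝ (Fin d)) (δ : ℝ), 0 < δ →
      ∫ z in sphere x δ, Real.log (mπ z).toReal
          ∂((μH[(d : ℝ) - 1] (sphere x δ))⁻¹ • μH[(d : ℝ) - 1]) ≤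
        Real.log (mπ x).toReal := by
  have hm : Measurable π := hπ.1.measurable
  have hlsc : LowerSemicontinuous mπ := by rw [hmπ]; exact marg_lsc d π hm S hS
  have hpr : ∀ x, 0 < (mπ x).toReal := fun x => ENNReal.toReal_pos (hpos x).ne' (hfin x)
  have hlog : LowerSemicontinuous (fun x => Real.log (mπ x).toReal) := by
    intro x y hy
    have hy' : y < Real.log (mπ x).toReal := hy
    rw [Real.lt_log_iff_exp_lt (hpr x), ← ENNReal.ofReal_lt_iff_lt_toReal (Real.exp_pos _).le
      (hfin x)] at hy'
    filter_upwards [hlsc x _ hy'] with z hz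
    rw [gt_iff_lt, ENNReal.ofReal_lt_iff_lt_toReal (Real.exp_pos _).le (hfin z)] at hz
    exact (Real.lt_log_iff_exp_lt (hpr z)).2 hz
  refine ⟨hlog, fun x δ hδ => ?_⟩
  obtain ⟨n, rfl⟩ : ∃ n, d = n + 1 := ⟨d - 1, by omega⟩
  have hn : ((n + 1 : ℕ) : ℝ) - 1 = n := by push_cast; ring
  have hc0 : μH[((n + 1 : ℕ) : ℝ) - 1] (sphere x δ) ≠ 0 := by
    rw [hn]; exact (sphere_pos_s7 n x δ hδ).ne'
  have hc1 : μH[((n + 1 : ℕ) : ℝ) - 1] (sphere x δ) ≠ ⊤ := by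
    rw [hn]; exact (sphere_lt_top n x δ hδ).ne
  have hprob : IsProbabilityMeasure (((μH[((n + 1 : ℕ) : ℝ) - 1] (sphere x δ))⁻¹ •
      (μH[((n + 1 : ℕ) : ℝ) - 1] :
        Measure (EuclideanSpace ℝ (Fin (n + 1))))).restrict (sphere x δ)) := by
    constructor
    rw [Measure.restrict_apply_univ, Measure.smul_apply, smul_eq_mul,
      ENNReal.inv_mul_cancel hc0 hc1]
  have hsup := marg_super (n + 1) π hπ (gaussDensityMat (n + 1) S) (gauss_cont _ S).measurable
    x δ hδ
  have hmx : ∀ z, ∫⁻ a, ENNReal.ofReal (gaussDensityMat (n + 1) S (z - a)) * π a = mπ z := by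
    intro z; rw [hmπ]
  simp_rw [hmx] at hsup
  set μ := ((μH[((n + 1 : ℕ) : ℝ) - 1] (sphere x δ))⁻¹ •
      (μH[((n + 1 : ℕ) : ℝ) - 1] :
        Measure (EuclideanSpace ℝ (Fin (n + 1))))).restrict (sphere x δ) with hμ
  have hmeas : Measurable mπ := hlsc.measurable
  have hint : Integrable (fun z => (mπ z).toReal) μ :=
    integrable_toReal_of_lintegral_ne_top hmeas.aemeasurable
      (ne_top_of_le_ne_top (hfin x) hsup)
  have hmean : ∫ z, (mπ z).toReal ∂μ ≤ (mπ x).toReal := by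
    rw [integral_toReal hmeas.aemeasurable
      (Filter.Eventually.of_forall fun z => (hfin z).lt_top)]
    exact ENNReal.toReal_mono (hfin x) hsup
  -- lower bound on the sphere
  obtain ⟨b, hb⟩ := (hlog.lowerSemicontinuousOn (sphere x δ)).bddBelow_of_isCompact
    (isCompact_sphere x δ)
  have hmeml : ∀ᵐ z ∂μ, z ∈ sphere x δ := ae_restrict_mem isClosed_sphere.measurableSet
  have hlogint : Integrable (fun z => Real.log (mπ z).toReal) μ := by
    refine Integrable.mono' (g := fun z => |b| + (mπ z).toReal) ((integrable_const _).add hint)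
      hlog.measurable.aestronglyMeasurable ?_
    filter_upwards [hmeml] with z hz
    have h1 : b ≤ Real.log (mπ z).toReal := hb (Set.mem_image_of_mem _ hz)
    have h2 := Real.log_le_sub_one_of_pos (hpr z)
    have h3 := hpr z
    rw [Real.norm_eq_abs, abs_le]
    constructor
    · linarith [neg_abs_le b]
    · linarith [abs_nonneg b]
  set c := (mπ x).toReal with hcdef
  have hc : 0 < c := hpr x
  calc ∫ z, Real.log (mπ z).toReal ∂μ
      ≤ ∫ z, ((Real.log c - 1) + c⁻¹ * (mπ z).toReal) ∂μ := by
        refine integral_mono hlogint ((integrable_const _).add (hint.const_mul _)) fun z => ?_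
        have h := Real.log_le_sub_one_of_pos (mul_pos (inv_pos.2 hc) (hpr z))
        rw [Real.log_mul (inv_pos.2 hc).ne' (hpr z).ne', Real.log_inv] at h
        show Real.log (mπ z).toReal ≤ (Real.log c - 1) + c⁻¹ * (mπ z).toReal
        linarith
    _ = (Real.log c - 1) + c⁻¹ * ∫ z, (mπ z).toReal ∂μ := by
        rw [integral_add (integrable_const _) (hint.const_mul _), integral_const_mul]
        simp
    _ ≤ (Real.log c - 1) + c⁻¹ * c := by gcongr
    _ = Real.log c := by rw [inv_mul_cancel₀ hc.ne']; ring
end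

section
/- (Theorem 3, part 1) Let n, m be integers with m ≥ 1 and n − m ≥ 2. Let m_SVS(X) = ∫_{ℝ^{n×m}} (2π)^{−nm/2} exp(−½‖X − M‖_F²) π_SVS(M) dM (which is finite and positive for every X), and define the Bayes estimator M̂(X) = X + ∇ log m_SVS(X). Then M̂ dominates the maximum likelihood estimator X under the Frobenius risk: for every M ∈ ℝ^{n×m}, E_{X∼N_{n,m}(M,I_n,I_m)}[‖M̂(X) − M‖_F²] < nm = E_{X∼N_{n,m}(M,I_n,I_m)}[‖X − M‖_F²]. -/
open Matrix MeasureTheory ENNReal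
open scoped Classical

/-- The density of `N_{n,m}(M, I_n, I_m)` (i.i.d. standard normal entries) at `X`. -/
noncomputable def matGaussDensity (n m : ℕ) (X M : EuclideanSpace ℝ (Fin n × Fin m)) : ℝ :=
  (2 * Real.pi) ^ (-((n : ℝ) * m) / 2) * Real.exp (-‖X - M‖ ^ 2 / 2)

/-- The marginal density of the singular value shrinkage prior. -/
noncomputable def mSVS (n m : ℕ) (X : EuclideanSpace ℝ (Fin n × Fin m)) : ℝ≥0∞ :=
  ∫⁻ M, ENNReal.ofReal (matGaussDensity n m X M) * piSVS n m M


section PartOne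
variable {ι : Type*} [Fintype ι]

/-- all Gaussian weights are integrable -/
def Adm (μ : Measure (EuclideanSpace ℝ ι)) : Prop :=
  ∀ a : ℝ, 0 < a → Integrable (fun M => Real.exp (-a * ‖M‖ ^ 2)) μ

/-- continuous with exponential growth -/
def Gro (p : EuclideanSpace ℝ ι → ℝ) : Prop :=
  Continuous p ∧ ∃ C k : ℝ, 0 ≤ C ∧ 0 ≤ k ∧ ∀ M, |p M| ≤ C * Real.exp (k * ‖M‖)

lemma gro_one : Gro (fun _ : EuclideanSpace ℝ ι => (1 : ℝ)) :=
  ⟨continuous_const, 1, 0, by norm_num, le_refl _, fun M => by simp⟩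

lemma norm_le_exp (r : ℝ) : r ≤ Real.exp r := by
  linarith [Real.add_one_le_exp r]

lemma coord_le (M : EuclideanSpace ℝ ι) (i : ι) : |M i| ≤ ‖M‖ := by
  simpa using PiLp.norm_apply_le M i

lemma gro_mul_coord {p : EuclideanSpace ℝ ι → ℝ} (hp : Gro p) (i : ι) :
    Gro (fun M => p M * M i) := by
  obtain ⟨hc, C, k, hC, hk, hb⟩ := hp
  refine ⟨hc.mul (by fun_prop), C, k + 1, hC, by linarith, fun M => ?_⟩
  rw [abs_mul, add_mul, Real.exp_add, one_mul, ← mul_assoc]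
  exact mul_le_mul (hb M) ((coord_le M i).trans (norm_le_exp _)) (abs_nonneg _) (by positivity)

lemma gro_mul_norm {p : EuclideanSpace ℝ ι → ℝ} (hp : Gro p) :
    Gro (fun M => p M * ‖M‖) := by
  obtain ⟨hc, C, k, hC, hk, hb⟩ := hp
  refine ⟨hc.mul (by fun_prop), C, k + 1, hC, by linarith, fun M => ?_⟩
  rw [abs_mul, add_mul, Real.exp_add, one_mul, ← mul_assoc, abs_norm]
  exact mul_le_mul (hb M) (norm_le_exp _) (norm_nonneg _) (by positivity)

lemma gro_of_bdd {p : EuclideanSpace ℝ ι → ℝ} (hc : Continuous p) (C : ℝ)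
    (h : ∀ M, |p M| ≤ C) : Gro p :=
  ⟨hc, C, 0, (abs_nonneg _).trans (h 0), le_refl _, fun M => by simpa using h M⟩

lemma gauss_bound (X M : EuclideanSpace ℝ ι) (a k : ℝ) (ha : 0 < a) :
    k * ‖M‖ - a * ‖X - M‖ ^ 2 ≤ (a * ‖X‖ ^ 2 + k ^ 2 / a) + -(a / 4) * ‖M‖ ^ 2 := by
  have h1 : ‖M‖ ≤ ‖X‖ + ‖X - M‖ := by
    have : M = X - (X - M) := by abel
    calc ‖M‖ = ‖X - (X - M)‖ := by rw [← this]
      _ ≤ _ := norm_sub_le _ _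
  have h2 : ‖M‖ ^ 2 ≤ 2 * ‖X‖ ^ 2 + 2 * ‖X - M‖ ^ 2 := by
    nlinarith [norm_nonneg M, norm_nonneg X, norm_nonneg (X - M), sq_nonneg (‖X‖ - ‖X - M‖)]
  have h3 : k * ‖M‖ ≤ a / 4 * ‖M‖ ^ 2 + k ^ 2 / a := by
    have : 0 ≤ (a / 2 * ‖M‖ - k) ^ 2 / a := by positivity
    have e : (a / 2 * ‖M‖ - k) ^ 2 / a = a / 4 * ‖M‖ ^ 2 - k * ‖M‖ + k ^ 2 / a := by
      field_simp; ring
    linarith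
  nlinarith

lemma int_gauss {μ : Measure (EuclideanSpace ℝ ι)} (hμ : Adm μ) {p : EuclideanSpace ℝ ι → ℝ}
    (hp : Gro p) (X : EuclideanSpace ℝ ι) {a : ℝ} (ha : 0 < a) :
    Integrable (fun M => p M * Real.exp (-a * ‖X - M‖ ^ 2)) μ := by
  obtain ⟨hc, C, k, hC, hk, hb⟩ := hp
  refine Integrable.mono' (((hμ (a / 4) (by positivity)).const_mul
    (C * Real.exp (a * ‖X‖ ^ 2 + k ^ 2 / a)))) ?_ ?_
  · exact (hc.mul (by fun_prop)).aestronglyMeasurable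
  · refine Filter.Eventually.of_forall fun M => ?_
    rw [Real.norm_eq_abs, abs_mul, Real.abs_exp, mul_assoc, ← Real.exp_add]
    calc |p M| * Real.exp (-a * ‖X - M‖ ^ 2)
        ≤ C * Real.exp (k * ‖M‖) * Real.exp (-a * ‖X - M‖ ^ 2) := by gcongr; exact hb M
      _ = C * Real.exp (k * ‖M‖ - a * ‖X - M‖ ^ 2) := by
          rw [mul_assoc, ← Real.exp_add]; congr 2; ring
      _ ≤ _ := by gcongr; exact gauss_bound X M a k ha

lemma adm_volume : Adm (volume : Measure (EuclideanSpace ℝ ι)) := by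
  intro a ha
  have := GaussianFourier.integrable_cexp_neg_mul_sq_norm_add (V := EuclideanSpace ℝ ι)
    (b := (a : ℂ)) (by simpa using ha) 0 0
  have h2 := this.norm
  refine h2.congr (Filter.Eventually.of_forall fun M => ?_)
  simp only [Complex.norm_exp]
  congr 1
  simp [← Complex.ofReal_pow]

/-- Gaussian-weighted integral -/
noncomputable def HH (μ : Measure (EuclideanSpace ℝ ι)) (p : EuclideanSpace ℝ ι → ℝ)
    (X : EuclideanSpace ℝ ι) : ℝ := ∫ M, p M * Real.exp (-(1 / 2) * ‖X - M‖ ^ 2) ∂μ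

lemma hasFDerivAt_gauss (M X : EuclideanSpace ℝ ι) (c a : ℝ) :
    HasFDerivAt (fun X => c * Real.exp (-a * ‖X - M‖ ^ 2))
      ((-(2 * a) * (c * Real.exp (-a * ‖X - M‖ ^ 2))) • innerSL ℝ (X - M)) X := by
  have h1 : HasFDerivAt (fun X : EuclideanSpace ℝ ι => X - M)
      (ContinuousLinearMap.id ℝ _) X := (hasFDerivAt_id X).sub_const M
  have h2 := h1.norm_sq
  have h3 := ((h2.const_mul (-a)).exp).const_mul c
  refine h3.congr_fderiv ?_
  ext v
  simp
  ring

lemma HH_hasFDerivAt {μ : Measure (EuclideanSpace ℝ ι)} (hμ : Adm μ)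
    {p : EuclideanSpace ℝ ι → ℝ} (hp : Gro p) (X : EuclideanSpace ℝ ι) :
    ∃ L : EuclideanSpace ℝ ι →L[ℝ] ℝ, HasFDerivAt (HH μ p) L X ∧
      ∀ i, L (EuclideanSpace.single i 1) = HH μ (fun M => p M * M i) X - X i * HH μ p X := by
  have hp0 := hp
  obtain ⟨hc, C, k, hC, hk, hb⟩ := hp
  set F' : EuclideanSpace ℝ ι → EuclideanSpace ℝ ι → EuclideanSpace ℝ ι →L[ℝ] ℝ :=
    fun X M => (-(2 * (1 / 2)) * (p M * Real.exp (-(1 / 2) * ‖X - M‖ ^ 2))) • innerSL ℝ (X - M)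
    with hF'
  set R := ‖X‖ + 1 with hR
  have hbd : ∀ Y ∈ Metric.ball X 1, ∀ M, ‖F' Y M‖ ≤
      (C * Real.exp (R + (1 / 2 * R ^ 2 + (k + 1) ^ 2 / (1 / 2)))) *
        Real.exp (-((1 / 2) / 4) * ‖M‖ ^ 2) := by
    intro Y hY M
    have hYR : ‖Y‖ ≤ R := by
      have : ‖Y - X‖ < 1 := by simpa [dist_eq_norm] using hY
      have h := norm_add_le (Y - X) X
      rw [sub_add_cancel] at h
      linarith
    have h1 : ‖F' Y M‖ = |p M| * Real.exp (-(1 / 2) * ‖Y - M‖ ^ 2) * ‖Y - M‖ := by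
      simp only [hF']
      rw [norm_smul, innerSL_apply_norm]
      simp
    rw [h1]
    have h2 : ‖Y - M‖ ≤ Real.exp (R + ‖M‖) :=
      ((norm_sub_le _ _).trans (by linarith)).trans (norm_le_exp _)
    calc _ ≤ (C * Real.exp (k * ‖M‖)) * Real.exp (-(1 / 2) * ‖Y - M‖ ^ 2) * Real.exp (R + ‖M‖) := by
            gcongr; exact hb M
      _ = C * Real.exp (R + ((k + 1) * ‖M‖ - 1 / 2 * ‖Y - M‖ ^ 2)) := by
          rw [mul_assoc, mul_assoc, ← Real.exp_add, ← Real.exp_add]; congr 2; ring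
      _ ≤ C * Real.exp (R + ((1 / 2 * R ^ 2 + (k + 1) ^ 2 / (1 / 2)) +
            -((1 / 2) / 4) * ‖M‖ ^ 2)) := by
          gcongr
          refine (gauss_bound Y M (1 / 2) (k + 1) (by norm_num)).trans ?_
          gcongr
      _ = _ := by rw [mul_assoc, ← Real.exp_add]; congr 2; ring
  have hbi : Integrable (fun M => (C * Real.exp (R + (1 / 2 * R ^ 2 + (k + 1) ^ 2 / (1 / 2)))) *
        Real.exp (-((1 / 2) / 4) * ‖M‖ ^ 2)) μ := (hμ _ (by norm_num)).const_mul _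
  have hF'm : AEStronglyMeasurable (F' X) μ := by
    apply Continuous.aestronglyMeasurable
    fun_prop
  have hF'i : Integrable (F' X) μ :=
    hbi.mono' hF'm (Filter.Eventually.of_forall fun M => hbd X (by simp) M)
  refine ⟨∫ M, F' X M ∂μ, ?_, ?_⟩
  · refine hasFDerivAt_integral_of_dominated_of_fderiv_le (Metric.ball_mem_nhds X one_pos)
      (Filter.Eventually.of_forall fun Y => ?_) (int_gauss hμ hp0 X (by norm_num)) hF'm
      (Filter.Eventually.of_forall fun M Y hY => hbd Y hY M) hbi
      (Filter.Eventually.of_forall fun M Y hY => hasFDerivAt_gauss M Y (p M) (1 / 2))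
    exact (hc.mul (by fun_prop)).aestronglyMeasurable
  · intro i
    rw [ContinuousLinearMap.integral_apply hF'i]
    unfold HH
    rw [← integral_const_mul, ← integral_sub
      (int_gauss hμ (gro_mul_coord hp0 i) X (by norm_num))
      ((int_gauss hμ hp0 X (by norm_num)).const_mul _)]
    congr 1
    ext M
    simp [hF', EuclideanSpace.inner_single_right]
    ring

lemma HH_continuous {μ : Measure (EuclideanSpace ℝ ι)} (hμ : Adm μ)
    {p : EuclideanSpace ℝ ι → ℝ} (hp : Gro p) : Continuous (HH μ p) :=
  continuous_iff_continuousAt.2 fun X =>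
    let ⟨_, h, _⟩ := HH_hasFDerivAt hμ hp X; h.continuousAt

end PartOne

section PartTwo
variable {ι : Type*} [Fintype ι]

lemma norm_sq_sub_eq (X M : EuclideanSpace ℝ ι) :
    ‖X - M‖ ^ 2 = ∑ i, (M i * M i - 2 * (X i * M i) + X i ^ 2) := by
  rw [EuclideanSpace.norm_sq_eq]
  refine Finset.sum_congr rfl fun i _ => ?_
  simp only [PiLp.sub_apply, Real.norm_eq_abs, sq_abs]
  ring

lemma gro_sq : Gro (fun M : EuclideanSpace ℝ ι => ‖M‖ * ‖M‖) := by
  simpa using gro_mul_norm (gro_mul_norm (gro_one (ι := ι)))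

/-- the infinitesimal consequence of monotonicity under the heat flow -/
lemma lap_nonpos {μ : Measure (EuclideanSpace ℝ ι)} (hμ : Adm μ) (X : EuclideanSpace ℝ ι)
    (hmono : MonotoneOn (fun t : ℝ => t ^ (Fintype.card ι) *
      ∫ M, Real.exp (-(t ^ 2 / 2) * ‖X - M‖ ^ 2) ∂μ) (Set.Ioi 0)) :
    (∫ M, ‖X - M‖ ^ 2 * Real.exp (-(1 / 2) * ‖X - M‖ ^ 2) ∂μ) ≤
      Fintype.card ι * HH μ (fun _ => 1) X := by
  have hsq : ∀ M : EuclideanSpace ℝ ι, 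
      2 * (‖X - M‖ ^ 2 * Real.exp (-(1 / 8) * ‖X - M‖ ^ 2)) ≤
        32 * Real.exp (-(1 / 16) * ‖X - M‖ ^ 2) := by
    intro M
    have h := norm_le_exp ((1 / 16) * ‖X - M‖ ^ 2)
    have e : Real.exp (-(1 / 16) * ‖X - M‖ ^ 2) =
      Real.exp ((1 / 16) * ‖X - M‖ ^ 2) * Real.exp (-(1 / 8) * ‖X - M‖ ^ 2) := by
      rw [← Real.exp_add]; congr 1; ring
    rw [e]
    have := mul_le_mul_of_nonneg_right h (Real.exp_pos (-(1 / 8) * ‖X - M‖ ^ 2)).le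
    linarith
  have hd := hasDerivAt_integral_of_dominated_loc_of_deriv_le (μ := μ) (x₀ := (1 : ℝ))
    (F := fun t M => Real.exp (-(t ^ 2 / 2) * ‖X - M‖ ^ 2))
    (F' := fun t M => Real.exp (-(t ^ 2 / 2) * ‖X - M‖ ^ 2) * (-t * ‖X - M‖ ^ 2))
    (bound := fun M => 32 * Real.exp (-(1 / 16) * ‖X - M‖ ^ 2))
    (s := Set.Ioo (1 / 2) 2) (Ioo_mem_nhds (by norm_num) (by norm_num))
    (Filter.Eventually.of_forall fun t => by
      apply Continuous.aestronglyMeasurable; fun_prop)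
    (by simpa using int_gauss hμ gro_one X (a := 1 / 2) (by norm_num))
    (by apply Continuous.aestronglyMeasurable; fun_prop)
    (Filter.Eventually.of_forall fun M t ht => by
      refine le_trans ?_ (hsq M)
      rw [norm_mul, norm_mul, norm_neg, Real.norm_eq_abs, Real.norm_eq_abs, Real.norm_eq_abs,
        Real.abs_exp, abs_of_pos (by linarith [ht.1] : 0 < t), abs_of_nonneg (by positivity)]
      have h1 : Real.exp (-(t ^ 2 / 2) * ‖X - M‖ ^ 2) ≤ Real.exp (-(1 / 8) * ‖X - M‖ ^ 2) := by
        have h4 : (1 : ℝ) / 8 ≤ t ^ 2 / 2 := by nlinarith [ht.1]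
        have := mul_le_mul_of_nonneg_right h4 (sq_nonneg ‖X - M‖)
        exact Real.exp_le_exp.2 (by linarith)
      have h2 : t ≤ 2 := ht.2.le
      have h3 : 0 ≤ t := by linarith [ht.1]
      calc _ ≤ Real.exp (-(1 / 8) * ‖X - M‖ ^ 2) * (2 * ‖X - M‖ ^ 2) := by gcongr
        _ = _ := by ring)
    (by simpa using (int_gauss hμ gro_one X (a := 1 / 16) (by norm_num)).const_mul 32)
    (Filter.Eventually.of_forall fun M t ht => by
      have h1 : HasDerivAt (fun t : ℝ => -(t ^ 2 / 2) * ‖X - M‖ ^ 2) (-t * ‖X - M‖ ^ 2) t := by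
        have := (((hasDerivAt_pow 2 t).div_const 2).neg).mul_const (‖X - M‖ ^ 2)
        refine this.congr_deriv ?_
        simp
      exact h1.exp)
  have hd2 := (hasDerivAt_pow (Fintype.card ι) (1 : ℝ)).mul hd.2
  have hnn := hd2.hasDerivWithinAt (s := Set.Ioi 0)
  have hge : 0 ≤ derivWithin (fun t : ℝ => t ^ (Fintype.card ι) *
      ∫ M, Real.exp (-(t ^ 2 / 2) * ‖X - M‖ ^ 2) ∂μ) (Set.Ioi 0) 1 := hmono.derivWithin_nonneg
  have heq := hnn.derivWithin ((isOpen_Ioi.uniqueDiffOn) 1 (by simp))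
  have heq' := hge.trans_eq heq
  have e1 : ∫ M, Real.exp (-((1 : ℝ) ^ 2 / 2) * ‖X - M‖ ^ 2) * (-1 * ‖X - M‖ ^ 2) ∂μ =
      - ∫ M, ‖X - M‖ ^ 2 * Real.exp (-(1 / 2) * ‖X - M‖ ^ 2) ∂μ := by
    rw [← integral_neg]; congr 1; ext M; norm_num; ring
  rw [e1] at heq'
  unfold HH
  simp only [one_pow, mul_one, one_mul] at heq' ⊢
  linarith

/-- coordinates of the score -/
noncomputable def gi (μ : Measure (EuclideanSpace ℝ ι)) (i : ι) (X : EuclideanSpace ℝ ι) : ℝ :=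
  HH μ (fun M => 1 * M i) X / HH μ (fun _ => 1) X - X i

noncomputable def dgi (μ : Measure (EuclideanSpace ℝ ι)) (i : ι) (X : EuclideanSpace ℝ ι) : ℝ :=
  HH μ (fun M => 1 * M i * M i) X / HH μ (fun _ => 1) X -
    (HH μ (fun M => 1 * M i) X / HH μ (fun _ => 1) X) ^ 2 - 1

lemma gro_coord (i : ι) : Gro (fun M : EuclideanSpace ℝ ι => 1 * M i) := gro_mul_coord gro_one i

lemma gro_coord2 (i : ι) : Gro (fun M : EuclideanSpace ℝ ι => 1 * M i * M i) :=
  gro_mul_coord (gro_coord i) i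

lemma HH_expand {μ : Measure (EuclideanSpace ℝ ι)} (hμ : Adm μ) (X : EuclideanSpace ℝ ι) :
    (∫ M, ‖X - M‖ ^ 2 * Real.exp (-(1 / 2) * ‖X - M‖ ^ 2) ∂μ) =
      ∑ i, (HH μ (fun M => 1 * M i * M i) X - 2 * X i * HH μ (fun M => 1 * M i) X
        + X i ^ 2 * HH μ (fun _ => 1) X) := by
  have hh : (0 : ℝ) < 1 / 2 := by norm_num
  have : ∀ i ∈ Finset.univ, Integrable (fun M : EuclideanSpace ℝ ι =>
      1 * M i * M i * Real.exp (-(1 / 2) * ‖X - M‖ ^ 2)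
        - 2 * X i * (1 * M i * Real.exp (-(1 / 2) * ‖X - M‖ ^ 2))
        + X i ^ 2 * (1 * Real.exp (-(1 / 2) * ‖X - M‖ ^ 2))) μ := fun i _ =>
    ((int_gauss hμ (gro_coord2 i) X hh).sub
      ((int_gauss hμ (gro_coord i) X hh).const_mul _)).add
      ((int_gauss hμ gro_one X hh).const_mul _)
  calc _ = ∫ M, ∑ i, (1 * M i * M i * Real.exp (-(1 / 2) * ‖X - M‖ ^ 2)
        - 2 * X i * (1 * M i * Real.exp (-(1 / 2) * ‖X - M‖ ^ 2))
        + X i ^ 2 * (1 * Real.exp (-(1 / 2) * ‖X - M‖ ^ 2))) ∂μ := by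
        congr 1; ext M
        nth_rw 1 [norm_sq_sub_eq]
        rw [Finset.sum_mul]
        refine Finset.sum_congr rfl fun i _ => by ring
    _ = _ := by
        rw [integral_finsetSum _ this]
        refine Finset.sum_congr rfl fun i _ => ?_
        have hi : Integrable (fun M : EuclideanSpace ℝ ι =>
            1 * M i * M i * Real.exp (-(1 / 2) * ‖X - M‖ ^ 2)
            - 2 * X i * (1 * M i * Real.exp (-(1 / 2) * ‖X - M‖ ^ 2))) μ :=
          ((int_gauss hμ (gro_coord2 i) X hh).sub
            ((int_gauss hμ (gro_coord i) X hh).const_mul _))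
        rw [integral_add hi ((int_gauss hμ gro_one X hh).const_mul _),
          integral_sub (int_gauss hμ (gro_coord2 i) X hh)
          ((int_gauss hμ (gro_coord i) X hh).const_mul _), integral_const_mul,
          integral_const_mul]
        rfl

lemma div_le {μ : Measure (EuclideanSpace ℝ ι)} (hμ : Adm μ) (X : EuclideanSpace ℝ ι)
    (hpos : 0 < HH μ (fun _ => 1) X)
    (hmono : MonotoneOn (fun t : ℝ => t ^ (Fintype.card ι) *
      ∫ M, Real.exp (-(t ^ 2 / 2) * ‖X - M‖ ^ 2) ∂μ) (Set.Ioi 0)) :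
    ∑ i, dgi μ i X ≤ - ∑ i, gi μ i X ^ 2 := by
  have h := lap_nonpos hμ X hmono
  rw [HH_expand hμ X] at h
  set m := HH μ (fun _ => 1) X with hm
  have e : ∑ i, (dgi μ i X + gi μ i X ^ 2) = (∑ i, (HH μ (fun M => 1 * M i * M i) X -
      2 * X i * HH μ (fun M => 1 * M i) X + X i ^ 2 * m) - Fintype.card ι * m) / m := by
    have : (Fintype.card ι : ℝ) * m = ∑ i : ι, m := by simp
    rw [this, ← Finset.sum_sub_distrib, Finset.sum_div]
    refine Finset.sum_congr rfl fun i _ => ?_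
    unfold dgi gi
    rw [← hm]
    field_simp
    ring
  rw [Finset.sum_add_distrib] at e
  have : (∑ i, (HH μ (fun M => 1 * M i * M i) X -
      2 * X i * HH μ (fun M => 1 * M i) X + X i ^ 2 * m) - Fintype.card ι * m) / m ≤ 0 :=
    div_nonpos_of_nonpos_of_nonneg (by linarith) hpos.le
  linarith

lemma gi_deriv {μ : Measure (EuclideanSpace ℝ ι)} (hμ : Adm μ)
    (hpos : ∀ X, 0 < HH μ (fun _ => 1) X) (i : ι) (X : EuclideanSpace ℝ ι) :
    HasLineDerivAt ℝ (gi μ i) (dgi μ i X) X (EuclideanSpace.single i 1) := by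
  obtain ⟨L1, h1, e1⟩ := HH_hasFDerivAt hμ (gro_coord i) X
  obtain ⟨L0, h0, e0⟩ := HH_hasFDerivAt hμ gro_one X
  have hc : HasFDerivAt (fun X : EuclideanSpace ℝ ι => X i)
    (EuclideanSpace.proj i : EuclideanSpace ℝ ι →L[ℝ] ℝ) X :=
    (EuclideanSpace.proj i : EuclideanSpace ℝ ι →L[ℝ] ℝ).hasFDerivAt
  have l1 := h1.hasLineDerivAt (EuclideanSpace.single i 1)
  have l0 := h0.hasLineDerivAt (EuclideanSpace.single i 1)
  have lc := hc.hasLineDerivAt (EuclideanSpace.single i 1)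
  unfold HasLineDerivAt at l1 l0 lc ⊢
  have hx := (hpos X).ne'
  have h := (l1.div l0 (by simpa using hx)).sub lc
  refine h.congr_deriv ?_
  simp [e1, e0, dgi]
  simp only [one_mul] at *
  field_simp
  ring

lemma gi_cont {μ : Measure (EuclideanSpace ℝ ι)} (hμ : Adm μ)
    (hpos : ∀ X, 0 < HH μ (fun _ => 1) X) (i : ι) : Continuous (gi μ i) := by
  unfold gi
  exact ((HH_continuous hμ (gro_coord i)).div (HH_continuous hμ gro_one)
    fun X => (hpos X).ne').sub (by fun_prop)

lemma dgi_cont {μ : Measure (EuclideanSpace ℝ ι)} (hμ : Adm μ)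
    (hpos : ∀ X, 0 < HH μ (fun _ => 1) X) (i : ι) : Continuous (dgi μ i) := by
  unfold dgi
  exact ((((HH_continuous hμ (gro_coord2 i)).div (HH_continuous hμ gro_one)
    fun X => (hpos X).ne')).sub (((HH_continuous hμ (gro_coord i)).div (HH_continuous hμ gro_one)
    fun X => (hpos X).ne').pow 2)).sub continuous_const

noncomputable def gv (μ : Measure (EuclideanSpace ℝ ι)) (X : EuclideanSpace ℝ ι) :
    EuclideanSpace ℝ ι := WithLp.toLp 2 fun i => gi μ i X

lemma gv_grad {μ : Measure (EuclideanSpace ℝ ι)} (hμ : Adm μ)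
    (hpos : ∀ X, 0 < HH μ (fun _ => 1) X) (K : ℝ) (hK : 0 < K) (X : EuclideanSpace ℝ ι) :
    gradient (fun Y => Real.log (K * HH μ (fun _ => 1) Y)) X = gv μ X := by
  obtain ⟨L0, h0, e0⟩ := HH_hasFDerivAt hμ gro_one X
  have hx := (hpos X).ne'
  have h := (h0.const_mul K).log (mul_pos hK (hpos X)).ne'
  have hg := h.hasGradientAt.gradient
  rw [hg]
  ext i
  have : ∀ v : EuclideanSpace ℝ ι, v i = inner ℝ v (EuclideanSpace.single i 1) := by
    intro v; simp [EuclideanSpace.inner_single_right]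
  rw [this, InnerProductSpace.toDual_symm_apply]
  simp [e0, gv, gi]
  field_simp

end PartTwo

section PartThree
variable {ι : Type*} [Fintype ι]

lemma exists_cutoff : ∃ C : ℝ, 0 ≤ C ∧ ∀ k : ℕ, ∃ χ : EuclideanSpace ℝ ι → ℝ,
    ContDiff ℝ 1 χ ∧ HasCompactSupport χ ∧ (∀ X, 0 ≤ χ X) ∧ (∀ X, χ X ≤ 1) ∧
    (∀ X, ‖X‖ ≤ k → χ X = 1) ∧
    ∀ X i, |fderiv ℝ χ X (EuclideanSpace.single i 1)| ≤ C / (k + 1) := by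
  let f : ContDiffBump (0 : EuclideanSpace ℝ ι) := ⟨1, 2, by norm_num, by norm_num⟩
  have hf1 : ContDiff ℝ 1 f := f.contDiff
  have hfc : HasCompactSupport f := f.hasCompactSupport
  obtain ⟨C, hC⟩ := (hfc.fderiv (𝕜 := ℝ)).exists_bound_of_continuous
    (hf1.continuous_fderiv (by norm_num))
  refine ⟨C, (norm_nonneg _).trans (hC 0), fun k => ?_⟩
  have hk : (0 : ℝ) < (k : ℝ) + 1 := by positivity
  refine ⟨fun X => f (((k : ℝ) + 1)⁻¹ • X), hf1.comp (by fun_prop),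
    hfc.comp_smul (by positivity), fun X => f.nonneg, fun X => f.le_one, fun X hX => ?_,
    fun X i => ?_⟩
  · apply f.one_of_mem_closedBall
    simp only [Metric.mem_closedBall, dist_zero_right, norm_smul, norm_inv, Real.norm_eq_abs,
      abs_of_pos hk]
    change _ ≤ (1 : ℝ)
    rw [inv_mul_le_iff₀ hk]
    linarith
  · have h1 : HasFDerivAt (fun X : EuclideanSpace ℝ ι => ((k : ℝ) + 1)⁻¹ • X)
      (((k : ℝ) + 1)⁻¹ • ContinuousLinearMap.id ℝ _) X := 
      (((k : ℝ) + 1)⁻¹ • ContinuousLinearMap.id ℝ (EuclideanSpace ℝ ι)).hasFDerivAt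
    have h2 : HasFDerivAt f (fderiv ℝ f (((k : ℝ) + 1)⁻¹ • X)) (((k : ℝ) + 1)⁻¹ • X) :=
      (hf1.differentiable (by norm_num) _).hasFDerivAt
    have h3 := h2.comp X h1
    have h4 : fderiv ℝ (fun X => f (((k : ℝ) + 1)⁻¹ • X)) X = _ := h3.fderiv
    rw [h4]
    simp only [ContinuousLinearMap.comp_apply, _root_.smul_apply,
      ContinuousLinearMap.id_apply, map_smul, smul_eq_mul, abs_mul, abs_inv, abs_of_pos hk]
    rw [div_eq_inv_mul]
    gcongr
    have h5 := (fderiv ℝ f (((k : ℝ) + 1)⁻¹ • X)).le_opNorm (EuclideanSpace.single i (1:ℝ))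
    rw [Real.norm_eq_abs] at h5
    simp only [PiLp.norm_single, norm_one, mul_one] at h5
    exact h5.trans (hC _)

lemma ibp_coord {g dg χ : EuclideanSpace ℝ ι → ℝ} (M : EuclideanSpace ℝ ι) (i : ι)
    (hg : Continuous g) (hdg : Continuous dg)
    (hd : ∀ X, HasLineDerivAt ℝ g (dg X) X (EuclideanSpace.single i 1))
    (hχ : ContDiff ℝ 1 χ) (hχc : HasCompactSupport χ) :
    ∫ X, χ X * Real.exp (-(1 / 2) * ‖X - M‖ ^ 2) * dg X =
      - ∫ X, ((fderiv ℝ χ X (EuclideanSpace.single i 1)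
        - χ X * (X i - M i)) * Real.exp (-(1 / 2) * ‖X - M‖ ^ 2)) * g X := by
  have hχ' : Continuous fun X => fderiv ℝ χ X (EuclideanSpace.single i 1) :=
    (hχ.continuous_fderiv (by norm_num)).clm_apply continuous_const
  have hcs' : HasCompactSupport fun X => fderiv ℝ χ X (EuclideanSpace.single i 1) :=
    hχc.fderiv_apply ℝ _
  have hχ0 := hχ.continuous
  have hcs2 : HasCompactSupport fun X : EuclideanSpace ℝ ι =>
      (fderiv ℝ χ X (EuclideanSpace.single i 1) - χ X * (X i - M i)) := by
    refine HasCompactSupport.sub hcs' (HasCompactSupport.mul_right hχc)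
  refine integral_bilinear_hasLineDerivAt_right_eq_neg_left_of_integrable
    (B := ContinuousLinearMap.mul ℝ ℝ) (v := EuclideanSpace.single i 1)
    (f := fun X => χ X * Real.exp (-(1 / 2) * ‖X - M‖ ^ 2)) (g := g) (g' := dg)
    (f' := fun X => ((fderiv ℝ χ X (EuclideanSpace.single i 1)
        - χ X * (X i - M i)) * Real.exp (-(1 / 2) * ‖X - M‖ ^ 2))) ?_ ?_ ?_ ?_ ?_
  · refine Continuous.integrable_of_hasCompactSupport ?_ ?_
    · simp only [ContinuousLinearMap.mul_apply']
      fun_prop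
    · exact (hcs2.mul_right).mul_right
  · refine Continuous.integrable_of_hasCompactSupport ?_ ?_
    · simp only [ContinuousLinearMap.mul_apply']
      fun_prop
    · exact (hχc.mul_right).mul_right
  · refine Continuous.integrable_of_hasCompactSupport ?_ ?_
    · simp only [ContinuousLinearMap.mul_apply']
      fun_prop
    · exact (hχc.mul_right).mul_right
  · intro X _
    have h1 := (hχ.differentiable (by norm_num) X).hasFDerivAt
    have h2 := hasFDerivAt_gauss M X 1 (1 / 2)
    have h3 := (h1.mul h2).hasLineDerivAt (EuclideanSpace.single i 1)
    have e : (fun X => χ X * Real.exp (-(1 / 2) * ‖X - M‖ ^ 2)) =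
      χ * (fun X => 1 * Real.exp (-(1 / 2) * ‖X - M‖ ^ 2)) := by ext X; simp
    rw [e]
    unfold HasLineDerivAt at h3 ⊢
    refine h3.congr_deriv ?_
    simp [EuclideanSpace.inner_single_right]
    ring
  · intro X _; exact hd X

lemma ibp_cut {μ : Measure (EuclideanSpace ℝ ι)} (hμ : Adm μ)
    (hpos : ∀ X, 0 < HH μ (fun _ => 1) X)
    (hmono : ∀ X, MonotoneOn (fun t : ℝ => t ^ (Fintype.card ι) *
      ∫ M, Real.exp (-(t ^ 2 / 2) * ‖X - M‖ ^ 2) ∂μ) (Set.Ioi 0))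
    (M : EuclideanSpace ℝ ι) {χ : EuclideanSpace ℝ ι → ℝ}
    (hχ : ContDiff ℝ 1 χ) (hχc : HasCompactSupport χ) (hχ0 : ∀ X, 0 ≤ χ X) :
    ∫ X, χ X * ((∑ i, (gi μ i X * (X i - M i) + gi μ i X ^ 2)) *
        Real.exp (-(1 / 2) * ‖X - M‖ ^ 2)) ≤
      ∫ X, (∑ i, fderiv ℝ χ X (EuclideanSpace.single i 1) * gi μ i X) *
        Real.exp (-(1 / 2) * ‖X - M‖ ^ 2) := by
  have hχ' : ∀ i, Continuous fun X => fderiv ℝ χ X (EuclideanSpace.single i 1) := fun i =>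
    (hχ.continuous_fderiv (by norm_num)).clm_apply continuous_const
  have hcs' : ∀ i, HasCompactSupport fun X => fderiv ℝ χ X (EuclideanSpace.single i 1) := fun i =>
    hχc.fderiv_apply ℝ _
  have hχc0 := hχ.continuous
  have hg := fun i => gi_cont hμ hpos i
  have hdg := fun i => dgi_cont hμ hpos i
  have hibp := fun i => ibp_coord M i (hg i) (hdg i) (gi_deriv hμ hpos i) hχ hχc
  have hi1 : ∀ i ∈ Finset.univ, Integrable fun X : EuclideanSpace ℝ ι =>
      χ X * Real.exp (-(1 / 2) * ‖X - M‖ ^ 2) * dgi μ i X := fun i _ => by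
    refine Continuous.integrable_of_hasCompactSupport ?_ ((hχc.mul_right).mul_right)
    have := hdg i
    fun_prop
  have hi3 : ∀ i ∈ Finset.univ, Integrable fun X : EuclideanSpace ℝ ι =>
      fderiv ℝ χ X (EuclideanSpace.single i 1) * gi μ i X *
        Real.exp (-(1 / 2) * ‖X - M‖ ^ 2) := fun i _ => by
    refine Continuous.integrable_of_hasCompactSupport ?_ (((hcs' i).mul_right).mul_right)
    have := hg i
    have := hχ' i
    fun_prop
  have hi4 : ∀ i ∈ Finset.univ, Integrable fun X : EuclideanSpace ℝ ι =>
      χ X * (gi μ i X * (X i - M i) * Real.exp (-(1 / 2) * ‖X - M‖ ^ 2)) := fun i _ => by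
    refine Continuous.integrable_of_hasCompactSupport ?_ (hχc.mul_right)
    have := hg i
    fun_prop
  have hi5 : Integrable fun X : EuclideanSpace ℝ ι =>
      χ X * ((∑ i, gi μ i X ^ 2) * Real.exp (-(1 / 2) * ‖X - M‖ ^ 2)) := by
    refine Continuous.integrable_of_hasCompactSupport ?_ (hχc.mul_right)
    fun_prop
  have hA : ∫ X, (∑ i, χ X * Real.exp (-(1 / 2) * ‖X - M‖ ^ 2) * dgi μ i X) =
      (∫ X, ∑ i, χ X * (gi μ i X * (X i - M i) * Real.exp (-(1 / 2) * ‖X - M‖ ^ 2))) -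
      ∫ X, ∑ i, fderiv ℝ χ X (EuclideanSpace.single i 1) * gi μ i X *
        Real.exp (-(1 / 2) * ‖X - M‖ ^ 2) := by
    rw [integral_finsetSum _ hi1, integral_finsetSum _ hi3, integral_finsetSum _ hi4,
      ← Finset.sum_sub_distrib]
    refine Finset.sum_congr rfl fun i hi => ?_
    rw [hibp i, ← integral_sub (hi4 i hi) (hi3 i hi), ← integral_neg]
    congr 1; ext X; ring
  have hB : ∫ X, (∑ i, χ X * Real.exp (-(1 / 2) * ‖X - M‖ ^ 2) * dgi μ i X) ≤
      ∫ X, -(χ X * ((∑ i, gi μ i X ^ 2) * Real.exp (-(1 / 2) * ‖X - M‖ ^ 2))) := by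
    refine integral_mono (integrable_finsetSum _ hi1) hi5.neg fun X => ?_
    simp only
    rw [← Finset.mul_sum]
    have h := div_le hμ X (hpos X) (hmono X)
    have h2 : 0 ≤ χ X * Real.exp (-(1 / 2) * ‖X - M‖ ^ 2) :=
      mul_nonneg (hχ0 X) (Real.exp_pos _).le
    have := mul_le_mul_of_nonneg_left h h2
    linarith
  rw [integral_neg] at hB
  have hC : ∫ X, χ X * ((∑ i, (gi μ i X * (X i - M i) + gi μ i X ^ 2)) *
        Real.exp (-(1 / 2) * ‖X - M‖ ^ 2)) = 
      (∫ X, ∑ i, χ X * (gi μ i X * (X i - M i) * Real.exp (-(1 / 2) * ‖X - M‖ ^ 2))) +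
      ∫ X, χ X * ((∑ i, gi μ i X ^ 2) * Real.exp (-(1 / 2) * ‖X - M‖ ^ 2)) := by
    rw [← integral_add (integrable_finsetSum _ hi4) hi5]
    congr 1; ext X
    rw [Finset.sum_add_distrib, ← Finset.mul_sum, ← Finset.sum_mul]
    ring
  rw [hC]
  simp only [Finset.sum_mul]
  simp only [Finset.sum_mul] at hB
  linarith

lemma stein_le {μ : Measure (EuclideanSpace ℝ ι)} (hμ : Adm μ)
    (hpos : ∀ X, 0 < HH μ (fun _ => 1) X)
    (hmono : ∀ X, MonotoneOn (fun t : ℝ => t ^ (Fintype.card ι) *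
      ∫ M, Real.exp (-(t ^ 2 / 2) * ‖X - M‖ ^ 2) ∂μ) (Set.Ioi 0))
    (M : EuclideanSpace ℝ ι)
    (h1 : Integrable fun X => (∑ i, (gi μ i X * (X i - M i) + gi μ i X ^ 2)) *
        Real.exp (-(1 / 2) * ‖X - M‖ ^ 2))
    (h2 : Integrable fun X => (∑ i, |gi μ i X|) * Real.exp (-(1 / 2) * ‖X - M‖ ^ 2)) :
    ∫ X, (∑ i, (gi μ i X * (X i - M i) + gi μ i X ^ 2)) *
        Real.exp (-(1 / 2) * ‖X - M‖ ^ 2) ≤ 0 := by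
  obtain ⟨C, hC, hcut⟩ := exists_cutoff (ι := ι)
  choose χ hχ hχc hχ0 hχ1 hχe hχd using hcut
  have hT : Filter.Tendsto (fun k : ℕ => C / ((k : ℝ) + 1) *
      ∫ X, (∑ i, |gi μ i X|) * Real.exp (-(1 / 2) * ‖X - M‖ ^ 2)) Filter.atTop (nhds 0) := by
    have : Filter.Tendsto (fun k : ℕ => C / ((k : ℝ) + 1)) Filter.atTop (nhds 0) := by
      have := (tendsto_one_div_add_atTop_nhds_zero_nat (𝕜 := ℝ)).const_mul C
      simpa [div_eq_mul_inv] using this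
    simpa using this.mul_const _
  have hL : Filter.Tendsto (fun k : ℕ => ∫ X, χ k X *
      ((∑ i, (gi μ i X * (X i - M i) + gi μ i X ^ 2)) *
        Real.exp (-(1 / 2) * ‖X - M‖ ^ 2))) Filter.atTop (nhds (∫ X,
      (∑ i, (gi μ i X * (X i - M i) + gi μ i X ^ 2)) *
        Real.exp (-(1 / 2) * ‖X - M‖ ^ 2))) := by
    refine tendsto_integral_of_dominated_convergence _ (fun k => ?_) h1.norm (fun k => ?_) ?_
    · exact (hχ k).continuous.aestronglyMeasurable.mul h1.aestronglyMeasurable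
    · refine Filter.Eventually.of_forall fun X => ?_
      rw [norm_mul]
      refine mul_le_of_le_one_left (norm_nonneg _) ?_
      rw [Real.norm_eq_abs, abs_of_nonneg (hχ0 k X)]
      exact hχ1 k X
    · refine Filter.Eventually.of_forall fun X => ?_
      refine tendsto_const_nhds.congr' ?_
      obtain ⟨k0, hk0⟩ := exists_nat_ge ‖X‖
      filter_upwards [Filter.eventually_ge_atTop k0] with k hk
      rw [hχe k X (hk0.trans (by exact_mod_cast hk)), one_mul]
  refine le_of_tendsto_of_tendsto' hL hT fun k => ?_
  refine (ibp_cut hμ hpos hmono M (hχ k) (hχc k) (hχ0 k)).trans ?_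
  rw [← integral_const_mul]
  refine (Real.le_norm_self _).trans (norm_integral_le_of_norm_le (h2.const_mul _)
    (Filter.Eventually.of_forall fun X => ?_))
  rw [Real.norm_eq_abs, abs_mul, Real.abs_exp, ← mul_assoc, Finset.mul_sum]
  gcongr
  refine (Finset.abs_sum_le_sum_abs _ _).trans (Finset.sum_le_sum fun i _ => ?_)
  rw [abs_mul]
  gcongr
  exact hχd k X i

lemma gv_norm_sq (μ : Measure (EuclideanSpace ℝ ι)) (X : EuclideanSpace ℝ ι) :
    ‖gv μ X‖ ^ 2 = ∑ i, gi μ i X ^ 2 := by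
  rw [EuclideanSpace.norm_sq_eq]
  simp [gv]

lemma gv_inner (μ : Measure (EuclideanSpace ℝ ι)) (X M : EuclideanSpace ℝ ι) :
    inner ℝ (X - M) (gv μ X) = ∑ i, gi μ i X * (X i - M i) := by
  simp [gv, PiLp.inner_apply]

lemma gv_cont {μ : Measure (EuclideanSpace ℝ ι)} (hμ : Adm μ)
    (hpos : ∀ X, 0 < HH μ (fun _ => 1) X) : Continuous (gv μ) := by
  unfold gv
  have := fun i => gi_cont hμ hpos i
  fun_prop

lemma gauss_second_moment (M : EuclideanSpace ℝ ι) :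
    Integrable (fun X => ‖X - M‖ ^ 2 * Real.exp (-(1 / 2) * ‖X - M‖ ^ 2)) := by
  have h : Integrable (fun X : EuclideanSpace ℝ ι => ‖X‖ ^ 2 * Real.exp (-(1 / 2) * ‖X‖ ^ 2)) := by
    have := int_gauss adm_volume gro_sq (0 : EuclideanSpace ℝ ι) (a := 1 / 2) (by norm_num)
    simpa [sq] using this
  exact h.comp_sub_right M

lemma gauss_integral (M : EuclideanSpace ℝ ι) :
    Integrable (fun X => Real.exp (-(1 / 2) * ‖X - M‖ ^ 2)) :=
  (adm_volume (1 / 2) (by norm_num)).comp_sub_right M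

theorem risk_lt {μ : Measure (EuclideanSpace ℝ ι)} (hμ : Adm μ)
    (hpos : ∀ X, 0 < HH μ (fun _ => 1) X)
    (hmono : ∀ X, MonotoneOn (fun t : ℝ => t ^ (Fintype.card ι) *
      ∫ M, Real.exp (-(t ^ 2 / 2) * ‖X - M‖ ^ 2) ∂μ) (Set.Ioi 0))
    (hnc : ∃ X, gv μ X ≠ 0) (M : EuclideanSpace ℝ ι)
    (hN : 0 < ∫ X, ‖X - M‖ ^ 2 * Real.exp (-(1 / 2) * ‖X - M‖ ^ 2)) :
    ∫ X, ‖X + gv μ X - M‖ ^ 2 * Real.exp (-(1 / 2) * ‖X - M‖ ^ 2) <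
      ∫ X, ‖X - M‖ ^ 2 * Real.exp (-(1 / 2) * ‖X - M‖ ^ 2) := by
  by_cases hint : Integrable fun X =>
      ‖X + gv μ X - M‖ ^ 2 * Real.exp (-(1 / 2) * ‖X - M‖ ^ 2)
  swap
  · rwa [integral_undef hint]
  have hgc := gv_cont hμ hpos
  have h2m := gauss_second_moment M
  have hg2 : Integrable fun X => ‖gv μ X‖ ^ 2 * Real.exp (-(1 / 2) * ‖X - M‖ ^ 2) := by
    refine ((hint.const_mul 2).add (h2m.const_mul 2)).mono'
      (Continuous.aestronglyMeasurable (by fun_prop)) (Filter.Eventually.of_forall fun X => ?_)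
    rw [Real.norm_eq_abs, abs_of_nonneg (by positivity)]
    have e : gv μ X = (X + gv μ X - M) - (X - M) := by abel
    have h : ‖gv μ X‖ ≤ ‖X + gv μ X - M‖ + ‖X - M‖ := by
      calc _ = ‖(X + gv μ X - M) - (X - M)‖ := by rw [← e]
        _ ≤ _ := norm_sub_le _ _
    have h' : ‖gv μ X‖ ^ 2 ≤ 2 * ‖X + gv μ X - M‖ ^ 2 + 2 * ‖X - M‖ ^ 2 := by
      nlinarith [norm_nonneg (gv μ X), sq_nonneg (‖X + gv μ X - M‖ - ‖X - M‖)]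
    have := mul_le_mul_of_nonneg_right h' (Real.exp_pos (-(1 / 2) * ‖X - M‖ ^ 2)).le
    simp only [Pi.add_apply]
    linarith
  have hgi : Integrable fun X => inner ℝ (X - M) (gv μ X) *
      Real.exp (-(1 / 2) * ‖X - M‖ ^ 2) := by
    refine (hg2.add h2m).mono'
      (Continuous.aestronglyMeasurable (by fun_prop)) (Filter.Eventually.of_forall fun X => ?_)
    rw [Real.norm_eq_abs, abs_mul, Real.abs_exp]
    have h := abs_real_inner_le_norm (X - M) (gv μ X)
    have h' : |inner ℝ (X - M) (gv μ X)| ≤ ‖gv μ X‖ ^ 2 + ‖X - M‖ ^ 2 := by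
      nlinarith [norm_nonneg (gv μ X), norm_nonneg (X - M), sq_nonneg (‖gv μ X‖ - ‖X - M‖)]
    have := mul_le_mul_of_nonneg_right h' (Real.exp_pos (-(1 / 2) * ‖X - M‖ ^ 2)).le
    simp only [Pi.add_apply]
    linarith
  have habs : Integrable fun X => (∑ i, |gi μ i X|) * Real.exp (-(1 / 2) * ‖X - M‖ ^ 2) := by
    have hgic := fun i => gi_cont hμ hpos i
    refine (hg2.add ((gauss_integral M).const_mul (Fintype.card ι))).mono'
      (Continuous.aestronglyMeasurable (by fun_prop)) (Filter.Eventually.of_forall fun X => ?_)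
    rw [Real.norm_eq_abs, abs_of_nonneg (by positivity)]
    have h' : ∑ i, |gi μ i X| ≤ ‖gv μ X‖ ^ 2 + Fintype.card ι := by
      have e : ‖gv μ X‖ ^ 2 + Fintype.card ι = ∑ i, (gi μ i X ^ 2 + 1) := by
        rw [Finset.sum_add_distrib, gv_norm_sq]; simp
      rw [e]
      refine Finset.sum_le_sum fun i _ => ?_
      rw [← sq_abs]
      nlinarith [sq_nonneg (|gi μ i X| - 1), abs_nonneg (gi μ i X)]
    have := mul_le_mul_of_nonneg_right h' (Real.exp_pos (-(1 / 2) * ‖X - M‖ ^ 2)).le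
    simp only [Pi.add_apply]
    linarith
  have ew : ∀ X, (∑ i, (gi μ i X * (X i - M i) + gi μ i X ^ 2)) *
        Real.exp (-(1 / 2) * ‖X - M‖ ^ 2) = inner ℝ (X - M) (gv μ X) *
      Real.exp (-(1 / 2) * ‖X - M‖ ^ 2) +
      ‖gv μ X‖ ^ 2 * Real.exp (-(1 / 2) * ‖X - M‖ ^ 2) := by
    intro X
    rw [Finset.sum_add_distrib, gv_norm_sq, gv_inner]; ring
  have hst := stein_le hμ hpos hmono M (by simp only [ew]; exact hgi.add hg2) habs
  simp only [ew] at hst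
  rw [integral_add hgi hg2] at hst
  have hgpos : 0 < ∫ X, ‖gv μ X‖ ^ 2 * Real.exp (-(1 / 2) * ‖X - M‖ ^ 2) := by
    obtain ⟨X0, hX0⟩ := hnc
    refine integral_pos_of_integrable_nonneg_nonzero (x := X0) (by fun_prop) hg2
      (fun X => by positivity) ?_
    have : 0 < ‖gv μ X0‖ := norm_pos_iff.2 hX0
    positivity
  have ex : ∫ X, ‖X + gv μ X - M‖ ^ 2 * Real.exp (-(1 / 2) * ‖X - M‖ ^ 2) =
      (∫ X, ‖X - M‖ ^ 2 * Real.exp (-(1 / 2) * ‖X - M‖ ^ 2)) +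
      (2 * (∫ X, inner ℝ (X - M) (gv μ X) * Real.exp (-(1 / 2) * ‖X - M‖ ^ 2)) +
      ∫ X, ‖gv μ X‖ ^ 2 * Real.exp (-(1 / 2) * ‖X - M‖ ^ 2)) := by
    have hs : Integrable fun X => 2 * (inner ℝ (X - M) (gv μ X) *
      Real.exp (-(1 / 2) * ‖X - M‖ ^ 2)) + ‖gv μ X‖ ^ 2 * Real.exp (-(1 / 2) * ‖X - M‖ ^ 2) :=
      (hgi.const_mul 2).add hg2
    rw [← integral_const_mul, ← integral_add (hgi.const_mul 2) hg2, ← integral_add h2m hs]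
    congr 1; ext X
    have : X + gv μ X - M = (X - M) + gv μ X := by abel
    rw [this, norm_add_sq_real]
    ring
  rw [ex]
  linarith

/-- zero score everywhere would force a constant marginal -/
lemma const_of_gv_zero {μ : Measure (EuclideanSpace ℝ ι)} (hμ : Adm μ)
    (hpos : ∀ X, 0 < HH μ (fun _ => 1) X) (h0 : ∀ X, gv μ X = 0) (X Y : EuclideanSpace ℝ ι) :
    HH μ (fun _ => 1) X = HH μ (fun _ => 1) Y := by
  have hd : ∀ X, HasFDerivAt (HH μ (fun _ => 1)) (0 : EuclideanSpace ℝ ι →L[ℝ] ℝ) X := by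
    intro X
    obtain ⟨L0, h, e0⟩ := HH_hasFDerivAt hμ gro_one X
    have : L0 = 0 := by
      apply ContinuousLinearMap.coe_injective
      refine (EuclideanSpace.basisFun ι ℝ).toBasis.ext fun i => ?_
      have h1 : gi μ i X = 0 := by
        have := congrArg (fun v : EuclideanSpace ℝ ι => v i) (h0 X)
        simpa [gv] using this
      unfold gi at h1
      have := (hpos X).ne'
      simp [e0]
      simp only [one_mul] at h1
      field_simp at h1
      linarith
    rwa [this] at h
  exact is_const_of_fderiv_eq_zero (fun X => (hd X).differentiableAt)
    (fun X => (hd X).fderiv) X Y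

lemma gauss_second_moment_eq (M : EuclideanSpace ℝ ι) :
    ∫ X, ‖X - M‖ ^ 2 * Real.exp (-(1 / 2) * ‖X - M‖ ^ 2) =
      Fintype.card ι * (2 * Real.pi) ^ ((Fintype.card ι : ℝ) / 2) := by
  have hc : ∀ i : ι, ∫ X : EuclideanSpace ℝ ι, X i * X i * Real.exp (-(1 / 2) * ‖X‖ ^ 2) =
      (2 * Real.pi) ^ ((Fintype.card ι : ℝ) / 2) := by
    intro i
    have hh : (0 : ℝ) < 1 / 2 := by norm_num
    have hI := GaussianFourier.integral_rexp_neg_mul_sq_norm (V := EuclideanSpace ℝ ι) hh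
    have h0 := int_gauss adm_volume gro_one (0 : EuclideanSpace ℝ ι) hh
    have h1 := int_gauss adm_volume (gro_coord i) (0 : EuclideanSpace ℝ ι) hh
    have h2 := int_gauss adm_volume (gro_coord2 i) (0 : EuclideanSpace ℝ ι) hh
    simp only [zero_sub, norm_neg, one_mul] at h0 h1 h2
    have := integral_bilinear_hasLineDerivAt_right_eq_neg_left_of_integrable
      (μ := (volume : Measure (EuclideanSpace ℝ ι)))
      (B := ContinuousLinearMap.mul ℝ ℝ) (v := EuclideanSpace.single i 1)
      (f := fun X : EuclideanSpace ℝ ι => X i) (f' := fun _ => 1)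
      (g := fun X => Real.exp (-(1 / 2) * ‖X‖ ^ 2))
      (g' := fun X => - (X i * Real.exp (-(1 / 2) * ‖X‖ ^ 2)))
      (by simpa using h0)
      (by simp only [ContinuousLinearMap.mul_apply', mul_neg, ← mul_assoc]; exact h2.neg)
      (by simpa using h1)
      (fun X _ => by
        have hc : HasFDerivAt (fun X : EuclideanSpace ℝ ι => X i)
          (EuclideanSpace.proj i : EuclideanSpace ℝ ι →L[ℝ] ℝ) X :=
          (EuclideanSpace.proj i : EuclideanSpace ℝ ι →L[ℝ] ℝ).hasFDerivAt
        simpa using hc.hasLineDerivAt (EuclideanSpace.single i 1))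
      (fun X _ => by
        have h3 := (hasFDerivAt_gauss 0 X 1 (1 / 2)).hasLineDerivAt (EuclideanSpace.single i 1)
        simpa [EuclideanSpace.inner_single_right, mul_comm] using h3)
    simp only [ContinuousLinearMap.mul_apply', mul_neg, ← mul_assoc, integral_neg, one_mul,
      neg_inj] at this
    rw [this, hI]
    simp
    congr 1
    ring
  rw [integral_sub_right_eq_self (fun X : EuclideanSpace ℝ ι =>
    ‖X‖ ^ 2 * Real.exp (-(1 / 2) * ‖X‖ ^ 2)) M]
  calc _ = ∫ X : EuclideanSpace ℝ ι, ∑ i, X i * X i * Real.exp (-(1 / 2) * ‖X‖ ^ 2) := by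
        congr 1; ext X
        nth_rw 1 [EuclideanSpace.norm_sq_eq]
        rw [Finset.sum_mul]
        refine Finset.sum_congr rfl fun i _ => ?_
        rw [Real.norm_eq_abs, sq_abs, sq]
    _ = _ := by
        rw [integral_finsetSum]
        · simp only [hc, Finset.sum_const, Finset.card_univ, nsmul_eq_mul]
        · intro i _
          have h2 := int_gauss adm_volume (gro_coord2 i) (0 : EuclideanSpace ℝ ι)
            (by norm_num : (0 : ℝ) < 1 / 2)
          simpa using h2

end PartThree

section PartFour
variable {ι : Type*} [Fintype ι]

lemma heat_antitone {f : EuclideanSpace ℝ ι → ℝ} {d dd : ι → EuclideanSpace ℝ ι → ℝ} {C : ℝ}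
    (hf : Differentiable ℝ f)
    (hfd : ∀ x i, fderiv ℝ f x (EuclideanSpace.single i 1) = d i x)
    (hdc : ∀ i, Continuous (d i)) (hddc : ∀ i, Continuous (dd i))
    (hdd : ∀ i x, HasLineDerivAt ℝ (d i) (dd i x) x (EuclideanSpace.single i 1))
    (hfb : ∀ x, |f x| ≤ C) (hdb : ∀ i x, |d i x| ≤ C) (hddb : ∀ i x, |dd i x| ≤ C)
    (hsuper : ∀ x, ∑ i, dd i x ≤ 0) (X : EuclideanSpace ℝ ι) :
    AntitoneOn (fun s : ℝ => ∫ Z, f (X + s • Z) * Real.exp (-(1 / 2) * ‖Z‖ ^ 2)) (Set.Ici 0) := by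
  have hh : (0 : ℝ) < 1 / 2 := by norm_num
  have hfc := hf.continuous
  have hC : 0 ≤ C := (abs_nonneg _).trans (hfb 0)
  have hlin : ∀ x Z, fderiv ℝ f x Z = ∑ i, Z i * d i x := by
    intro x Z
    conv_lhs => rw [← (EuclideanSpace.basisFun ι ℝ).sum_repr Z]
    simp [hfd]
  have hder : ∀ s : ℝ, HasDerivAt
      (fun s : ℝ => ∫ Z, f (X + s • Z) * Real.exp (-(1 / 2) * ‖Z‖ ^ 2))
      (∫ Z, (∑ i, Z i * d i (X + s • Z)) * Real.exp (-(1 / 2) * ‖Z‖ ^ 2)) s := by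
    intro s
    refine (hasDerivAt_integral_of_dominated_loc_of_deriv_le (s := Set.univ)
      (F := fun (s : ℝ) Z => f (X + s • Z) * Real.exp (-(1 / 2) * ‖Z‖ ^ 2))
      (F' := fun (s : ℝ) Z => (∑ i, Z i * d i (X + s • Z)) * Real.exp (-(1 / 2) * ‖Z‖ ^ 2))
      (bound := fun Z => (Fintype.card ι * C) * (‖Z‖ * Real.exp (-(1 / 2) * ‖Z‖ ^ 2)))
      Filter.univ_mem (Filter.Eventually.of_forall fun t => ?_) ?_ ?_
      (Filter.Eventually.of_forall fun Z t _ => ?_) ?_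
      (Filter.Eventually.of_forall fun Z t _ => ?_)).2
    · apply Continuous.aestronglyMeasurable; fun_prop
    · have := int_gauss adm_volume (gro_of_bdd (p := fun Z => f (X + s • Z)) (by fun_prop) C
        (fun Z => hfb _)) 0 hh
      simpa using this
    · apply Continuous.aestronglyMeasurable; fun_prop
    · rw [norm_mul, Real.norm_eq_abs, Real.norm_eq_abs, Real.abs_exp, ← mul_assoc]
      gcongr
      refine (Finset.abs_sum_le_sum_abs _ _).trans ?_
      calc ∑ i, |Z i * d i (X + t • Z)| ≤ ∑ i : ι, ‖Z‖ * C := by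
            refine Finset.sum_le_sum fun i _ => ?_
            rw [abs_mul]
            exact mul_le_mul (coord_le Z i) (hdb i _) (abs_nonneg _) (norm_nonneg _)
        _ = _ := by simp; ring
    · have := int_gauss adm_volume (gro_mul_norm (gro_one (ι := ι))) 0 hh
      simpa using this.const_mul (Fintype.card ι * C)
    · have h1 : HasDerivAt (fun t : ℝ => X + t • Z) Z t := by
        simpa using ((hasDerivAt_id t).smul_const Z).const_add X
      have h2 := ((hf (X + t • Z)).hasFDerivAt.comp_hasDerivAt t h1).mul_const
        (Real.exp (-(1 / 2) * ‖Z‖ ^ 2))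
      rw [hlin] at h2
      exact h2
  have hibp : ∀ (s : ℝ) i, ∫ Z : EuclideanSpace ℝ ι, Z i * d i (X + s • Z) *
      Real.exp (-(1 / 2) * ‖Z‖ ^ 2) =
      s * ∫ Z, dd i (X + s • Z) * Real.exp (-(1 / 2) * ‖Z‖ ^ 2) := by
    intro s i
    have hdc := hdc i
    have hddc := hddc i
    have h0 := int_gauss adm_volume (gro_of_bdd (p := fun Z => d i (X + s • Z)) (by fun_prop) C
        (fun Z => hdb i _)) 0 hh
    have h1 := int_gauss adm_volume (gro_mul_coord (gro_of_bdd (p := fun Z => d i (X + s • Z))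
      (by fun_prop) C (fun Z => hdb i _)) i) 0 hh
    have h2 := int_gauss adm_volume (gro_of_bdd (p := fun Z => dd i (X + s • Z)) (by fun_prop) C
        (fun Z => hddb i _)) 0 hh
    simp only [zero_sub, norm_neg] at h0 h1 h2
    have := integral_bilinear_hasLineDerivAt_right_eq_neg_left_of_integrable
      (μ := (volume : Measure (EuclideanSpace ℝ ι)))
      (B := ContinuousLinearMap.mul ℝ ℝ) (v := EuclideanSpace.single i 1)
      (f := fun Z : EuclideanSpace ℝ ι => d i (X + s • Z)) (f' := fun Z => s * dd i (X + s • Z))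
      (g := fun X => Real.exp (-(1 / 2) * ‖X‖ ^ 2))
      (g' := fun X => - (X i * Real.exp (-(1 / 2) * ‖X‖ ^ 2)))
      (by simpa [mul_assoc] using h2.const_mul s)
      (by simp only [ContinuousLinearMap.mul_apply', mul_neg, ← mul_assoc]; exact h1.neg)
      (by simpa using h0)
      (fun Z _ => by
        have h3 := hdd i (X + s • Z)
        unfold HasLineDerivAt at h3 ⊢
        have h4 : HasDerivAt (fun t : ℝ => s * t) s 0 := by
          simpa using (hasDerivAt_id (0 : ℝ)).const_mul s
        have h5 := HasDerivAt.comp (0 : ℝ) (h₂ := fun t : ℝ => d i (X + s • Z + t •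
          EuclideanSpace.single i 1)) (by simpa using h3) h4
        rw [mul_comm] at h5
        have e : (fun t : ℝ => d i (X + s • (Z + t • EuclideanSpace.single i 1))) =
            (fun t : ℝ => d i (X + s • Z + t • EuclideanSpace.single i 1)) ∘ fun t => s * t := by
          funext t
          change d i (X + s • (Z + t • EuclideanSpace.single i 1)) =
            d i (X + s • Z + (s * t) • EuclideanSpace.single i 1)
          rw [smul_add, smul_smul, add_assoc]
        rw [← e] at h5
        exact h5)
      (fun X _ => by
        have h3 := (hasFDerivAt_gauss 0 X 1 (1 / 2)).hasLineDerivAt (EuclideanSpace.single i 1)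
        simpa [EuclideanSpace.inner_single_right, mul_comm] using h3)
    simp only [ContinuousLinearMap.mul_apply', mul_neg, integral_neg, neg_inj] at this
    rw [← integral_const_mul]
    convert this using 1
    · congr 1; ext Z; ring
    · congr 1; ext Z; ring
  refine antitoneOn_of_deriv_nonpos (convex_Ici 0)
    (fun s _ => (hder s).continuousAt.continuousWithinAt)
    (fun s _ => (hder s).differentiableAt.differentiableWithinAt) fun s hs => ?_
  rw [interior_Ici] at hs
  have hs' : 0 < s := hs
  rw [(hder s).deriv]
  have hi1 : ∀ i ∈ Finset.univ, Integrable fun Z : EuclideanSpace ℝ ι => Z i * d i (X + s • Z) *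
      Real.exp (-(1 / 2) * ‖Z‖ ^ 2) := fun i _ => by
    have hdc := hdc i
    have h1 := int_gauss adm_volume (gro_mul_coord (gro_of_bdd (p := fun Z => d i (X + s • Z))
      (by fun_prop) C (fun Z => hdb i _)) i) 0 hh
    simp only [zero_sub, norm_neg] at h1
    refine h1.congr (Filter.Eventually.of_forall fun Z => ?_)
    simp only; ring
  have hi2 : ∀ i ∈ Finset.univ, Integrable fun Z : EuclideanSpace ℝ ι => dd i (X + s • Z) *
      Real.exp (-(1 / 2) * ‖Z‖ ^ 2) := fun i _ => by
    have hddc := hddc i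
    have h2 := int_gauss adm_volume (gro_of_bdd (p := fun Z => dd i (X + s • Z)) (by fun_prop) C
        (fun Z => hddb i _)) 0 hh
    simpa only [zero_sub, norm_neg] using h2
  simp only [Finset.sum_mul]
  rw [integral_finsetSum _ hi1]
  simp only [hibp]
  rw [← Finset.mul_sum, ← integral_finsetSum _ hi2]
  refine mul_nonpos_of_nonneg_of_nonpos hs'.le (integral_nonpos fun Z => ?_)
  simp only [← Finset.sum_mul, Pi.zero_apply]
  exact mul_nonpos_of_nonpos_of_nonneg (hsuper _) (Real.exp_pos _).le

lemma heat_change (f : EuclideanSpace ℝ ι → ℝ) (X : EuclideanSpace ℝ ι) {t : ℝ} (ht : 0 < t) :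
    t ^ (Fintype.card ι) * ∫ M, f M * Real.exp (-(t ^ 2 / 2) * ‖X - M‖ ^ 2) =
      ∫ Z, f (X + t⁻¹ • Z) * Real.exp (-(1 / 2) * ‖Z‖ ^ 2) := by
  have h1 := Measure.integral_comp_smul (volume : Measure (EuclideanSpace ℝ ι))
    (fun Z => f (X + Z) * Real.exp (-(t ^ 2 / 2) * ‖Z‖ ^ 2)) t⁻¹
  rw [finrank_euclideanSpace, inv_pow, inv_inv, abs_of_pos (by positivity), smul_eq_mul] at h1
  have h2 := integral_add_left_eq_self (μ := (volume : Measure (EuclideanSpace ℝ ι)))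
    (fun M => f M * Real.exp (-(t ^ 2 / 2) * ‖X - M‖ ^ 2)) X
  rw [← h2]
  simp only [sub_add_cancel_left, norm_neg]
  rw [← h1]
  congr 1; ext Z
  rw [norm_smul, Real.norm_eq_abs, abs_of_pos (by positivity)]
  congr 2
  field_simp

end PartFour

section PartFive

lemma jacobi_deriv {m : ℕ} {Γ : ℝ → Matrix (Fin m) (Fin m) ℝ} {Γ' : Matrix (Fin m) (Fin m) ℝ}
    {t₀ : ℝ} (h : ∀ a b, HasDerivAt (fun t => Γ t a b) (Γ' a b) t₀) :
    HasDerivAt (fun t => (Γ t).det) ((Γ t₀).adjugate * Γ').trace t₀ := by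
  have e : ((Γ t₀).adjugate * Γ').trace = ∑ i, ((Γ t₀).updateCol i (fun k => Γ' k i)).det := by
    unfold Matrix.trace
    refine Finset.sum_congr rfl fun i _ => ?_
    rw [← Matrix.cramer_apply, Matrix.cramer_eq_adjugate_mulVec]
    simp [Matrix.mul_apply, Matrix.mulVec, dotProduct]
  rw [e]
  simp only [Matrix.det_apply']
  rw [Finset.sum_comm]
  refine HasDerivAt.fun_sum fun σ _ => ?_
  rw [← Finset.mul_sum]
  refine HasDerivAt.const_mul _ ?_
  have := HasDerivAt.fun_finsetProd (u := Finset.univ) (x := t₀)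
    (f := fun i t => Γ t (σ i) i) (f' := fun i => Γ' (σ i) i) (fun i _ => h (σ i) i)
  refine this.congr_deriv ?_
  refine Finset.sum_congr rfl fun i _ => ?_
  rw [← Finset.mul_prod_erase Finset.univ _ (Finset.mem_univ i), smul_eq_mul, mul_comm]
  congr 1
  · simp
  · refine Finset.prod_congr rfl fun j hj => ?_
    rw [Matrix.updateCol_ne (Finset.ne_of_mem_erase hj)]

section
open scoped Matrix.Norms.Operator

lemma inv_deriv {m : ℕ} {Γ : ℝ → Matrix (Fin m) (Fin m) ℝ} {Γ' : Matrix (Fin m) (Fin m) ℝ}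
    {t₀ : ℝ} (h : ∀ a b, HasDerivAt (fun t => Γ t a b) (Γ' a b) t₀) (hu : IsUnit (Γ t₀)) (a b) :
    HasDerivAt (fun t => (Γ t)⁻¹ a b) (-((Γ t₀)⁻¹ * Γ' * (Γ t₀)⁻¹) a b) t₀ := by
  have h1 : HasDerivAt Γ Γ' t₀ := by
    refine hasDerivAt_pi.2 fun a => hasDerivAt_pi.2 fun b => h a b
  obtain ⟨u, hu⟩ := hu
  have h2 := hasFDerivAt_ringInverse (𝕜 := ℝ) u
  rw [hu] at h2
  have h3 := h2.comp_hasDerivAt t₀ h1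
  have h4 : HasDerivAt (fun t => (Γ t)⁻¹) (-((Γ t₀)⁻¹ * Γ' * (Γ t₀)⁻¹)) t₀ := by
    have e : (fun t => (Γ t)⁻¹) = Ring.inverse ∘ Γ := by
      funext t; exact Matrix.nonsing_inv_eq_ringInverse _
    rw [e]
    refine h3.congr_deriv ?_
    rw [Matrix.nonsing_inv_eq_ringInverse, ← hu, Ring.inverse_unit]
    simp [ContinuousLinearMap.mulLeftRight_apply]
  exact hasDerivAt_pi.1 (hasDerivAt_pi.1 h4 a) b

end

variable {n m : ℕ}

/-- regularized Gram matrix -/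
noncomputable def BB (ε : ℝ) (x : EuclideanSpace ℝ (Fin n × Fin m)) : Matrix (Fin m) (Fin m) ℝ :=
  (toMat x)ᵀ * toMat x + ε • (1 : Matrix (Fin m) (Fin m) ℝ)

noncomputable def AA (ε : ℝ) (x : EuclideanSpace ℝ (Fin n × Fin m)) : Matrix (Fin m) (Fin m) ℝ :=
  (BB ε x)⁻¹

noncomputable def WW (ε : ℝ) (x : EuclideanSpace ℝ (Fin n × Fin m)) : Matrix (Fin n) (Fin m) ℝ :=
  toMat x * AA ε x

/-- regularized prior -/
noncomputable def fe (ε : ℝ) (x : EuclideanSpace ℝ (Fin n × Fin m)) : ℝ :=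
  (BB ε x).det ^ (-((n : ℝ) - m - 1) / 2)

noncomputable def PP (ε : ℝ) (x : EuclideanSpace ℝ (Fin n × Fin m)) (i : Fin n) : ℝ :=
  ∑ b, toMat x i b * WW ε x i b

lemma gram_psd (x : EuclideanSpace ℝ (Fin n × Fin m)) : ((toMat x)ᵀ * toMat x).PosSemidef := by
  have := Matrix.posSemidef_conjTranspose_mul_self (toMat x)
  rwa [Matrix.conjTranspose_eq_transpose_of_trivial] at this

lemma BB_posDef {ε : ℝ} (hε : 0 < ε) (x : EuclideanSpace ℝ (Fin n × Fin m)) :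
    (BB ε x).PosDef :=
  Matrix.PosDef.posSemidef_add (gram_psd x) (Matrix.PosDef.one.smul hε)

lemma AA_symm {ε : ℝ} (hε : 0 < ε) (x : EuclideanSpace ℝ (Fin n × Fin m)) (a b : Fin m) :
    AA ε x a b = AA ε x b a := by
  have h := (BB_posDef hε x).inv.isHermitian
  have := h.apply b a
  simpa [AA] using this

lemma AA_mul_BB {ε : ℝ} (hε : 0 < ε) (x : EuclideanSpace ℝ (Fin n × Fin m)) :
    AA ε x * BB ε x = 1 :=
  Matrix.nonsing_inv_mul _ (BB_posDef hε x).det_pos.ne'.isUnit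

/-- `A_ab = ∑_i W_ia W_ib + ε ∑_c A_ac A_cb`. -/
lemma AA_expand {ε : ℝ} (hε : 0 < ε) (x : EuclideanSpace ℝ (Fin n × Fin m)) (a b : Fin m) :
    AA ε x a b = ∑ i, WW ε x i a * WW ε x i b + ε * ∑ c, AA ε x a c * AA ε x c b := by
  have hT : (AA ε x)ᵀ = AA ε x := by ext a b; exact (AA_symm hε x a b).symm
  have h : AA ε x = (WW ε x)ᵀ * WW ε x + ε • (AA ε x * AA ε x) := by
    calc AA ε x = AA ε x * BB ε x * AA ε x := by rw [AA_mul_BB hε, one_mul]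
      _ = _ := by
        unfold BB WW
        rw [Matrix.transpose_mul, hT]
        simp only [mul_add, add_mul, Matrix.mul_assoc]
        simp
  have h2 := congrFun (congrFun h a) b
  simpa [Matrix.mul_apply] using h2

/-- `tr(S A) = m - ε tr A` -/
lemma PP_sum {ε : ℝ} (hε : 0 < ε) (x : EuclideanSpace ℝ (Fin n × Fin m)) :
    ∑ i, PP ε x i = m - ε * ∑ a, AA ε x a a := by
  have e : ((AA ε x * (toMat x)ᵀ) * toMat x).trace = ∑ i, PP ε x i := by
    rw [Matrix.trace_mul_comm, ← Matrix.mul_assoc]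
    change ((WW ε x) * (toMat x)ᵀ).trace = _
    simp only [Matrix.trace, Matrix.diag, Matrix.mul_apply, PP, Matrix.transpose_apply]
    refine Finset.sum_congr rfl fun i _ => Finset.sum_congr rfl fun b _ => mul_comm _ _
  have h := congrArg Matrix.trace (AA_mul_BB hε x)
  unfold BB at h
  rw [mul_add, Matrix.trace_add, ← Matrix.mul_assoc, e] at h
  simp only [Matrix.mul_smul, mul_one, Matrix.trace_smul, Matrix.trace_one, Fintype.card_fin,
    smul_eq_mul] at h
  have e2 : (AA ε x).trace = ∑ a, AA ε x a a := rfl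
  rw [e2] at h
  linarith

lemma PP_nonneg {ε : ℝ} (hε : 0 < ε) (x : EuclideanSpace ℝ (Fin n × Fin m)) (i : Fin n) :
    0 ≤ PP ε x i := by
  have h := (BB_posDef hε x).inv.posSemidef.mul_mul_conjTranspose_same (toMat x)
  have h2 := h.diag_nonneg (i := i)
  rw [Matrix.conjTranspose_eq_transpose_of_trivial] at h2
  change 0 ≤ (WW ε x * (toMat x)ᵀ) i i at h2
  simpa [Matrix.mul_apply, PP, mul_comm] using h2

lemma AA_diag_nonneg {ε : ℝ} (hε : 0 < ε) (x : EuclideanSpace ℝ (Fin n × Fin m)) (a : Fin m) :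
    0 ≤ AA ε x a a := (BB_posDef hε x).inv.posSemidef.diag_nonneg

lemma AA_bound {ε : ℝ} (hε : 0 < ε) (x : EuclideanSpace ℝ (Fin n × Fin m)) (a b : Fin m) :
    |AA ε x a b| ≤ 1 / ε := by
  have key : ∀ b, ε * AA ε x a b ^ 2 ≤ AA ε x a a := by
    intro b
    rw [AA_expand hε x a a]
    have h1 : AA ε x a b ^ 2 ≤ ∑ c, AA ε x a c * AA ε x c a := by
      have := Finset.single_le_sum (f := fun c => AA ε x a c * AA ε x c a)
        (fun c _ => by rw [AA_symm hε x c a]; exact mul_self_nonneg _) (Finset.mem_univ b)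
      rw [AA_symm hε x b a] at this
      rw [sq]; exact this
    have h2 : 0 ≤ ∑ i, WW ε x i a * WW ε x i a :=
      Finset.sum_nonneg fun i _ => mul_self_nonneg _
    nlinarith
  have h1 : AA ε x a a ≤ 1 / ε := by
    have := key a
    rw [le_div_iff₀ hε]
    by_contra hcon
    push Not at hcon
    have h0 : 0 < AA ε x a a := by
      by_contra h; push Not at h; nlinarith
    nlinarith
  have h2 := (key b).trans h1
  refine abs_le_of_sq_le_sq ?_ (by positivity)
  rw [le_div_iff₀ hε] at h2
  rw [one_div, inv_pow, ← one_div, le_div_iff₀ (by positivity)]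
  nlinarith

lemma WW_sq_sum {ε : ℝ} (hε : 0 < ε) (x : EuclideanSpace ℝ (Fin n × Fin m)) :
    ∑ i, ∑ a, WW ε x i a ^ 2 = ∑ a, AA ε x a a - ε * ∑ a, ∑ c, AA ε x a c ^ 2 := by
  rw [Finset.sum_comm, Finset.mul_sum, ← Finset.sum_sub_distrib]
  refine Finset.sum_congr rfl fun a _ => ?_
  have h := AA_expand hε x a a
  have e : ∑ c, AA ε x a c * AA ε x c a = ∑ c, AA ε x a c ^ 2 :=
    Finset.sum_congr rfl fun c _ => by rw [AA_symm hε x c a]; ring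
  rw [e] at h
  simp only [sq] at h ⊢
  linarith

end PartFive

section PartFiveB
variable {n m : ℕ}

lemma toMat_line (x : EuclideanSpace ℝ (Fin n × Fin m)) (i : Fin n) (a : Fin m) (t : ℝ)
    (j : Fin n) (b : Fin m) :
    toMat (x + t • EuclideanSpace.single (i, a) (1 : ℝ)) j b =
      toMat x j b + t * (if j = i ∧ b = a then 1 else 0) := by
  simp [toMat, Prod.ext_iff, Pi.single_apply]

lemma toMat_deriv (x : EuclideanSpace ℝ (Fin n × Fin m)) (i : Fin n) (a : Fin m)
    (j : Fin n) (b : Fin m) :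
    HasDerivAt (fun t : ℝ => toMat (x + t • EuclideanSpace.single (i, a) (1 : ℝ)) j b)
      (if j = i ∧ b = a then 1 else 0) 0 := by
  simp only [toMat_line]
  simpa using ((hasDerivAt_id (0:ℝ)).mul_const (if j = i ∧ b = a then (1:ℝ) else 0)).const_add
    (toMat x j b)

/-- derivative of the Gram matrix -/
noncomputable def GP (x : EuclideanSpace ℝ (Fin n × Fin m)) (i : Fin n) (a : Fin m) :
    Matrix (Fin m) (Fin m) ℝ :=
  fun b c => (if b = a then toMat x i c else 0) + (if c = a then toMat x i b else 0)

lemma BB_deriv (ε : ℝ) (x : EuclideanSpace ℝ (Fin n × Fin m)) (i : Fin n) (a : Fin m)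
    (b c : Fin m) :
    HasDerivAt (fun t : ℝ => BB ε (x + t • EuclideanSpace.single (i, a) (1 : ℝ)) b c)
      (GP x i a b c) 0 := by
  simp only [BB, Matrix.add_apply, Matrix.mul_apply, Matrix.transpose_apply]
  have h : HasDerivAt (fun t : ℝ => ∑ j,
      toMat (x + t • EuclideanSpace.single (i, a) (1 : ℝ)) j b *
      toMat (x + t • EuclideanSpace.single (i, a) (1 : ℝ)) j c)
      (∑ j, ((if j = i ∧ b = a then 1 else 0) * toMat x j c
        + toMat x j b * (if j = i ∧ c = a then 1 else 0))) 0 := by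
    refine HasDerivAt.fun_sum fun j _ => ?_
    have := (toMat_deriv x i a j b).fun_mul (toMat_deriv x i a j c)
    simpa using this
  refine (h.add_const _).congr_deriv ?_
  rw [Finset.sum_add_distrib]
  unfold GP
  congr 1
  · by_cases hb : b = a <;> simp [hb]
  · by_cases hb : c = a <;> simp [hb]

lemma AGP_trace {ε : ℝ} (hε : 0 < ε) (x : EuclideanSpace ℝ (Fin n × Fin m)) (i : Fin n)
    (a : Fin m) : (AA ε x * GP x i a).trace = 2 * WW ε x i a := by
  simp only [Matrix.trace, Matrix.diag, Matrix.mul_apply, GP, mul_add, Finset.sum_add_distrib]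
  simp only [mul_ite, mul_zero, Finset.sum_ite_eq', Finset.mem_univ, if_true, Finset.sum_ite_eq]
  rw [Finset.sum_comm (f := fun b c => if b = a then AA ε x b c * toMat x i c else 0)]
  simp only [Finset.sum_ite_eq', Finset.mem_univ, if_true, WW, Matrix.mul_apply]
  rw [two_mul]
  congr 1 <;> refine Finset.sum_congr rfl fun b _ => ?_
  · rw [mul_comm]
  · rw [mul_comm, AA_symm hε x a b]

lemma AGPA {ε : ℝ} (hε : 0 < ε) (x : EuclideanSpace ℝ (Fin n × Fin m)) (i : Fin n)
    (a b c : Fin m) : (AA ε x * GP x i a * AA ε x) b c =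
      AA ε x b a * WW ε x i c + WW ε x i b * AA ε x a c := by
  have h : ∀ d, (AA ε x * GP x i a) b d = AA ε x b a * toMat x i d +
      (if d = a then WW ε x i b else 0) := by
    intro d
    simp only [Matrix.mul_apply, GP, mul_add, Finset.sum_add_distrib, mul_ite, mul_zero,
      Finset.sum_ite_eq', Finset.mem_univ, if_true]
    congr 1
    by_cases hd : d = a
    · simp only [hd, if_true, WW, Matrix.mul_apply]
      refine Finset.sum_congr rfl fun e _ => ?_
      rw [mul_comm, AA_symm hε x b e]
    · simp [hd]
  rw [Matrix.mul_apply]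
  simp only [h, add_mul, Finset.sum_add_distrib, ite_mul, zero_mul, Finset.sum_ite_eq',
    Finset.mem_univ, if_true]
  congr 1
  rw [WW, Matrix.mul_apply, Finset.mul_sum]
  exact Finset.sum_congr rfl fun d _ => by ring

lemma AA_deriv {ε : ℝ} (hε : 0 < ε) (x : EuclideanSpace ℝ (Fin n × Fin m)) (i : Fin n)
    (a b c : Fin m) :
    HasDerivAt (fun t : ℝ => AA ε (x + t • EuclideanSpace.single (i, a) (1 : ℝ)) b c)
      (-(AA ε x b a * WW ε x i c + WW ε x i b * AA ε x a c)) 0 := by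
  have h := inv_deriv (t₀ := 0)
    (Γ := fun t : ℝ => BB ε (x + t • EuclideanSpace.single (i, a) (1 : ℝ)))
    (BB_deriv ε x i a) (by simpa using (BB_posDef hε x).isUnit) b c
  simp only [zero_smul, add_zero] at h
  rw [← AGPA hε]
  exact h

lemma WW_deriv {ε : ℝ} (hε : 0 < ε) (x : EuclideanSpace ℝ (Fin n × Fin m)) (i : Fin n)
    (a : Fin m) :
    HasDerivAt (fun t : ℝ => WW ε (x + t • EuclideanSpace.single (i, a) (1 : ℝ)) i a)
      (AA ε x a a - WW ε x i a ^ 2 - PP ε x i * AA ε x a a) 0 := by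
  simp only [WW, Matrix.mul_apply]
  have h : HasDerivAt (fun t : ℝ => ∑ b,
      toMat (x + t • EuclideanSpace.single (i, a) (1 : ℝ)) i b *
      AA ε (x + t • EuclideanSpace.single (i, a) (1 : ℝ)) b a)
      (∑ b, ((if i = i ∧ b = a then 1 else 0) * AA ε x b a
        + toMat x i b * (-(AA ε x b a * WW ε x i a + WW ε x i b * AA ε x a a)))) 0 := by
    refine HasDerivAt.fun_sum fun b _ => ?_
    have := (toMat_deriv x i a i b).fun_mul (AA_deriv hε x i a b a)
    simpa using this
  refine h.congr_deriv ?_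
  rw [Finset.sum_add_distrib]
  have e : ∑ b, toMat x i b * AA ε x b a = WW ε x i a := by rw [WW, Matrix.mul_apply]
  have e1 : ∑ b, toMat x i b * (-(AA ε x b a * WW ε x i a + WW ε x i b * AA ε x a a))
      = -(∑ b, toMat x i b * AA ε x b a) * WW ε x i a - PP ε x i * AA ε x a a := by
    rw [PP, ← Finset.sum_neg_distrib, Finset.sum_mul, Finset.sum_mul, ← Finset.sum_sub_distrib]
    exact Finset.sum_congr rfl fun b _ => by ring
  rw [e1, e]
  simp only [true_and, ite_mul, one_mul, zero_mul, Finset.sum_ite_eq', Finset.mem_univ, if_true]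
  ring

lemma fe_deriv {ε : ℝ} (hε : 0 < ε) (x : EuclideanSpace ℝ (Fin n × Fin m)) (i : Fin n)
    (a : Fin m) :
    HasDerivAt (fun t : ℝ => fe ε (x + t • EuclideanSpace.single (i, a) (1 : ℝ)))
      (-((n : ℝ) - m - 1) * fe ε x * WW ε x i a) 0 := by
  have hp := (BB_posDef hε x).det_pos
  have h := jacobi_deriv (t₀ := 0)
    (Γ := fun t : ℝ => BB ε (x + t • EuclideanSpace.single (i, a) (1 : ℝ)))
    (BB_deriv ε x i a)
  have h2 := h.rpow_const (p := -((n : ℝ) - m - 1) / 2) (Or.inl (by simpa using hp.ne'))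
  simp only [zero_smul, add_zero] at h2
  refine h2.congr_deriv ?_
  have e : (BB ε x).adjugate = (BB ε x).det • AA ε x := by
    rw [AA, Matrix.inv_def, smul_smul, Ring.inverse_eq_inv', mul_inv_cancel₀ hp.ne', one_smul]
  rw [e, Matrix.smul_mul, Matrix.trace_smul, AGP_trace hε, fe, Real.rpow_sub_one hp.ne',
    smul_eq_mul]
  field_simp

lemma BB_diff (ε : ℝ) (a b : Fin m) :
    Differentiable ℝ (fun x : EuclideanSpace ℝ (Fin n × Fin m) => BB ε x a b) := by
  simp only [BB, Matrix.add_apply, Matrix.mul_apply, Matrix.transpose_apply, toMat]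
  fun_prop

lemma BB_cont (ε : ℝ) : Continuous (fun x : EuclideanSpace ℝ (Fin n × Fin m) => BB ε x) :=
  continuous_pi fun a => continuous_pi fun b => (BB_diff ε a b).continuous

lemma fe_diff {ε : ℝ} (hε : 0 < ε) :
    Differentiable ℝ (fe ε : EuclideanSpace ℝ (Fin n × Fin m) → ℝ) := by
  have h : Differentiable ℝ (fun x : EuclideanSpace ℝ (Fin n × Fin m) => (BB ε x).det) := by
    simp only [Matrix.det_apply']
    refine Differentiable.fun_sum fun σ _ => (Differentiable.const_mul ?_ _)
    exact fun x => (HasFDerivAt.finsetProd (u := Finset.univ) (g := fun i x => BB ε x (σ i) i) fun i _ => (BB_diff ε (σ i) i x).hasFDerivAt).differentiableAt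
  intro x
  exact (h x).rpow_const (Or.inl (BB_posDef hε x).det_pos.ne')

lemma AA_cont {ε : ℝ} (hε : 0 < ε) (a b : Fin m) :
    Continuous (fun x : EuclideanSpace ℝ (Fin n × Fin m) => AA ε x a b) := by
  have h : (fun x : EuclideanSpace ℝ (Fin n × Fin m) => AA ε x a b) =
      fun x => (BB ε x).det⁻¹ * (BB ε x).adjugate a b := by
    funext x; simp [AA, Matrix.inv_def]
  rw [h]
  refine Continuous.mul (Continuous.inv₀ (BB_cont ε).matrix_det
    fun x => (BB_posDef hε x).det_pos.ne') ?_
  exact (BB_cont ε).matrix_adjugate.matrix_elem a b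

lemma toMat_cont (i : Fin n) (a : Fin m) :
    Continuous (fun x : EuclideanSpace ℝ (Fin n × Fin m) => toMat x i a) := by
  simp only [toMat]; fun_prop

lemma WW_cont {ε : ℝ} (hε : 0 < ε) (i : Fin n) (a : Fin m) :
    Continuous (fun x : EuclideanSpace ℝ (Fin n × Fin m) => WW ε x i a) := by
  simp only [WW, Matrix.mul_apply]
  exact continuous_finsetSum _ fun b _ => (toMat_cont i b).mul (AA_cont hε b a)

lemma PP_cont {ε : ℝ} (hε : 0 < ε) (i : Fin n) :
    Continuous (fun x : EuclideanSpace ℝ (Fin n × Fin m) => PP ε x i) := by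
  simp only [PP]
  exact continuous_finsetSum _ fun b _ => (toMat_cont i b).mul (WW_cont hε i b)

lemma fe_pos {ε : ℝ} (hε : 0 < ε) (x : EuclideanSpace ℝ (Fin n × Fin m)) : 0 < fe ε x :=
  Real.rpow_pos_of_pos (BB_posDef hε x).det_pos _

lemma fe_bdd {ε : ℝ} (hε : 0 < ε) (hc : m + 2 ≤ n) :
    ∃ C, ∀ x : EuclideanSpace ℝ (Fin n × Fin m), fe ε x ≤ C := by
  have hc' : (m : ℝ) + 2 ≤ n := by exact_mod_cast hc
  refine ⟨((m.factorial : ℝ) * (1 / ε) ^ m) ^ (((n : ℝ) - m - 1) / 2), fun x => ?_⟩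
  have hp := (BB_posDef hε x).det_pos
  have h1 : fe ε x = (AA ε x).det ^ (((n : ℝ) - m - 1) / 2) := by
    rw [fe, AA, Matrix.det_nonsing_inv, Ring.inverse_eq_inv', neg_div, Real.rpow_neg hp.le,
      Real.inv_rpow hp.le]
  have h2 : (AA ε x).det ≤ (m.factorial : ℝ) * (1 / ε) ^ m := by
    have := Matrix.det_le (A := AA ε x) (abv := AbsoluteValue.abs) (x := 1 / ε)
      (fun a b => AA_bound hε x a b)
    simp only [Fintype.card_fin, nsmul_eq_mul] at this
    exact (le_abs_self _).trans this
  rw [h1]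
  exact Real.rpow_le_rpow (BB_posDef hε x).inv.det_pos.le h2 (by linarith)

lemma trA_bound {ε : ℝ} (hε : 0 < ε) (x : EuclideanSpace ℝ (Fin n × Fin m)) :
    ∑ a, AA ε x a a ≤ m / ε := by
  calc ∑ a, AA ε x a a ≤ ∑ a : Fin m, 1 / ε :=
        Finset.sum_le_sum fun a _ => (le_abs_self _).trans (AA_bound hε x a a)
    _ = m / ε := by simp [div_eq_mul_inv]

lemma WW_sq_bound {ε : ℝ} (hε : 0 < ε) (x : EuclideanSpace ℝ (Fin n × Fin m)) (i a) :
    WW ε x i a ^ 2 ≤ m / ε := by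
  refine le_trans ?_ (trA_bound hε x)
  have h := WW_sq_sum hε x
  have h1 : WW ε x i a ^ 2 ≤ ∑ b, WW ε x i b ^ 2 :=
    Finset.single_le_sum (f := fun b => WW ε x i b ^ 2) (fun b _ => sq_nonneg _)
      (Finset.mem_univ a)
  have h2 : ∑ b, WW ε x i b ^ 2 ≤ ∑ i, ∑ b, WW ε x i b ^ 2 :=
    Finset.single_le_sum (f := fun i => ∑ b, WW ε x i b ^ 2)
      (fun b _ => Finset.sum_nonneg fun _ _ => sq_nonneg _) (Finset.mem_univ i)
  have h3 : 0 ≤ ∑ a, ∑ c, AA ε x a c ^ 2 :=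
    Finset.sum_nonneg fun _ _ => Finset.sum_nonneg fun _ _ => sq_nonneg _
  nlinarith

lemma PP_bound {ε : ℝ} (hε : 0 < ε) (x : EuclideanSpace ℝ (Fin n × Fin m)) (i) :
    PP ε x i ≤ m := by
  have h := PP_sum hε x
  have h1 : PP ε x i ≤ ∑ i, PP ε x i :=
    Finset.single_le_sum (fun b _ => PP_nonneg hε x b) (Finset.mem_univ i)
  have h2 : 0 ≤ ∑ a, AA ε x a a := Finset.sum_nonneg fun a _ => AA_diag_nonneg hε x a
  nlinarith

/-- first and second derivatives of `fe` -/
noncomputable def dF (ε : ℝ) (p : Fin n × Fin m) (x : EuclideanSpace ℝ (Fin n × Fin m)) : ℝ :=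
  -((n : ℝ) - m - 1) * fe ε x * WW ε x p.1 p.2

noncomputable def ddF (ε : ℝ) (p : Fin n × Fin m) (x : EuclideanSpace ℝ (Fin n × Fin m)) : ℝ :=
  -((n : ℝ) - m - 1) * (fe ε x * (AA ε x p.2 p.2 - WW ε x p.1 p.2 ^ 2 - PP ε x p.1 * AA ε x p.2 p.2)
    - ((n : ℝ) - m - 1) * fe ε x * WW ε x p.1 p.2 ^ 2)

lemma ddF_sum {ε : ℝ} (hε : 0 < ε) (hc : m + 2 ≤ n) (x : EuclideanSpace ℝ (Fin n × Fin m)) :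
    ∑ p, ddF ε p x ≤ 0 := by
  have hc' : (m : ℝ) + 2 ≤ n := by exact_mod_cast hc
  set c : ℝ := (n : ℝ) - m - 1 with hcd
  have hw := WW_sq_sum hε x
  have hP := PP_sum hε x
  have h3 : 0 ≤ ∑ a, ∑ c, AA ε x a c ^ 2 :=
    Finset.sum_nonneg fun _ _ => Finset.sum_nonneg fun _ _ => sq_nonneg _
  have e : ∑ p, ddF ε p x = fe ε x * ((c ^ 2 + c) * (∑ i, ∑ a, WW ε x i a ^ 2)
      - c * n * (∑ a, AA ε x a a) + c * (∑ i, PP ε x i) * (∑ a, AA ε x a a)) := by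
    have e0 : ∀ i a, ddF ε (i, a) x = (fe ε x * (c ^ 2 + c)) * WW ε x i a ^ 2
        - (fe ε x * c) * AA ε x a a + (fe ε x * c * PP ε x i) * AA ε x a a := by
      intro i a; simp only [ddF]; rw [← hcd]; ring
    rw [Fintype.sum_prod_type]
    simp only [e0, Finset.sum_add_distrib, Finset.sum_sub_distrib, ← Finset.mul_sum,
      ← Finset.sum_mul, Finset.sum_const, Finset.card_univ, Fintype.card_fin, nsmul_eq_mul]
    ring
  rw [e, hw, hP]
  have h1 : 1 ≤ c := by linarith
  have hn : (n : ℝ) = m + 1 + c := by rw [hcd]; ring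
  set T := ∑ a, AA ε x a a
  set Q := ∑ a, ∑ c, AA ε x a c ^ 2
  have : (c ^ 2 + c) * (T - ε * Q) - c * n * T + c * (m - ε * T) * T
      = -((c ^ 2 + c) * ε * Q + c * ε * T ^ 2) := by rw [hn]; ring
  rw [this]
  have h4 : 0 ≤ (c ^ 2 + c) * ε * Q + c * ε * T ^ 2 := by positivity
  nlinarith [fe_pos hε x]

lemma fe_antitone {ε : ℝ} (hε : 0 < ε) (hc : m + 2 ≤ n) (X : EuclideanSpace ℝ (Fin n × Fin m)) :
    AntitoneOn (fun s : ℝ => ∫ Z, fe ε (X + s • Z) * Real.exp (-(1 / 2) * ‖Z‖ ^ 2))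
      (Set.Ici 0) := by
  have hc' : (m : ℝ) + 2 ≤ n := by exact_mod_cast hc
  obtain ⟨C0, hC0⟩ := fe_bdd (n := n) (m := m) hε hc
  have hC0p : 0 ≤ C0 := (fe_pos hε 0).le.trans (hC0 0)
  set c : ℝ := (n : ℝ) - m - 1 with hcd
  have h1 : 1 ≤ c := by linarith
  set W := (m : ℝ) / ε with hW
  have hWp : 0 ≤ W := by positivity
  have hWb : ∀ (x : EuclideanSpace ℝ (Fin n × Fin m)) i a, |WW ε x i a| ≤ 1 + W := by
    intro x i a
    have := WW_sq_bound hε x i a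
    refine abs_le_of_sq_le_sq ?_ (by positivity)
    nlinarith
  set C := C0 + c * C0 * (1 + W) + c * (C0 * (1 / ε + W + m * (1 / ε)) + c * C0 * W) with hC
  have t1 : 0 ≤ c * C0 * (1 + W) := by positivity
  have t2 : 0 ≤ c * (C0 * (1 / ε + W + m * (1 / ε)) + c * C0 * W) := by positivity
  refine heat_antitone (d := dF ε) (dd := ddF ε) (C := C) (fe_diff hε) ?_ ?_ ?_ ?_ ?_ ?_ ?_
    (ddF_sum hε hc) X
  · rintro x ⟨i, a⟩
    have h := (fe_diff hε x).hasFDerivAt.hasLineDerivAt (EuclideanSpace.single (i, a) (1 : ℝ))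
    unfold HasLineDerivAt at h
    have h2 := HasDerivAt.unique h (fe_deriv hε x i a)
    convert h2 using 1
    · congr!
    · rfl
  · rintro ⟨i, a⟩
    exact ((fe_diff hε).continuous.const_mul _).mul (WW_cont hε i a)
  · rintro ⟨i, a⟩
    have h1 := (fe_diff (n := n) (m := m) hε).continuous
    have h2 := WW_cont (n := n) hε i a
    have h3 := AA_cont (n := n) hε a a
    have h4 := PP_cont (m := m) hε i
    unfold ddF
    fun_prop
  · rintro ⟨i, a⟩ x
    have h := ((fe_deriv hε x i a).const_mul (-c)).fun_mul (WW_deriv hε x i a)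
    simp only [zero_smul, add_zero] at h
    unfold HasLineDerivAt
    have h' : HasDerivAt (fun t : ℝ => dF ε (i, a) (x + t • EuclideanSpace.single (i, a) (1 : ℝ)))
        (ddF ε (i, a) x) 0 := by
      refine h.congr_deriv ?_
      simp only [ddF]
      ring
    refine h'.congr_of_eventuallyEq (Filter.Eventually.of_forall fun t => ?_)
    congr!
  · intro x
    rw [abs_of_pos (fe_pos hε x)]
    linarith [hC0 x]
  · rintro ⟨i, a⟩ x
    have : |dF ε (i, a) x| ≤ c * C0 * (1 + W) := by
      unfold dF
      rw [abs_mul, abs_mul, abs_neg, abs_of_nonneg (by linarith : 0 ≤ (n : ℝ) - m - 1),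
        abs_of_pos (fe_pos hε x)]
      have := hWb x i a
      have := hC0 x
      have := (fe_pos hε x).le
      gcongr
    linarith
  · rintro ⟨i, a⟩ x
    have hA := AA_bound hε x a a
    have hA0 := AA_diag_nonneg hε x a
    rw [abs_of_nonneg hA0] at hA
    have hw := WW_sq_bound hε x i a
    have hP := PP_bound hε x i
    have hP0 := PP_nonneg hε x i
    have hf := hC0 x
    have hf0 := (fe_pos hε x).le
    have : |ddF ε (i, a) x| ≤ c * (C0 * (1 / ε + W + m * (1 / ε)) + c * C0 * W) := by
      unfold ddF
      rw [abs_mul, abs_neg, abs_of_nonneg (by linarith : 0 ≤ (n : ℝ) - m - 1)]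
      refine mul_le_mul_of_nonneg_left ?_ (by linarith)
      refine (abs_sub _ _).trans (add_le_add ?_ ?_)
      · rw [abs_mul, abs_of_nonneg hf0]
        refine mul_le_mul hf ?_ (abs_nonneg _) hC0p
        refine (abs_sub _ _).trans (add_le_add ((abs_sub _ _).trans (add_le_add ?_ ?_)) ?_)
        · rwa [abs_of_nonneg hA0]
        · rwa [abs_of_nonneg (sq_nonneg _)]
        · rw [abs_of_nonneg (by positivity)]
          gcongr
      · rw [abs_of_nonneg (by positivity)]
        gcongr
    linarith

end PartFiveB

section PartSix
variable {n m : ℕ}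

lemma det_gram_le {ε : ℝ} (hε : 0 < ε) (x : EuclideanSpace ℝ (Fin n × Fin m)) :
    ((toMat x)ᵀ * toMat x).det ≤ (BB ε x).det := by
  set S := (toMat x)ᵀ * toMat x with hS
  have hp : S.PosSemidef := gram_psd x
  have hH := hp.isHermitian
  have h1 : S.det = ∏ i, hH.eigenvalues i := by simpa using hH.det_eq_prod_eigenvalues
  have h2 : (BB ε x).det = ∏ i, (hH.eigenvalues i + ε) := by
    have e1 := Matrix.eval_charpoly S (-ε)
    rw [hH.charpoly_eq, Polynomial.eval_prod] at e1
    have e2 : (Matrix.scalar (Fin m)) (-ε) - S = -(BB ε x) := by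
      rw [BB, ← hS, Matrix.smul_one_eq_diagonal, neg_add]
      simp [sub_eq_add_neg, add_comm, Matrix.scalar_apply]
    rw [e2, Matrix.det_neg] at e1
    have e3 : ∏ i, Polynomial.eval (-ε) (Polynomial.X - Polynomial.C ((hH.eigenvalues i : ℝ)))
        = (-1) ^ (Fintype.card (Fin m)) * ∏ i, (hH.eigenvalues i + ε) := by
      rw [← Finset.card_univ, ← Finset.prod_const, ← Finset.prod_mul_distrib]
      refine Finset.prod_congr rfl fun i _ => ?_
      simp; ring
    have e4 := e3.symm.trans e1
    exact (mul_left_cancel₀ (pow_ne_zero _ (by norm_num)) e4).symm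
  rw [h1, h2]
  refine Finset.prod_le_prod (fun i _ => hp.eigenvalues_nonneg i) fun i _ => by linarith

lemma fe_le_pi {ε : ℝ} (hε : 0 < ε) (hc : m + 2 ≤ n) (x : EuclideanSpace ℝ (Fin n × Fin m)) :
    ENNReal.ofReal (fe ε x) ≤ piSVS n m x := by
  have hc' : (m : ℝ) + 2 ≤ n := by exact_mod_cast hc
  unfold piSVS
  split_ifs with h
  · refine ENNReal.ofReal_le_ofReal ?_
    have h0 : 0 < ((toMat x)ᵀ * toMat x).det :=
      lt_of_le_of_ne (gram_psd x).det_nonneg (Ne.symm h.ne_zero)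
    exact Real.rpow_le_rpow_of_nonpos h0 (det_gram_le hε x) (by linarith)
  · exact le_top

/-- the regularizing sequence -/
noncomputable def ek (k : ℕ) : ℝ := 1 / ((k : ℝ) + 1)

lemma ek_pos (k : ℕ) : 0 < ek k := by unfold ek; positivity

lemma fe_tendsto (hc : m + 2 ≤ n) (x : EuclideanSpace ℝ (Fin n × Fin m)) :
    Filter.Tendsto (fun k => ENNReal.ofReal (fe (ek k) x)) Filter.atTop (nhds (piSVS n m x)) := by
  have hc' : (m : ℝ) + 2 ≤ n := by exact_mod_cast hc
  have hek : Filter.Tendsto ek Filter.atTop (nhds 0) := tendsto_one_div_add_atTop_nhds_zero_nat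
  have hd : Filter.Tendsto (fun k => (BB (ek k) x).det) Filter.atTop
      (nhds ((toMat x)ᵀ * toMat x).det) := by
    have hcont : Continuous (fun ε : ℝ => (BB ε x).det) := by
      unfold BB
      exact Continuous.matrix_det (by fun_prop)
    have := (hcont.tendsto 0).comp hek
    simpa [BB, Function.comp_def] using this
  unfold piSVS
  split_ifs with h
  · refine ENNReal.tendsto_ofReal ?_
    exact hd.rpow_const (Or.inl h.ne_zero)
  · have h0 : ((toMat x)ᵀ * toMat x).det = 0 := by
      by_contra h1; exact h (Ne.isUnit h1)
    rw [h0] at hd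
    refine ENNReal.tendsto_ofReal_atTop.comp ?_
    refine (tendsto_rpow_neg_nhdsGT_zero (y := -((n : ℝ) - m - 1) / 2) (by linarith)).comp ?_
    exact tendsto_nhdsWithin_iff.2 ⟨hd, Filter.Eventually.of_forall fun k =>
      (BB_posDef (ek_pos k) x).det_pos⟩

lemma pi_meas (hc : m + 2 ≤ n) : Measurable (piSVS n m) := by
  refine measurable_of_tendsto_metrizable (f := fun k x => ENNReal.ofReal (fe (ek k) x))
    (fun k => (fe_diff (ek_pos k)).continuous.measurable.ennreal_ofReal) ?_
  exact tendsto_pi_nhds.2 fun x => fe_tendsto hc x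

lemma pi_pos (x : EuclideanSpace ℝ (Fin n × Fin m)) : 0 < piSVS n m x := by
  unfold piSVS
  split_ifs with h
  · have h0 : 0 < ((toMat x)ᵀ * toMat x).det :=
      lt_of_le_of_ne (gram_psd x).det_nonneg (Ne.symm h.ne_zero)
    exact ENNReal.ofReal_pos.2 (Real.rpow_pos_of_pos h0 _)
  · simp

/-- heat-type integral of the prior -/
noncomputable def HT (t : ℝ) (X : EuclideanSpace ℝ (Fin n × Fin m)) : ℝ≥0∞ :=
  ∫⁻ M, piSVS n m M * ENNReal.ofReal (Real.exp (-(t ^ 2 / 2) * ‖X - M‖ ^ 2))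

/-- regularized heat-type integral -/
noncomputable def GT (k : ℕ) (t : ℝ) (X : EuclideanSpace ℝ (Fin n × Fin m)) : ℝ :=
  t ^ (Fintype.card (Fin n × Fin m)) *
    ∫ M, fe (ek k) M * Real.exp (-(t ^ 2 / 2) * ‖X - M‖ ^ 2)

lemma fe_gro (hc : m + 2 ≤ n) (k : ℕ) :
    Gro (fe (ek k) : EuclideanSpace ℝ (Fin n × Fin m) → ℝ) := by
  obtain ⟨C, hC⟩ := fe_bdd (n := n) (m := m) (ek_pos k) hc
  exact gro_of_bdd (fe_diff (ek_pos k)).continuous C fun x => by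
    rw [abs_of_pos (fe_pos (ek_pos k) x)]; exact hC x

lemma GT_lintegral (hc : m + 2 ≤ n) (k : ℕ) {t : ℝ} (ht : 0 < t)
    (X : EuclideanSpace ℝ (Fin n × Fin m)) :
    ENNReal.ofReal (GT k t X) = ENNReal.ofReal (t ^ (Fintype.card (Fin n × Fin m))) *
      ∫⁻ M, ENNReal.ofReal (fe (ek k) M) *
        ENNReal.ofReal (Real.exp (-(t ^ 2 / 2) * ‖X - M‖ ^ 2)) := by
  rw [GT, ENNReal.ofReal_mul (by positivity), ofReal_integral_eq_lintegral_ofReal]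
  · congr 1
    refine lintegral_congr fun M => ?_
    rw [ENNReal.ofReal_mul (fe_pos (ek_pos k) M).le]
  · exact int_gauss adm_volume (fe_gro hc k) X (by positivity)
  · exact Filter.Eventually.of_forall fun M =>
      mul_nonneg (fe_pos (ek_pos k) M).le (Real.exp_pos _).le

lemma GT_le_HT (hc : m + 2 ≤ n) (k : ℕ) {t : ℝ} (ht : 0 < t)
    (X : EuclideanSpace ℝ (Fin n × Fin m)) :
    ENNReal.ofReal (GT k t X) ≤
      ENNReal.ofReal (t ^ (Fintype.card (Fin n × Fin m))) * HT t X := by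
  rw [GT_lintegral hc k ht, HT]
  gcongr with M
  exact fe_le_pi (ek_pos k) hc M

lemma HT_le_of (hc : m + 2 ≤ n) {t : ℝ} (ht : 0 < t)
    (X : EuclideanSpace ℝ (Fin n × Fin m)) (B : ℝ≥0∞)
    (h : ∀ k, ENNReal.ofReal (GT k t X) ≤ B) :
    ENNReal.ofReal (t ^ (Fintype.card (Fin n × Fin m))) * HT t X ≤ B := by
  have e : HT t X = ∫⁻ M, Filter.liminf (fun k => ENNReal.ofReal (fe (ek k) M) *
        ENNReal.ofReal (Real.exp (-(t ^ 2 / 2) * ‖X - M‖ ^ 2))) Filter.atTop := by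
    refine lintegral_congr fun M => ?_
    refine (Filter.Tendsto.liminf_eq ?_).symm
    exact ENNReal.Tendsto.mul_const (fe_tendsto hc M) (Or.inr ENNReal.ofReal_ne_top)
  have h1 : HT t X ≤ Filter.liminf (fun k => ∫⁻ M, ENNReal.ofReal (fe (ek k) M) *
        ENNReal.ofReal (Real.exp (-(t ^ 2 / 2) * ‖X - M‖ ^ 2))) Filter.atTop := by
    rw [e]
    refine lintegral_liminf_le fun k => ?_
    refine ((fe_diff (ek_pos k)).continuous.measurable.ennreal_ofReal).mul ?_
    exact (Continuous.measurable (by fun_prop)).ennreal_ofReal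
  have hp : 0 < t ^ (Fintype.card (Fin n × Fin m)) := by positivity
  have hT0 : ENNReal.ofReal (t ^ (Fintype.card (Fin n × Fin m))) ≠ 0 := by
    simpa using hp
  have hB : HT t X ≤ B / ENNReal.ofReal (t ^ (Fintype.card (Fin n × Fin m))) := by
    refine h1.trans ?_
    refine (Filter.liminf_le_liminf (v := fun _ =>
      B / ENNReal.ofReal (t ^ (Fintype.card (Fin n × Fin m))))
      (Filter.Eventually.of_forall fun k => ?_)).trans (by simp)
    rw [ENNReal.le_div_iff_mul_le (Or.inl hT0) (Or.inl ENNReal.ofReal_ne_top), mul_comm,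
      ← GT_lintegral hc k ht]
    exact h k
  rw [ENNReal.le_div_iff_mul_le (Or.inl hT0) (Or.inl ENNReal.ofReal_ne_top), mul_comm] at hB
  exact hB

lemma GT_mono (hc : m + 2 ≤ n) (k : ℕ) {s t : ℝ} (hs : 0 < s) (hst : s ≤ t)
    (X : EuclideanSpace ℝ (Fin n × Fin m)) : GT k s X ≤ GT k t X := by
  have ht := hs.trans_le hst
  unfold GT
  rw [heat_change _ _ hs, heat_change _ _ ht]
  exact fe_antitone (ek_pos k) hc X (Set.mem_Ici.2 (by positivity))
    (Set.mem_Ici.2 (by positivity)) (inv_anti₀ hs hst)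

lemma GT_le (hc : m + 2 ≤ n) (k : ℕ) {s : ℝ} (hs : 0 < s)
    (X : EuclideanSpace ℝ (Fin n × Fin m)) : GT k s X ≤ fe (ek k) X *
      ∫ Z : EuclideanSpace ℝ (Fin n × Fin m), Real.exp (-(1 / 2) * ‖Z‖ ^ 2) := by
  unfold GT
  rw [heat_change _ _ hs]
  refine (fe_antitone (ek_pos k) hc X (Set.mem_Ici.2 le_rfl)
    (Set.mem_Ici.2 (by positivity)) (by positivity : (0:ℝ) ≤ s⁻¹)).trans ?_
  simp only [zero_smul, add_zero]
  rw [integral_const_mul]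

lemma HT_mono (hc : m + 2 ≤ n) {s t : ℝ} (hs : 0 < s) (hst : s ≤ t)
    (X : EuclideanSpace ℝ (Fin n × Fin m)) :
    ENNReal.ofReal (s ^ (Fintype.card (Fin n × Fin m))) * HT s X ≤
      ENNReal.ofReal (t ^ (Fintype.card (Fin n × Fin m))) * HT t X :=
  HT_le_of hc hs X _ fun k => (ENNReal.ofReal_le_ofReal (GT_mono hc k hs hst X)).trans
    (GT_le_HT hc k (hs.trans_le hst) X)

lemma HT_le (hc : m + 2 ≤ n) {s : ℝ} (hs : 0 < s) (X : EuclideanSpace ℝ (Fin n × Fin m)) :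
    ENNReal.ofReal (s ^ (Fintype.card (Fin n × Fin m))) * HT s X ≤
      piSVS n m X * ENNReal.ofReal
        (∫ Z : EuclideanSpace ℝ (Fin n × Fin m), Real.exp (-(1 / 2) * ‖Z‖ ^ 2)) :=
  HT_le_of hc hs X _ fun k => by
    refine (ENNReal.ofReal_le_ofReal (GT_le hc k hs X)).trans ?_
    rw [ENNReal.ofReal_mul (fe_pos (ek_pos k) X).le]
    gcongr
    exact fe_le_pi (ek_pos k) hc X

/-- a full rank matrix -/
noncomputable def X0 (n m : ℕ) : EuclideanSpace ℝ (Fin n × Fin m) :=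
  WithLp.toLp 2 fun p => if p.1.val = p.2.val then 1 else 0

lemma pi_X0 (hc : m + 2 ≤ n) {r : ℝ} (hr : 0 < r) :
    piSVS n m (r • X0 n m) = ENNReal.ofReal (((r ^ 2) ^ m) ^ (-((n : ℝ) - m - 1) / 2)) := by
  have e : (toMat (r • X0 n m))ᵀ * toMat (r • X0 n m) = (r ^ 2) • (1 : Matrix (Fin m) (Fin m) ℝ) := by
    ext a b
    simp only [Matrix.mul_apply, Matrix.transpose_apply, toMat, X0, PiLp.smul_apply, smul_eq_mul,
      Matrix.smul_apply, Matrix.one_apply]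
    have ha : a.val < n := by omega
    rw [Finset.sum_eq_single (⟨a.val, ha⟩ : Fin n)]
    · by_cases hab : a = b
      · simp [hab]; ring
      · have : ¬ a.val = b.val := fun h => hab (Fin.ext h)
        simp [hab, this]
    · intro i _ hi
      have : ¬ i.val = a.val := fun h => hi (Fin.ext h)
      simp [this]
    · simp
  have e2 : ((toMat (r • X0 n m))ᵀ * toMat (r • X0 n m)).det = (r ^ 2) ^ m := by
    rw [e, Matrix.det_smul]; simp
  unfold piSVS
  rw [e2, if_pos]
  exact (by positivity : (r ^ 2) ^ m ≠ 0).isUnit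

/-- the prior measure -/
noncomputable def MU (n m : ℕ) : Measure (EuclideanSpace ℝ (Fin n × Fin m)) :=
  volume.withDensity (piSVS n m)

lemma MU_lintegral (hc : m + 2 ≤ n) (g : EuclideanSpace ℝ (Fin n × Fin m) → ℝ)
    (hg : Continuous g) :
    ∫⁻ M, ENNReal.ofReal (g M) ∂(MU n m) = ∫⁻ M, piSVS n m M * ENNReal.ofReal (g M) := by
  rw [MU, lintegral_withDensity_eq_lintegral_mul _ (pi_meas hc) hg.measurable.ennreal_ofReal]
  rfl

lemma HT_X0 (hc : m + 2 ≤ n) {t : ℝ} (ht : 0 < t) : HT t (X0 n m) < ⊤ := by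
  have h := HT_le hc ht (X0 n m)
  have e := pi_X0 (m := m) hc (r := 1) one_pos
  rw [one_smul] at e
  rw [e] at h
  have h2 := h.trans_lt (ENNReal.mul_lt_top ENNReal.ofReal_lt_top ENNReal.ofReal_lt_top)
  by_contra hcon
  rw [not_lt_top_iff] at hcon
  rw [hcon, ENNReal.mul_top] at h2
  · exact lt_irrefl _ h2
  · have : 0 < t ^ (Fintype.card (Fin n × Fin m)) := by positivity
    simpa using this

lemma MU_adm (hc : m + 2 ≤ n) : Adm (MU n m) := by
  intro a ha
  have hcont : Continuous fun M : EuclideanSpace ℝ (Fin n × Fin m) =>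
      Real.exp (-a * ‖M‖ ^ 2) := by fun_prop
  refine ⟨hcont.aestronglyMeasurable, ?_⟩
  rw [hasFiniteIntegral_iff_ofReal (Filter.Eventually.of_forall fun M => (Real.exp_pos _).le),
    MU_lintegral hc _ hcont]
  have hb : ∀ M, Real.exp (-a * ‖M‖ ^ 2) ≤ Real.exp (a * ‖X0 n m‖ ^ 2) *
      Real.exp (-(√a ^ 2 / 2) * ‖X0 n m - M‖ ^ 2) := by
    intro M
    rw [← Real.exp_add, Real.sq_sqrt ha.le]
    refine Real.exp_le_exp.2 ?_
    have h1 : ‖X0 n m - M‖ ^ 2 ≤ 2 * ‖X0 n m‖ ^ 2 + 2 * ‖M‖ ^ 2 := by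
      have := norm_sub_le (X0 n m) M
      nlinarith [sq_nonneg (‖X0 n m‖ - ‖M‖), norm_nonneg (X0 n m - M), norm_nonneg (X0 n m),
        norm_nonneg M]
    nlinarith
  calc ∫⁻ M, piSVS n m M * ENNReal.ofReal (Real.exp (-a * ‖M‖ ^ 2))
      ≤ ∫⁻ M, ENNReal.ofReal (Real.exp (a * ‖X0 n m‖ ^ 2)) * (piSVS n m M *
        ENNReal.ofReal (Real.exp (-(√a ^ 2 / 2) * ‖X0 n m - M‖ ^ 2))) := by
        refine lintegral_mono fun M => ?_
        refine (mul_le_mul_right (ENNReal.ofReal_le_ofReal (hb M)) _).trans ?_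
        rw [ENNReal.ofReal_mul (Real.exp_pos _).le]
        exact le_of_eq (by ring)
    _ = ENNReal.ofReal (Real.exp (a * ‖X0 n m‖ ^ 2)) * HT (√a) (X0 n m) := by
        rw [lintegral_const_mul' _ _ ENNReal.ofReal_ne_top, HT]
    _ < ⊤ := ENNReal.mul_lt_top ENNReal.ofReal_lt_top (HT_X0 hc (Real.sqrt_pos.2 ha))

lemma HT_eq (hc : m + 2 ≤ n) {t : ℝ} (ht : 0 < t) (X : EuclideanSpace ℝ (Fin n × Fin m)) :
    HT t X = ENNReal.ofReal (∫ M, Real.exp (-(t ^ 2 / 2) * ‖X - M‖ ^ 2) ∂(MU n m)) := by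
  have hi := int_gauss (MU_adm hc) gro_one X (a := t ^ 2 / 2) (by positivity)
  simp only [one_mul] at hi
  rw [ofReal_integral_eq_lintegral_ofReal hi
    (Filter.Eventually.of_forall fun M => (Real.exp_pos _).le), MU_lintegral hc _ (by fun_prop), HT]

lemma HT_pos (hc : m + 2 ≤ n) (t : ℝ) (X : EuclideanSpace ℝ (Fin n × Fin m)) : 0 < HT t X := by
  unfold HT
  rw [lintegral_pos_iff_support]
  · have : Function.support (fun M : EuclideanSpace ℝ (Fin n × Fin m) =>
      piSVS n m M * ENNReal.ofReal (Real.exp (-(t ^ 2 / 2) * ‖X - M‖ ^ 2))) = Set.univ := by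
      ext M
      simp only [Function.mem_support, Set.mem_univ, iff_true]
      exact mul_ne_zero (pi_pos M).ne' (ENNReal.ofReal_pos.2 (Real.exp_pos _)).ne'
    rw [this]
    exact Measure.measure_univ_pos.2 (NeZero.ne _)
  · exact (pi_meas hc).mul (Continuous.measurable (by fun_prop)).ennreal_ofReal

lemma HT_one (hc : m + 2 ≤ n) (X : EuclideanSpace ℝ (Fin n × Fin m)) :
    HT 1 X = ENNReal.ofReal (HH (MU n m) (fun _ => 1) X) := by
  rw [HT_eq hc one_pos, HH]
  simp

lemma HH_MU_pos (hc : m + 2 ≤ n) (X : EuclideanSpace ℝ (Fin n × Fin m)) :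
    0 < HH (MU n m) (fun _ => 1) X := by
  have := HT_pos hc 1 X
  rw [HT_one hc] at this
  exact ENNReal.ofReal_pos.1 this

lemma MU_mono (hc : m + 2 ≤ n) (X : EuclideanSpace ℝ (Fin n × Fin m)) :
    MonotoneOn (fun t : ℝ => t ^ (Fintype.card (Fin n × Fin m)) *
      ∫ M, Real.exp (-(t ^ 2 / 2) * ‖X - M‖ ^ 2) ∂(MU n m)) (Set.Ioi 0) := by
  intro s hs t ht hst
  have hs : 0 < s := hs
  have ht : 0 < t := ht
  have h := HT_mono hc hs hst X
  rw [HT_eq hc hs, HT_eq hc ht, ← ENNReal.ofReal_mul (by positivity),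
    ← ENNReal.ofReal_mul (by positivity)] at h
  refine (ENNReal.ofReal_le_ofReal_iff ?_).1 h
  exact mul_nonneg (by positivity) (integral_nonneg fun M => (Real.exp_pos _).le)

lemma MU_nonconst (hm : 1 ≤ m) (hc : m + 2 ≤ n) : ∃ X, gv (MU n m) X ≠ 0 := by
  have hc' : (m : ℝ) + 2 ≤ n := by exact_mod_cast hc
  by_contra hcon
  push Not at hcon
  have hconst := const_of_gv_zero (MU_adm hc) (HH_MU_pos hc) hcon
  set I := ∫ Z : EuclideanSpace ℝ (Fin n × Fin m), Real.exp (-(1 / 2) * ‖Z‖ ^ 2) with hI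
  have hI0 : 0 ≤ I := integral_nonneg fun M => (Real.exp_pos _).le
  have hb : ∀ r : ℝ, 0 < r → HH (MU n m) (fun _ => 1) 0 ≤
      ((r ^ 2) ^ m) ^ (-(((n : ℝ) - m - 1) / 2)) * I := by
    intro r hr
    have h := HT_le hc one_pos (r • X0 n m)
    rw [HT_one hc, pi_X0 hc hr, one_pow, ENNReal.ofReal_one, one_mul,
      ← ENNReal.ofReal_mul (by positivity), ENNReal.ofReal_le_ofReal_iff (by positivity)] at h
    rw [hconst 0 (r • X0 n m), ← neg_div]
    exact h
  have hlim : Filter.Tendsto (fun r : ℝ => ((r ^ 2) ^ m) ^ (-(((n : ℝ) - m - 1) / 2)) * I)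
      Filter.atTop (nhds 0) := by
    have h1 := tendsto_rpow_neg_atTop (y := ((n : ℝ) - m - 1) / 2) (by linarith)
    have h2 : Filter.Tendsto (fun r : ℝ => (r ^ 2) ^ m) Filter.atTop Filter.atTop :=
      (Filter.tendsto_pow_atTop (by omega)).comp (Filter.tendsto_pow_atTop (by norm_num))
    simpa using (h1.comp h2).mul_const I
  have := ge_of_tendsto hlim (Filter.eventually_atTop.2 ⟨1, fun r hr => hb r (by linarith)⟩)
  exact absurd (HH_MU_pos hc 0) (not_lt.2 this)

lemma dens_eq (X M : EuclideanSpace ℝ (Fin n × Fin m)) : matGaussDensity n m X M =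
    (2 * Real.pi) ^ (-((n : ℝ) * m) / 2) * Real.exp (-(1 / 2) * ‖X - M‖ ^ 2) := by
  unfold matGaussDensity
  congr 2
  ring

lemma mSVS_eq (hc : m + 2 ≤ n) (X : EuclideanSpace ℝ (Fin n × Fin m)) :
    mSVS n m X = ENNReal.ofReal ((2 * Real.pi) ^ (-((n : ℝ) * m) / 2) *
      HH (MU n m) (fun _ => 1) X) := by
  rw [ENNReal.ofReal_mul (by positivity), ← HT_one hc, HT,
    ← lintegral_const_mul' _ _ ENNReal.ofReal_ne_top]
  refine lintegral_congr fun M => ?_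
  rw [dens_eq, ENNReal.ofReal_mul (by positivity), one_pow]
  ring

end PartSix

theorem stmt9 (n m : ℕ) (hm : 1 ≤ m) (hnm : m + 2 ≤ n)
    (Mhat : EuclideanSpace ℝ (Fin n × Fin m) → EuclideanSpace ℝ (Fin n × Fin m))
    (hMhat : Mhat = fun X =>
      X + gradient (fun Y => Real.log (mSVS n m Y).toReal) X) :
    (∀ X, 0 < mSVS n m X ∧ mSVS n m X ≠ ⊤) ∧
    ∀ M : EuclideanSpace ℝ (Fin n × Fin m),
      (∫ X, ‖Mhat X - M‖ ^ 2 * matGaussDensity n m X M) < (n : ℝ) * m ∧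
      (∫ X, ‖X - M‖ ^ 2 * matGaussDensity n m X M) = (n : ℝ) * m := by
  set K : ℝ := (2 * Real.pi) ^ (-((n : ℝ) * m) / 2) with hK
  have hKpos : 0 < K := Real.rpow_pos_of_pos (by positivity) _
  have hpos := HH_MU_pos (n := n) (m := m) hnm
  have hMh : ∀ X, Mhat X = X + gv (MU n m) X := by
    intro X
    rw [hMhat]
    simp only
    rw [← gv_grad (MU_adm hnm) hpos K hKpos X]
    congr 2
    funext Y
    rw [mSVS_eq hnm, ENNReal.toReal_ofReal (mul_pos hKpos (hpos Y)).le]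
  refine ⟨fun X => ?_, fun M => ?_⟩
  · rw [mSVS_eq hnm]
    exact ⟨ENNReal.ofReal_pos.2 (mul_pos hKpos (hpos X)), ENNReal.ofReal_ne_top⟩
  · have hcard : (Fintype.card (Fin n × Fin m) : ℝ) = n * m := by simp
    have h2 := gauss_second_moment_eq M
    have hKK : K * (2 * Real.pi) ^ ((n : ℝ) * m / 2) = 1 := by
      rw [hK, ← Real.rpow_add (by positivity), neg_div, neg_add_cancel, Real.rpow_zero]
    rw [hcard] at h2
    have e : ∀ g : EuclideanSpace ℝ (Fin n × Fin m) → ℝ,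
        ∫ X, g X * matGaussDensity n m X M =
          K * ∫ X, g X * Real.exp (-(1 / 2) * ‖X - M‖ ^ 2) := by
      intro g
      rw [← integral_const_mul]
      refine integral_congr_ae (Filter.Eventually.of_forall fun X => ?_)
      simp only [dens_eq]
      ring
    have heq : (∫ X, ‖X - M‖ ^ 2 * matGaussDensity n m X M) = (n : ℝ) * m := by
      rw [e, h2]
      linear_combination ((n : ℝ) * m) * hKK
    refine ⟨?_, heq⟩
    rw [← heq, e, e]
    simp only [hMh]
    refine mul_lt_mul_of_pos_left ?_ hKpos
    refine risk_lt (MU_adm hnm) hpos (MU_mono hnm) (MU_nonconst hm hnm) M ?_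
    rw [h2]
    have hn : (0 : ℝ) < n := by exact_mod_cast (by omega : 0 < n)
    have hm' : (0 : ℝ) < m := by exact_mod_cast hm
    positivity
end
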